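/- Let i > 3 be such that #f_{i−1} = #f_{i+1} = 2 and #f_i = 1; write f_i = {d}, and let J be an invariant-factor count function for d. Set a = σ_{i;2,1}²/σ_i², b = σ_{i;1,2}²/σ_i², c = σ_{i;2,2}²/σ_i², and λ₁ = 1+a+b+c, λ₂ = 1+a−b−c, λ₃ = 1−a+b−c. Then for every x ∈ ℝ, lim_{n→∞} (1/n)·#{1 ≤ m ≤ n : J(m) ≤ μ_i·log log n + x·σ_i·(log log n)^{1/2}} = γ³({z ∈ ℝ³ : λ₁^{1/2}·z₁ − λ₂^{1/2}·|z₂| − λ₃^{1/2}·|z₃| ≤ 2x}). -/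

import Mathlib

open MeasureTheory ProbabilityTheory Filter

noncomputable section

/-- A key encoding the lexicographic order on pairs `(φ(q), q)`; this is a valid
encoding on prime powers since every prime power satisfies `q ≤ 2 * φ(q)`. -/
def ppKey (q : ℕ) : ℕ := 2 * Nat.totient q ^ 2 + q

/-- The `n`-th smallest key of a prime power (0-indexed). -/
def ppNthKey (n : ℕ) : ℕ := Nat.nth (fun k => ∃ q : ℕ, IsPrimePow q ∧ ppKey q = k) n

/-- The total φ-sequence `q̃_i` (1-indexed): the enumeration of all prime powers
ordered by nondecreasing totient, with ties broken by increasing size. -/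
def qt (i : ℕ) : ℕ := sInf {q : ℕ | IsPrimePow q ∧ ppKey q = ppNthKey (i - 1)}

/-- `lcm(q̃_1, …, q̃_i)`. -/
def Lseq (i : ℕ) : ℕ := (Finset.Icc 1 i).lcm qt

/-- The universal factor order set `f_i`. -/
def UFO (i : ℕ) : Set ℕ :=
  if Nat.totient (qt i) < Nat.totient (qt (i + 1)) then {Lseq i}
  else {Lseq i, Nat.lcm (Lseq (i - 1)) (qt (i + 1))}

/-- `φ(q̃_i)` as a real number. -/
def phiQ (i : ℕ) : ℝ := (Nat.totient (qt i) : ℝ)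

/-- `μ_i = 1/φ(q̃_i) − 1/φ(q̃_{i+1})`. -/
def muSeq (i : ℕ) : ℝ := 1 / phiQ i - 1 / phiQ (i + 1)

/-- `σ_i = (1/φ(q̃_i) + 1/φ(q̃_{i+1}) − 2/(φ(q̃_i)·φ(q̃_{i+1})))^{1/2}`. -/
def sigSeq (i : ℕ) : ℝ :=
  Real.sqrt (1 / phiQ i + 1 / phiQ (i + 1) - 2 / (phiQ i * phiQ (i + 1)))

/-- `σ_{i;a,b} = (φ(q̃_i)^{−a} + φ(q̃_{i+1})^{−b} − 2/(φ(q̃_i)·φ(q̃_{i+1})))^{1/2}`. -/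
def sigAB (i a b : ℕ) : ℝ :=
  Real.sqrt (1 / phiQ i ^ a + 1 / phiQ (i + 1) ^ b - 2 / (phiQ i * phiQ (i + 1)))

/-- `ν_j = (φ(q̃_j)^{−1}·(1 − φ(q̃_j)^{−1}))^{1/2}`. -/
def nuSeq (j : ℕ) : ℝ := Real.sqrt (1 / phiQ j * (1 - 1 / phiQ j))

/-- `J` is an invariant-factor count function for `d`: whenever `(ℤ/mℤ)ˣ` is isomorphic to
a direct product of cyclic groups `ℤ/λ_1 × ⋯ × ℤ/λ_K` with `1 < λ_1 ∣ λ_2 ∣ ⋯ ∣ λ_K`,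
`J m` is the number of indices `j` with `λ_j = d`. -/
def IsInvCount (d : ℕ) (J : ℕ → ℕ) : Prop :=
  ∀ m : ℕ, 1 ≤ m → ∀ K : ℕ, ∀ lam : Fin K → ℕ,
    (∀ j, 1 < lam j) →
    (∀ j k : Fin K, j ≤ k → lam j ∣ lam k) →
    Nonempty ((ZMod m)ˣ ≃* Multiplicative (∀ j : Fin K, ZMod (lam j))) →
    J m = (Finset.univ.filter fun j : Fin K => lam j = d).card

/-- The number of `m ∈ {1, …, n}` satisfying `P`. -/
def cnt (P : ℕ → Prop) (n : ℕ) : ℕ := {m : ℕ | 1 ≤ m ∧ m ≤ n ∧ P m}.ncard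

/-- The average `(1/n)·∑_{m=1}^n J(m)`. -/
def avg (J : ℕ → ℕ) (n : ℕ) : ℝ := (∑ m ∈ Finset.Icc 1 n, (J m : ℝ)) / n

/-- `log log n`. -/
def LL (n : ℕ) : ℝ := Real.log (Real.log n)

/-- The standard normal cumulative distribution function. -/
def Phi (x : ℝ) : ℝ := (Real.sqrt (2 * Real.pi))⁻¹ * ∫ t in Set.Iic x, Real.exp (-t ^ 2 / 2)

/-- Owen's T-function. -/
def OwenT (h a : ℝ) : ℝ :=
  (2 * Real.pi)⁻¹ * ∫ t in (0:ℝ)..a, Real.exp (-(1 + t ^ 2) * h ^ 2 / 2) / (1 + t ^ 2)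

/-- The skew-normal cumulative distribution function with parameter `α`. -/
def PhiSkew (x α : ℝ) : ℝ := Phi x - 2 * OwenT x α

/-- The standard Gaussian probability measure `γ^k` on `ℝ^k`. -/
def stdGaussian (k : ℕ) : Measure (Fin k → ℝ) :=
  Measure.pi fun _ => gaussianReal 0 1

/-- `ω(m;q,1)`: the number of distinct primes `p ∣ m` with `p ≡ 1 (mod q)`. -/
def omegaQ (m q : ℕ) : ℕ := (m.primeFactors.filter fun p => p % q = 1 % q).card

/-- The correction term `Ē(m;p^α)`. -/
def Ebar (m p α : ℕ) : ℕ :=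
  if p ^ α = 2 ∧ 8 ∣ m then 2
  else if p ^ α = 2 ∧ 4 ∣ m ∧ ¬(8 ∣ m) then 1
  else if p = 2 ∧ 2 ≤ α ∧ 2 ^ (α + 2) ∣ m then 1
  else if p ≠ 2 ∧ p ^ (α + 1) ∣ m then 1
  else 0

/-- `prm(m;q)` for a prime power `q = p^α`: the unique `k` such that `p^k` is the cardinality
of the subgroup `{x ∈ (ℤ/mℤ)ˣ : x^p = 1 and x = y^{p^{α−1}} for some y}` (obtained here as the
`p`-adic valuation of that cardinality; note `p = q.minFac` and `p^{α−1} = q / p`). -/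
def prm (m q : ℕ) : ℕ :=
  (Nat.card {x : (ZMod m)ˣ // x ^ q.minFac = 1 ∧ ∃ y : (ZMod m)ˣ, y ^ (q / q.minFac) = x}).factorization
    q.minFac

/-- `m` is `y`-typical: for all prime powers `q₁, q₂` with `φ(q₁) ≤ y` and `φ(q₁) < φ(q₂)`
one has `prm(m;q₁) > prm(m;q₂)`. -/
def yTypical (y : ℝ) (m : ℕ) : Prop :=
  ∀ q₁ q₂ : ℕ, IsPrimePow q₁ → IsPrimePow q₂ →
    (Nat.totient q₁ : ℝ) ≤ y → Nat.totient q₁ < Nat.totient q₂ →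
    prm m q₂ < prm m q₁

open ArithmeticFunction vonMangoldt in
lemma residueClass_tsum_bound {q : ℕ} [NeZero q] {a : ZMod q} (ha : IsUnit a) :
    ∃ C : ℝ, ∀ x ∈ Set.Ioc (1 : ℝ) 2,
      |∑' n : ℕ, residueClass a n / (n : ℝ) ^ x - (q.totient : ℝ)⁻¹ / (x - 1)| ≤ C := by
  have H {x : ℝ} (hx : 1 < x) :
      ∑' n : ℕ, residueClass a n / (n : ℝ) ^ x =
        (LFunctionResidueClassAux a x).re + (q.totient : ℝ)⁻¹ / (x - 1) := by
    refine Complex.ofReal_injective ?_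
    simp only [Complex.ofReal_tsum, Complex.ofReal_div, Complex.ofReal_cpow (Nat.cast_nonneg _),
      Complex.ofReal_natCast,
      Complex.ofReal_add, Complex.ofReal_inv, Complex.ofReal_sub, Complex.ofReal_one]
    simp_rw [← LFunctionResidueClassAux_real ha hx,
      eqOn_LFunctionResidueClassAux ha <| Set.mem_ofPred.mpr (Complex.ofReal_re x ▸ hx),
      sub_add_cancel, LSeries, LSeries.term]
    refine tsum_congr fun n ↦ ?_
    split_ifs with hn
    · simp only [hn, residueClass_apply_zero, Complex.ofReal_zero, zero_div]
    · rfl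
  have hcont : ContinuousOn (fun x : ℝ ↦ (LFunctionResidueClassAux a x).re) (Set.Icc 1 2) :=
    Complex.continuous_re.continuousOn.comp (t := Set.univ)
      (continuousOn_LFunctionResidueClassAux a)
      (fun ⦃x⦄ a ↦ trivial) |>.comp Complex.continuous_ofReal.continuousOn fun x hx ↦ by
        simpa only [Set.mem_ofPred_eq, Complex.ofReal_re] using hx.1
  obtain ⟨C, hC⟩ := isCompact_Icc.exists_bound_of_continuousOn hcont
  refine ⟨C, fun x hx ↦ ?_⟩
  rw [H hx.1, add_sub_cancel_right]
  simpa using hC x (Set.mem_Icc_of_Ioc hx)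

/-- The indicator function of the primes in the residue class `a`. -/
def primeInd {q : ℕ} (a : ZMod q) (n : ℕ) : ℝ :=
  open Classical in if n.Prime ∧ (n : ZMod q) = a then 1 else 0

lemma primeInd_nonneg {q : ℕ} (a : ZMod q) (n : ℕ) : 0 ≤ primeInd a n := by
  unfold primeInd; split_ifs <;> norm_num

lemma primeInd_le_one {q : ℕ} (a : ZMod q) (n : ℕ) : primeInd a n ≤ 1 := by
  unfold primeInd; split_ifs <;> norm_num

lemma summable_primeInd {q : ℕ} (a : ZMod q) {x : ℝ} (hx : 1 < x) :
    Summable fun n : ℕ ↦ primeInd a n / (n : ℝ) ^ x := by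
  refine Summable.of_nonneg_of_le (fun n ↦ div_nonneg (primeInd_nonneg a n) (by positivity))
    (fun n ↦ ?_) (Real.summable_one_div_nat_rpow.mpr hx)
  gcongr
  exact primeInd_le_one a n

lemma summable_primeInd_log {q : ℕ} (a : ZMod q) {x : ℝ} (hx : 1 < x) :
    Summable fun n : ℕ ↦ primeInd a n * Real.log n / (n : ℝ) ^ x := by
  have hd : (0:ℝ) < (x - 1) / 2 := by linarith
  refine Summable.of_nonneg_of_le (fun n ↦ div_nonneg (mul_nonneg (primeInd_nonneg a n)
    (Real.log_natCast_nonneg n)) (by positivity))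
    (fun n ↦ ?_) ((Real.summable_one_div_nat_rpow.mpr
      (show 1 < (x + 1) / 2 by linarith)).mul_left (1 / ((x - 1) / 2)))
  rcases n.eq_zero_or_pos with rfl | hn
  · simp only [primeInd, Nat.not_prime_zero, false_and, if_false, zero_mul, zero_div]
    exact mul_nonneg (one_div_nonneg.mpr hd.le) (by positivity)
  have hn' : (0:ℝ) < n := by exact_mod_cast hn
  have h1 := Real.log_natCast_le_rpow_div n hd
  rw [div_le_iff₀ (by positivity)]
  calc primeInd a n * Real.log n ≤ 1 * ((n:ℝ) ^ ((x-1)/2) / ((x-1)/2)) := by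
        gcongr
        exact primeInd_le_one a n
    _ = _ := by
        have : (n:ℝ) ^ x = (n:ℝ) ^ ((x-1)/2) * (n:ℝ) ^ ((x+1)/2) := by
          rw [← Real.rpow_add hn']; ring_nf
        rw [this]
        field_simp

open ArithmeticFunction vonMangoldt in
lemma primeInd_log_tsum_bound {q : ℕ} [NeZero q] {a : ZMod q} (ha : IsUnit a) :
    ∃ C : ℝ, ∀ x ∈ Set.Ioc (1 : ℝ) 2,
      |∑' n : ℕ, primeInd a n * Real.log n / (n : ℝ) ^ x - (q.totient : ℝ)⁻¹ / (x - 1)| ≤ C := by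
  obtain ⟨C, hC⟩ := residueClass_tsum_bound ha
  have hs := summable_residueClass_non_primes_div a
  refine ⟨C + ∑' n : ℕ, (if n.Prime then 0 else residueClass a n) / (n:ℝ), fun x hx ↦ ?_⟩
  have hnn : ∀ n : ℕ, 0 ≤ (if n.Prime then 0 else residueClass a n) := fun n ↦ by
    split_ifs
    · exact le_rfl
    · exact residueClass_nonneg a n
  have hle : ∀ n : ℕ, (if n.Prime then 0 else residueClass a n) / (n:ℝ) ^ x ≤
      (if n.Prime then 0 else residueClass a n) / (n:ℝ) := fun n ↦ by
    rcases n.eq_zero_or_pos with rfl | hn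
    · simp
    · have : (1:ℝ) ≤ n := by exact_mod_cast hn
      apply div_le_div_of_nonneg_left (hnn n) (by positivity)
      simpa using Real.rpow_le_rpow_of_exponent_le this hx.1.le
  have hs2 : Summable fun n : ℕ ↦ (if n.Prime then 0 else residueClass a n) / (n:ℝ) ^ x :=
    Summable.of_nonneg_of_le (fun n ↦ div_nonneg (hnn n) (by positivity)) hle hs
  have hsplit : ∑' n : ℕ, residueClass a n / (n : ℝ) ^ x =
      ∑' n : ℕ, primeInd a n * Real.log n / (n : ℝ) ^ x +
      ∑' n : ℕ, (if n.Prime then 0 else residueClass a n) / (n:ℝ) ^ x := by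
    rw [← (summable_primeInd_log a hx.1).tsum_add hs2]
    refine tsum_congr fun n ↦ ?_
    rw [← add_div]
    congr 1
    by_cases hp : n.Prime
    · by_cases h : (n : ZMod q) = a
      · simp [primeInd, hp, h, residueClass, vonMangoldt_apply_prime hp]
      · simp [primeInd, hp, h, residueClass]
    · simp [primeInd, hp]
  have h0 := hs2.tsum_le_tsum hle hs
  have h1 : 0 ≤ ∑' n : ℕ, (if n.Prime then 0 else residueClass a n) / (n:ℝ) ^ x :=
    tsum_nonneg fun n ↦ div_nonneg (hnn n) (by positivity)
  have h2 := hC x hx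
  rw [hsplit, abs_le] at h2
  rw [abs_le]
  constructor <;> linarith [h2.1, h2.2]

lemma primeInd_hasDerivAt {q : ℕ} (a : ZMod q) {x : ℝ} (hx : 1 < x) :
    HasDerivAt (fun x : ℝ ↦ ∑' n : ℕ, primeInd a n / (n : ℝ) ^ x)
      (-∑' n : ℕ, primeInd a n * Real.log n / (n : ℝ) ^ x) x := by
  have key : ∀ (f : ℕ → ℝ) (_ : f 0 = 0) (y : ℝ),
      (LSeries (fun n ↦ (f n : ℂ)) (y : ℂ)) = ((∑' n : ℕ, f n / (n : ℝ) ^ y : ℝ) : ℂ) := by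
    intro f hf y
    rw [Complex.ofReal_tsum, LSeries]
    refine tsum_congr fun n ↦ ?_
    rcases eq_or_ne n 0 with rfl | hn
    · simp [hf]
    · rw [LSeries.term_of_ne_zero hn, Complex.ofReal_div, Complex.ofReal_cpow (Nat.cast_nonneg _),
        Complex.ofReal_natCast]
  have hab : LSeries.abscissaOfAbsConv (fun n ↦ (primeInd a n : ℂ)) < ((x : ℂ).re : EReal) := by
    refine lt_of_le_of_lt (LSeries.abscissaOfAbsConv_le_of_le_const ⟨1, fun n _ ↦ ?_⟩)
      (by rw [Complex.ofReal_re]; exact_mod_cast hx)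
    rw [Complex.norm_real, Real.norm_of_nonneg (primeInd_nonneg a n)]
    exact primeInd_le_one a n
  have h := (LSeries_hasDerivAt hab).real_of_complex
  have e1 : (fun y : ℝ ↦ (LSeries (fun n ↦ (primeInd a n : ℂ)) (y:ℂ)).re) =
      fun y : ℝ ↦ ∑' n : ℕ, primeInd a n / (n : ℝ) ^ y := by
    funext y
    rw [key _ (by simp [primeInd, Nat.not_prime_zero]), Complex.ofReal_re]
  have e2 : (-LSeries (LSeries.logMul fun n ↦ (primeInd a n : ℂ)) (x:ℂ)).re =
      -∑' n : ℕ, primeInd a n * Real.log n / (n : ℝ) ^ x := by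
    have : (LSeries.logMul fun n ↦ (primeInd a n : ℂ)) =
        fun n ↦ ((primeInd a n * Real.log n : ℝ) : ℂ) := by
      funext n
      simp [LSeries.logMul, Complex.natCast_log, mul_comm]
    rw [this, key _ (by simp), Complex.neg_re, Complex.ofReal_re]
  rw [e1, e2] at h
  exact h

lemma primeInd_tsum_bound {q : ℕ} [NeZero q] {a : ZMod q} (ha : IsUnit a) :
    ∃ C : ℝ, ∀ x ∈ Set.Ioc (1 : ℝ) 2,
      |∑' n : ℕ, primeInd a n / (n : ℝ) ^ x + (q.totient : ℝ)⁻¹ * Real.log (x - 1)| ≤ C := by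
  obtain ⟨C, hC⟩ := primeInd_log_tsum_bound ha
  set h : ℝ → ℝ := fun x ↦
    ∑' n : ℕ, primeInd a n / (n : ℝ) ^ x + (q.totient : ℝ)⁻¹ * Real.log (x - 1) with hh
  have hder : ∀ x : ℝ, 1 < x → HasDerivAt h
      (-∑' n : ℕ, primeInd a n * Real.log n / (n : ℝ) ^ x + (q.totient : ℝ)⁻¹ * (1 / (x - 1))) x := by
    intro x hx
    refine (primeInd_hasDerivAt a hx).add (HasDerivAt.const_mul _ ?_)
    exact ((hasDerivAt_id x).sub_const 1).log (by simpa using (sub_pos.mpr hx).ne')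
  have hC0 : 0 ≤ C := (abs_nonneg _).trans (hC 2 (by norm_num))
  refine ⟨C + |h 2|, fun x hx ↦ ?_⟩
  have hb := (convex_Ioc (1:ℝ) 2).norm_image_sub_le_of_norm_hasDerivWithin_le (f := h) (C := C)
    (fun y hy ↦ (hder y hy.1).hasDerivWithinAt) (fun y hy ↦ by
      have := hC y hy
      rw [Real.norm_eq_abs, ← abs_neg]
      convert this using 2
      ring) (show (2:ℝ) ∈ Set.Ioc (1:ℝ) 2 by norm_num) hx
  rw [Real.norm_eq_abs, Real.norm_eq_abs] at hb
  have h3 : |x - 2| ≤ 1 := by rw [abs_le]; constructor <;> linarith [hx.1, hx.2]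
  have h4 : C * |x - 2| ≤ C := by nlinarith
  have h5 : |h x| ≤ |h x - h 2| + |h 2| := by
    simpa using abs_add_le (h x - h 2) (h 2)
  change |h x| ≤ _
  linarith

/-- Mertens' second theorem in arithmetic progressions. -/
theorem mertens_primeInd {q : ℕ} [NeZero q] {a : ZMod q} (ha : IsUnit a) :
    ∃ C : ℝ, ∀ x : ℝ, 3 ≤ x →
      |∑ n ∈ Finset.range (⌊x⌋₊ + 1), primeInd a n / (n : ℝ)
        - (q.totient : ℝ)⁻¹ * Real.log (Real.log x)| ≤ C := by
  obtain ⟨C₁, hC₁⟩ := primeInd_log_tsum_bound ha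
  obtain ⟨C₂, hC₂⟩ := primeInd_tsum_bound ha
  set κ : ℝ := (q.totient : ℝ)⁻¹
  have hκ : 0 ≤ κ := by positivity
  have hC₁0 : 0 ≤ C₁ := (abs_nonneg _).trans (hC₁ 2 (by norm_num))
  refine ⟨C₂ + Real.exp 1 * (κ + C₁), fun x hx ↦ ?_⟩
  have hlog : 1 < Real.log x := by
    rw [Real.lt_log_iff_exp_lt (by linarith)]
    exact Real.exp_one_lt_three.trans_le hx
  set l := Real.log x with hl
  have hl0 : 0 < l := by linarith
  set s : ℝ := 1 + 1 / l with hs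
  have hs1 : 1 < s := by rw [hs]; linarith [show 0 < 1 / l by positivity]
  have hs2 : s ≤ 2 := by
    have : 1 / l ≤ 1 := by rw [div_le_one hl0]; exact hlog.le
    linarith
  have b1 := hC₁ s ⟨hs1, hs2⟩
  have b2 := hC₂ s ⟨hs1, hs2⟩
  have e1 : s - 1 = 1 / l := by rw [hs]; ring
  rw [e1] at b1 b2
  rw [Real.log_div one_ne_zero hl0.ne', Real.log_one, zero_sub] at b2
  set D := ∑' n : ℕ, primeInd a n * Real.log n / (n : ℝ) ^ s
  set G := ∑' n : ℕ, primeInd a n / (n : ℝ) ^ s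
  have hfin : HasSum (fun n : ℕ ↦ if n ∈ Finset.range (⌊x⌋₊ + 1) then primeInd a n / (n:ℝ) else 0)
      (∑ n ∈ Finset.range (⌊x⌋₊ + 1), primeInd a n / (n : ℝ)) := by
    have := hasSum_sum_of_ne_finset_zero (L := .unconditional ℕ) (f := fun n : ℕ ↦
      if n ∈ Finset.range (⌊x⌋₊ + 1) then primeInd a n / (n:ℝ) else 0)
      (s := Finset.range (⌊x⌋₊ + 1)) (fun b hb ↦ by simp only [hb, if_false])
    rwa [Finset.sum_congr rfl (fun n hn ↦ if_pos hn)] at this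
  have hdiff := hfin.sub (summable_primeInd a hs1).hasSum
  have hbd : |∑ n ∈ Finset.range (⌊x⌋₊ + 1), primeInd a n / (n : ℝ) - G| ≤
      Real.exp 1 / l * D := by
    rw [← hdiff.tsum_eq, ← Real.norm_eq_abs]
    refine tsum_of_norm_bounded (f := fun n : ℕ ↦
      (if n ∈ Finset.range (⌊x⌋₊ + 1) then primeInd a n / (n:ℝ) else 0) - primeInd a n / (n:ℝ) ^ s) ((summable_primeInd_log a hs1).hasSum.mul_left _) fun n ↦ ?_
    by_cases hp : primeInd a n = 0
    · simp [hp]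
    have hpn : n.Prime ∧ (n : ZMod q) = a := by
      by_contra hcon; exact hp (by simp [primeInd, hcon])
    have hp1 : primeInd a n = 1 := by simp [primeInd, hpn]
    rw [hp1]
    have hn1 : (1:ℝ) < n := by exact_mod_cast hpn.1.one_lt
    have hn0 : (0:ℝ) < n := by linarith
    have hln : 0 < Real.log n := Real.log_pos hn1
    have hns : (n:ℝ) ^ s = n * Real.exp (Real.log n / l) := by
      rw [hs, Real.rpow_add hn0, Real.rpow_one, Real.rpow_def_of_pos hn0]
      congr 2; ring
    have hE := Real.exp_pos (Real.log n / l)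
    split_ifs with hmem
    · have hnx : (n:ℝ) ≤ x := by
        rw [Finset.mem_range, Nat.lt_succ_iff] at hmem
        exact (Nat.le_floor_iff (by linarith)).mp hmem
      have hr : Real.log n / l ≤ 1 := by
        rw [div_le_one hl0]; exact Real.log_le_log hn0 hnx
      have hr0 : 0 ≤ Real.log n / l := by positivity
      set r := Real.log n / l with hrdef
      have hlnr : Real.log n = r * l := by rw [hrdef]; field_simp
      have h1 : 1 / (n:ℝ) - 1 / (n:ℝ) ^ s = (1 - Real.exp (-r)) / n := by
        rw [hns, Real.exp_neg]; field_simp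
      have h2 : 1 - Real.exp (-r) ≤ r := by linarith [Real.add_one_le_exp (-r)]
      have h3 : 0 ≤ 1 - Real.exp (-r) := by
        have : Real.exp (-r) ≤ 1 := Real.exp_le_one_iff.mpr (by linarith)
        linarith
      have h4 : Real.exp 1 / l * (1 * Real.log n / (n:ℝ) ^ s) = Real.exp (1 - r) * r / n := by
        rw [hns, hlnr, Real.exp_sub]; field_simp
      rw [h1, h4, Real.norm_of_nonneg (by positivity)]
      gcongr
      have : 1 ≤ Real.exp (1 - r) := Real.one_le_exp (by linarith)
      nlinarith
    · have hnx : x < n := by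
        rw [Finset.mem_range, not_lt] at hmem
        exact Nat.lt_of_floor_lt (by omega)
      have h1 : l ≤ Real.log n := Real.log_le_log (by linarith) hnx.le
      have h2 : 1 ≤ Real.exp 1 := Real.one_le_exp (by norm_num)
      rw [zero_sub, norm_neg, Real.norm_of_nonneg (by positivity)]
      have h3 : Real.exp 1 / l * (1 * Real.log n / (n:ℝ) ^ s) =
          (Real.exp 1 * Real.log n / l) * (1 / (n:ℝ) ^ s) := by ring
      rw [h3]
      apply le_mul_of_one_le_left (by positivity)
      rw [le_div_iff₀ hl0]
      nlinarith
  have hD : Real.exp 1 / l * D ≤ Real.exp 1 * (κ + C₁) := by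
    have : D ≤ κ * l + C₁ := by
      have := (abs_le.mp b1).2
      rw [div_div_eq_mul_div, div_one] at this
      linarith
    rw [div_mul_eq_mul_div, mul_div_assoc]
    gcongr
    rw [div_le_iff₀ hl0]
    nlinarith
  rw [abs_le] at b2 hbd ⊢
  constructor <;> linarith [b2.1, b2.2, hbd.1, hbd.2]

lemma norm_exp_I_mul_sub_taylor_le_of_nonneg (k : ℕ) {x : ℝ} (hx : 0 ≤ x) :
    ‖Complex.exp (Complex.I * x) - ∑ j ∈ Finset.range k, (Complex.I * x) ^ j / (j.factorial : ℂ)‖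
      ≤ x ^ k / k.factorial := by
  induction k generalizing x with
  | zero => simp [Complex.norm_exp_I_mul_ofReal]
  | succ k ih =>
    set F : ℕ → ℝ → ℂ := fun k x ↦ Complex.exp (Complex.I * x) -
      ∑ j ∈ Finset.range k, (Complex.I * x) ^ j / (j.factorial : ℂ) with hF
    have hder : ∀ x : ℝ, HasDerivAt (F (k+1)) (Complex.I * F k x) x := by
      intro y
      have h1 : HasDerivAt (fun y : ℝ ↦ Complex.I * (y:ℂ)) Complex.I y := by
        simpa using (Complex.ofRealCLM.hasDerivAt (x := y)).const_mul Complex.I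
      have h2 : ∀ j ∈ Finset.range (k+1), HasDerivAt
          (fun y : ℝ ↦ (Complex.I * (y:ℂ)) ^ j / (j.factorial : ℂ))
          ((j:ℂ) * (Complex.I * (y:ℂ)) ^ (j-1) * Complex.I / (j.factorial : ℂ)) y := by
        intro j _
        exact (h1.pow j).div_const _
      have h3 := h1.cexp.sub (HasDerivAt.fun_sum h2)
      refine h3.congr_deriv ?_
      rw [Finset.sum_range_succ', hF]
      simp only [Nat.cast_zero, zero_mul, zero_div, add_zero, mul_sub, Finset.mul_sum]
      congr 1
      · ring
      · refine Finset.sum_congr rfl fun j _ ↦ ?_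
        rw [Nat.factorial_succ, Nat.add_sub_cancel]
        push_cast
        have : ((j:ℂ)+1) ≠ 0 := by exact_mod_cast Nat.succ_ne_zero j
        have : (j.factorial : ℂ) ≠ 0 := by exact_mod_cast j.factorial_ne_zero
        field_simp
    have hB : ∀ x : ℝ, HasDerivAt (fun x : ℝ ↦ x ^ (k+1) / ((k+1).factorial : ℝ))
        (x ^ k / (k.factorial : ℝ)) x := by
      intro y
      refine ((hasDerivAt_pow (k+1) y).div_const ((k+1).factorial : ℝ)).congr_deriv ?_
      rw [Nat.factorial_succ, Nat.add_sub_cancel]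
      push_cast
      have : ((k:ℝ)+1) ≠ 0 := by exact_mod_cast Nat.succ_ne_zero k
      field_simp
    refine image_norm_le_of_norm_deriv_right_le_deriv_boundary (f := F (k+1))
      (f' := fun x ↦ Complex.I * F k x) (a := 0) (b := x)
      (fun y _ ↦ (hder y).continuousAt.continuousWithinAt)
      (fun y _ ↦ (hder y).hasDerivWithinAt) ?_ hB ?_ ⟨hx, le_rfl⟩
    · simp [hF, Finset.sum_range_succ']
    · intro y hy
      rw [norm_mul, Complex.norm_I, one_mul]
      exact ih hy.1

lemma norm_exp_I_mul_sub_taylor_le (k : ℕ) (x : ℝ) :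
    ‖Complex.exp (Complex.I * x) - ∑ j ∈ Finset.range k, (Complex.I * x) ^ j / (j.factorial : ℂ)‖
      ≤ |x| ^ k / k.factorial := by
  rcases le_total 0 x with hx | hx
  · rw [abs_of_nonneg hx]; exact norm_exp_I_mul_sub_taylor_le_of_nonneg k hx
  · rw [abs_of_nonpos hx]
    have := norm_exp_I_mul_sub_taylor_le_of_nonneg k (neg_nonneg.mpr hx)
    rw [← Complex.norm_conj] at this
    convert this using 2
    simp [map_sub, ← Complex.exp_conj]

/-- The set of elements of `P` dividing `m`. -/
abbrev divs (P : Finset ℕ) (m : ℕ) : Finset ℕ := P.filter (· ∣ m)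

section Expectation
variable {E : Type*} [NormedAddCommGroup E] [NormedSpace ℝ E]

/-- Average over `1 ≤ m ≤ n` of a function of the set of `p ∈ P` dividing `m`. -/
def expU (n : ℕ) (P : Finset ℕ) (g : Finset ℕ → E) : E :=
  (n : ℝ)⁻¹ • ∑ m ∈ Finset.Ioc 0 n, g (divs P m)

/-- Weight of `A ⊆ P` when each `p ∈ P` is selected independently with probability `1/p`. -/
def wI (P A : Finset ℕ) : ℝ := (∏ p ∈ A, (p : ℝ)⁻¹) * ∏ p ∈ P \ A, (1 - (p : ℝ)⁻¹)

/-- Expectation in the independent model. -/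
def expI (P : Finset ℕ) (g : Finset ℕ → E) : E := ∑ A ∈ P.powerset, wI P A • g A

lemma wI_nonneg (P A : Finset ℕ) : 0 ≤ wI P A := by
  refine mul_nonneg (Finset.prod_nonneg fun p _ ↦ by positivity)
    (Finset.prod_nonneg fun p _ ↦ ?_)
  have : (p:ℝ)⁻¹ ≤ 1 := Nat.cast_inv_le_one p
  linarith

lemma expI_prod {𝕜 : Type*} [RCLike 𝕜] (P : Finset ℕ) (z : ℕ → 𝕜) :
    expI P (fun A ↦ ∏ p ∈ A, z p) = ∏ p ∈ P, (1 + (z p - 1) / (p : 𝕜)) := by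
  have : ∀ p ∈ P, (1 + (z p - 1) / (p : 𝕜)) = (p : 𝕜)⁻¹ * z p + (1 - (p : 𝕜)⁻¹) := by
    intro p _; ring
  rw [Finset.prod_congr rfl this, Finset.prod_add]
  unfold expI wI
  refine Finset.sum_congr rfl fun A _ ↦ ?_
  rw [Finset.prod_mul_distrib, RCLike.real_smul_eq_coe_mul]
  push_cast
  ring

lemma expI_mono {P : Finset ℕ} {g h : Finset ℕ → ℝ} (H : ∀ A ⊆ P, g A ≤ h A) :
    expI P g ≤ expI P h :=
  Finset.sum_le_sum fun A hA ↦
    smul_le_smul_of_nonneg_left (H A (Finset.mem_powerset.mp hA)) (wI_nonneg P A)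

lemma norm_expI_le {P : Finset ℕ} {g : Finset ℕ → E} {h : Finset ℕ → ℝ}
    (H : ∀ A ⊆ P, ‖g A‖ ≤ h A) : ‖expI P g‖ ≤ expI P h := by
  refine (norm_sum_le _ _).trans (Finset.sum_le_sum fun A hA ↦ ?_)
  rw [norm_smul, Real.norm_of_nonneg (wI_nonneg P A)]
  exact mul_le_mul_of_nonneg_left (H A (Finset.mem_powerset.mp hA)) (wI_nonneg P A)

lemma norm_expU_le {n : ℕ} {P : Finset ℕ} {g : Finset ℕ → E} {h : Finset ℕ → ℝ}
    (H : ∀ A, ‖g A‖ ≤ h A) : ‖expU n P g‖ ≤ expU n P h := by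
  unfold expU
  rw [norm_smul, Real.norm_of_nonneg (by positivity)]
  exact mul_le_mul_of_nonneg_left ((norm_sum_le _ _).trans (Finset.sum_le_sum fun _ _ ↦ H _))
    (by positivity)

lemma expI_add (P : Finset ℕ) (g h : Finset ℕ → E) :
    expI P (fun A ↦ g A + h A) = expI P g + expI P h := by
  simp [expI, Finset.sum_add_distrib]

lemma expU_add (n : ℕ) (P : Finset ℕ) (g h : Finset ℕ → E) :
    expU n P (fun A ↦ g A + h A) = expU n P g + expU n P h := by
  simp [expU, Finset.sum_add_distrib]

lemma expI_sum {ι : Type*} (P : Finset ℕ) (s : Finset ι) (g : ι → Finset ℕ → E) :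
    expI P (fun A ↦ ∑ i ∈ s, g i A) = ∑ i ∈ s, expI P (g i) := by
  unfold expI
  rw [Finset.sum_comm]
  simp [Finset.smul_sum]

lemma expU_sum {ι : Type*} (n : ℕ) (P : Finset ℕ) (s : Finset ι) (g : ι → Finset ℕ → E) :
    expU n P (fun A ↦ ∑ i ∈ s, g i A) = ∑ i ∈ s, expU n P (g i) := by
  unfold expU
  rw [Finset.sum_comm, Finset.smul_sum]

lemma expI_smul (P : Finset ℕ) (c : E) (g : Finset ℕ → ℝ) :
    expI P (fun A ↦ g A • c) = expI P g • c := by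
  simp [expI, Finset.sum_smul, smul_smul]

lemma expU_smul (n : ℕ) (P : Finset ℕ) (c : E) (g : Finset ℕ → ℝ) :
    expU n P (fun A ↦ g A • c) = expU n P g • c := by
  unfold expU
  rw [← Finset.sum_smul, smul_assoc]

end Expectation

lemma expU_indicator {n : ℕ} {P E : Finset ℕ} (hP : ∀ p ∈ P, p.Prime) (hE : E ⊆ P) :
    expU n P (fun A ↦ if E ⊆ A then (1:ℝ) else 0) = (n : ℝ)⁻¹ * ((n / ∏ p ∈ E, p : ℕ) : ℝ) := by
  unfold expU
  rw [smul_eq_mul, ← Nat.Ioc_filter_dvd_card_eq_div, Finset.sum_boole]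
  congr 3
  refine Finset.filter_congr fun m _ ↦ ?_
  constructor
  · intro h
    refine Finset.prod_primes_dvd m (fun p hp ↦ (hP p (hE hp)).prime) fun p hp ↦ ?_
    exact (Finset.mem_filter.mp (h hp)).2
  · intro h p hp
    exact Finset.mem_filter.mpr ⟨hE hp, (Finset.dvd_prod_of_mem _ hp).trans h⟩

lemma expI_indicator {P E : Finset ℕ} (hE : E ⊆ P) :
    expI P (fun A ↦ if E ⊆ A then (1:ℝ) else 0) = ((∏ p ∈ E, p : ℕ) : ℝ)⁻¹ := by
  have h1 : ∏ p ∈ P, ((p:ℝ)⁻¹ + (if p ∈ E then 0 else (1 - (p:ℝ)⁻¹))) =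
      ((∏ p ∈ E, p : ℕ) : ℝ)⁻¹ := by
    rw [← Finset.prod_subset hE]
    · push_cast
      rw [← Finset.prod_inv_distrib]
      exact Finset.prod_congr rfl fun p hp ↦ by simp [hp]
    · intro p _ hp; simp [hp]
  rw [← h1, Finset.prod_add]
  unfold expI wI
  refine Finset.sum_congr rfl fun A hA ↦ ?_
  rw [smul_eq_mul, mul_assoc]
  congr 1
  dsimp only
  split_ifs with h
  · rw [mul_one]
    refine Finset.prod_congr rfl fun p hp ↦ ?_
    rw [if_neg]
    exact fun hpE ↦ (Finset.mem_sdiff.mp hp).2 (h hpE)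
  · rw [mul_zero, eq_comm]
    obtain ⟨p, hp, hpA⟩ := Finset.not_subset.mp h
    exact Finset.prod_eq_zero (Finset.mem_sdiff.mpr ⟨hE hp, hpA⟩) (if_pos hp)

/-- The centred additive function. -/
def linA (P : Finset ℕ) (f : ℕ → ℝ) (A : Finset ℕ) : ℝ :=
  ∑ p ∈ A, f p - ∑ p ∈ P, f p / p

lemma moment_indicator_diff {n : ℕ} (hn : 0 < n) {P : Finset ℕ} (hP : ∀ p ∈ P, p.Prime)
    (f : ℕ → ℝ) {B : ℝ} (hB : ∑ p ∈ P, |f p| + |∑ p ∈ P, f p / p| ≤ B) (j : ℕ) :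
    ∀ E ⊆ P, |expU n P (fun A ↦ if E ⊆ A then linA P f A ^ j else 0) -
      expI P (fun A ↦ if E ⊆ A then linA P f A ^ j else 0)| ≤ B ^ j / n := by
  have hn' : (0:ℝ) < n := by exact_mod_cast hn
  have hB0 : 0 ≤ B := le_trans (by positivity) hB
  induction j with
  | zero =>
    intro E hE
    simp only [pow_zero]
    rw [expU_indicator hP hE, expI_indicator hE]
    set D := ∏ p ∈ E, p with hD
    have hD0 : 0 < D := Finset.prod_pos fun p hp ↦ (hP p (hE hp)).pos
    have hD' : (0:ℝ) < D := by exact_mod_cast hD0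
    have h1 : ((n / D : ℕ) : ℝ) * D ≤ n := by exact_mod_cast Nat.div_mul_le_self n D
    have h2 : (n : ℝ) ≤ ((n / D : ℕ) : ℝ) * D + D := by
      have := Nat.lt_div_mul_add (a := n) hD0
      exact_mod_cast this.le
    have : (n:ℝ)⁻¹ * ((n / D : ℕ) : ℝ) - (D:ℝ)⁻¹ = (((n / D : ℕ) : ℝ) * D - n) / D / n := by
      field_simp
    rw [this, abs_div, abs_of_pos hn']
    gcongr
    rw [abs_div, abs_of_pos hD', div_le_one hD', abs_le]
    constructor <;> linarith
  | succ j ih =>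
    intro E hE
    have key : ∀ (A : Finset ℕ), A ⊆ P → (if E ⊆ A then linA P f A ^ (j+1) else 0) =
        ∑ p ∈ P, (if insert p E ⊆ A then linA P f A ^ j else 0) • f p +
          (if E ⊆ A then linA P f A ^ j else 0) • (-∑ p ∈ P, f p / p) := by
      intro A hA
      by_cases h : E ⊆ A
      · simp only [Finset.insert_subset_iff, h, and_true, if_true, smul_eq_mul, ite_mul, zero_mul]
        rw [← Finset.sum_filter, ← Finset.mul_sum, ← mul_add, pow_succ]
        congr 1
        unfold linA
        rw [sub_eq_add_neg]
        congr 2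
        ext p
        simpa using @hA p
      · simp [Finset.insert_subset_iff, h]
    have hU : expU n P (fun A ↦ if E ⊆ A then linA P f A ^ (j+1) else 0) =
        ∑ p ∈ P, expU n P (fun A ↦ if insert p E ⊆ A then linA P f A ^ j else 0) • f p +
        expU n P (fun A ↦ if E ⊆ A then linA P f A ^ j else 0) • (-∑ p ∈ P, f p / p) := by
      simp_rw [← expU_smul]
      rw [← expU_sum, ← expU_add]
      unfold expU
      congr 1
      exact Finset.sum_congr rfl fun m _ ↦ key _ (Finset.filter_subset _ _)
    have hI : expI P (fun A ↦ if E ⊆ A then linA P f A ^ (j+1) else 0) =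
        ∑ p ∈ P, expI P (fun A ↦ if insert p E ⊆ A then linA P f A ^ j else 0) • f p +
        expI P (fun A ↦ if E ⊆ A then linA P f A ^ j else 0) • (-∑ p ∈ P, f p / p) := by
      simp_rw [← expI_smul]
      rw [← expI_sum, ← expI_add]
      unfold expI
      refine Finset.sum_congr rfl fun A hA ↦ ?_
      exact congrArg _ (key A (Finset.mem_powerset.mp hA))
    rw [hU, hI, add_sub_add_comm, ← Finset.sum_sub_distrib, ← sub_smul]
    simp_rw [← sub_smul]
    refine (abs_add_le _ _).trans ?_
    have h1 : |∑ p ∈ P, (expU n P (fun A ↦ if insert p E ⊆ A then linA P f A ^ j else 0) -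
        expI P (fun A ↦ if insert p E ⊆ A then linA P f A ^ j else 0)) • f p| ≤
        B ^ j / n * ∑ p ∈ P, |f p| := by
      refine (Finset.abs_sum_le_sum_abs _ _).trans ?_
      rw [Finset.mul_sum]
      refine Finset.sum_le_sum fun p hp ↦ ?_
      rw [smul_eq_mul, abs_mul]
      gcongr
      exact ih _ (Finset.insert_subset hp hE)
    have h2 : |(expU n P (fun A ↦ if E ⊆ A then linA P f A ^ j else 0) -
        expI P (fun A ↦ if E ⊆ A then linA P f A ^ j else 0)) • (-∑ p ∈ P, f p / p)| ≤
        B ^ j / n * |∑ p ∈ P, f p / p| := by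
      rw [smul_eq_mul, abs_mul, abs_neg]
      gcongr
      exact ih _ hE
    calc _ ≤ B ^ j / n * ∑ p ∈ P, |f p| + B ^ j / n * |∑ p ∈ P, f p / p| := add_le_add h1 h2
      _ = B ^ j / n * (∑ p ∈ P, |f p| + |∑ p ∈ P, f p / p|) := by ring
      _ ≤ B ^ j / n * B := by gcongr
      _ = B ^ (j+1) / n := by ring

lemma moment_diff {n : ℕ} (hn : 0 < n) {P : Finset ℕ} (hP : ∀ p ∈ P, p.Prime)
    (f : ℕ → ℝ) {B : ℝ} (hB : ∑ p ∈ P, |f p| + |∑ p ∈ P, f p / p| ≤ B) (j : ℕ) :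
    |expU n P (fun A ↦ linA P f A ^ j) - expI P (fun A ↦ linA P f A ^ j)| ≤ B ^ j / n := by
  simpa using moment_indicator_diff hn hP f hB j ∅ (Finset.empty_subset _)

lemma expI_exp_linA_le {P : Finset ℕ} {f : ℕ → ℝ} (hf : ∀ p ∈ P, |f p| ≤ 1) :
    expI P (fun A ↦ Real.exp (linA P f A)) ≤ Real.exp (∑ p ∈ P, f p ^ 2 / p) := by
  have h1 : expI P (fun A ↦ Real.exp (linA P f A)) =
      (∏ p ∈ P, (1 + (Real.exp (f p) - 1) / (p : ℝ))) * Real.exp (-∑ p ∈ P, f p / p) := by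
    rw [← expI_prod (𝕜 := ℝ) P (fun p ↦ Real.exp (f p)), ← smul_eq_mul, ← expI_smul]
    unfold linA
    congr 1
    funext A
    rw [smul_eq_mul, ← Real.exp_sum, ← Real.exp_add, sub_eq_add_neg]
  rw [h1]
  have h2 : ∏ p ∈ P, (1 + (Real.exp (f p) - 1) / (p : ℝ)) ≤
      Real.exp (∑ p ∈ P, (Real.exp (f p) - 1) / (p : ℝ)) := by
    rw [Real.exp_sum]
    refine Finset.prod_le_prod (fun p _ ↦ ?_) fun p _ ↦ ?_
    · rcases p.eq_zero_or_pos with rfl | hp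
      · simp
      · have hp' : (1:ℝ) ≤ p := by exact_mod_cast hp
        have : -1 ≤ (Real.exp (f p) - 1) / (p : ℝ) := by
          rw [le_div_iff₀ (by linarith)]
          nlinarith [Real.exp_pos (f p)]
        linarith
    · linarith [Real.add_one_le_exp ((Real.exp (f p) - 1) / (p : ℝ))]
  calc _ ≤ Real.exp (∑ p ∈ P, (Real.exp (f p) - 1) / (p : ℝ)) *
        Real.exp (-∑ p ∈ P, f p / p) := by gcongr
    _ = Real.exp (∑ p ∈ P, (Real.exp (f p) - 1 - f p) / (p : ℝ)) := by
        rw [← Real.exp_add, ← sub_eq_add_neg, ← Finset.sum_sub_distrib]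
        congr 1
        exact Finset.sum_congr rfl fun p _ ↦ by ring
    _ ≤ _ := by
        gcongr with p hp
        exact (le_abs_self _).trans (Real.abs_exp_sub_one_sub_id_le (hf p hp))

lemma linA_const_mul (P : Finset ℕ) (f : ℕ → ℝ) (c : ℝ) (A : Finset ℕ) :
    linA P (fun p ↦ c * f p) A = c * linA P f A := by
  simp [linA, mul_sub, Finset.mul_sum, mul_div_assoc]

lemma expI_even_moment_le {P : Finset ℕ} {f : ℕ → ℝ} (hf : ∀ p ∈ P, |f p| ≤ 1 / 2) (k : ℕ) :
    expI P (fun A ↦ linA P f A ^ (2 * k)) / ((2 * k).factorial : ℝ) ≤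
      2 * (1 / 4) ^ k * Real.exp (4 * ∑ p ∈ P, f p ^ 2 / p) := by
  have h1 : ∀ c : ℝ, |c| = 2 → expI P (fun A ↦ Real.exp (c * linA P f A)) ≤
      Real.exp (4 * ∑ p ∈ P, f p ^ 2 / p) := by
    intro c hc
    have := expI_exp_linA_le (P := P) (f := fun p ↦ c * f p) (fun p hp ↦ by
      rw [abs_mul, hc]; linarith [hf p hp])
    simp only [linA_const_mul] at this
    refine this.trans (le_of_eq ?_)
    rw [Finset.mul_sum]
    congr 1
    refine Finset.sum_congr rfl fun p _ ↦ ?_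
    rw [mul_pow, ← sq_abs c, hc]; ring
  have h2 := h1 2 (by norm_num)
  have h3 := h1 (-2) (by norm_num)
  have h4 : expI P (fun A ↦ linA P f A ^ (2 * k)) ≤
      expI P (fun A ↦ (Real.exp (2 * linA P f A) + Real.exp (-2 * linA P f A)) •
        ((1 / 4) ^ k * ((2 * k).factorial : ℝ))) := by
    refine expI_mono fun A _ ↦ ?_
    set L := linA P f A
    have h5 := Real.pow_div_factorial_le_exp _ (abs_nonneg (2 * L)) (2 * k)
    rw [(even_two_mul k).pow_abs, div_le_iff₀ (by positivity), mul_pow] at h5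
    have h6 : Real.exp |2 * L| ≤ Real.exp (2 * L) + Real.exp (-2 * L) := by
      rcases abs_cases (2 * L) with ⟨h, _⟩ | ⟨h, _⟩ <;> rw [h]
      · linarith [Real.exp_pos (-2 * L)]
      · rw [← neg_mul]; linarith [Real.exp_pos (2 * L)]
    have h7 : (2:ℝ) ^ (2 * k) = 4 ^ k := by rw [pow_mul]; norm_num
    rw [h7] at h5
    have h8 : L ^ (2 * k) = (1 / 4) ^ k * (4 ^ k * L ^ (2 * k)) := by
      rw [← mul_assoc, ← mul_pow]; norm_num
    rw [h8, smul_eq_mul]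
    calc _ ≤ (1 / 4 : ℝ) ^ k * (Real.exp |2 * L| * ((2 * k).factorial : ℝ)) := by gcongr
      _ ≤ (1 / 4 : ℝ) ^ k * ((Real.exp (2 * L) + Real.exp (-2 * L)) *
          ((2 * k).factorial : ℝ)) := by gcongr
      _ = _ := by ring
  rw [expI_smul, expI_add, smul_eq_mul] at h4
  rw [div_le_iff₀ (by positivity)]
  refine h4.trans ?_
  have : 0 ≤ (1 / 4 : ℝ) ^ k * ((2 * k).factorial : ℝ) := by positivity
  nlinarith

/-- Comparison of the characteristic functions of the arithmetic and the independent model. -/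
lemma norm_expU_sub_expI_le {n : ℕ} (hn : 0 < n) {P : Finset ℕ} (hP : ∀ p ∈ P, p.Prime)
    {f : ℕ → ℝ} (hf : ∀ p ∈ P, |f p| ≤ 1 / 2) (k : ℕ) :
    ‖expU n P (fun A ↦ Complex.exp (Complex.I * linA P f A)) -
      expI P (fun A ↦ Complex.exp (Complex.I * linA P f A))‖ ≤
      (2 * k + 1) * (P.card + 1) ^ (2 * k) / n +
        4 * (1 / 4) ^ k * Real.exp (4 * ∑ p ∈ P, f p ^ 2 / p) := by
  have hn' : (0:ℝ) < n := by exact_mod_cast hn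
  set B : ℝ := P.card + 1 with hBdef
  have hB1 : 1 ≤ B := by rw [hBdef]; linarith [Nat.cast_nonneg (α := ℝ) P.card]
  have hB : ∑ p ∈ P, |f p| + |∑ p ∈ P, f p / p| ≤ B := by
    have h1 : ∑ p ∈ P, |f p| ≤ P.card * (1 / 2) := by
      rw [← nsmul_eq_mul]; exact Finset.sum_le_card_nsmul _ _ _ hf
    have h2 : |∑ p ∈ P, f p / p| ≤ P.card * (1 / 2) := by
      refine (Finset.abs_sum_le_sum_abs _ _).trans ?_
      rw [← nsmul_eq_mul]
      refine Finset.sum_le_card_nsmul _ _ _ fun p hp ↦ ?_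
      have : (1:ℝ) ≤ p := by exact_mod_cast (hP p hp).one_le
      rw [abs_div, abs_of_pos (by linarith : (0:ℝ) < p)]
      exact (div_le_self (abs_nonneg _) this).trans (hf p hp)
    linarith
  have hmom : ∀ j ≤ 2 * k, |expU n P (fun A ↦ linA P f A ^ j) -
      expI P (fun A ↦ linA P f A ^ j)| ≤ B ^ (2 * k) / n := fun j hj ↦ by
    refine (moment_diff hn hP f hB j).trans ?_
    gcongr
  set T : Finset ℕ → ℂ := fun A ↦ ∑ j ∈ Finset.range (2 * k),
    (linA P f A ^ j) • (Complex.I ^ j / (j.factorial : ℂ)) with hT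
  set R : Finset ℕ → ℂ := fun A ↦ Complex.exp (Complex.I * linA P f A) - T A with hR
  have hRb : ∀ A, ‖R A‖ ≤ linA P f A ^ (2 * k) • ((2 * k).factorial : ℝ)⁻¹ := by
    intro A
    have := norm_exp_I_mul_sub_taylor_le (2 * k) (linA P f A)
    rw [(even_two_mul k).pow_abs] at this
    rw [smul_eq_mul, ← div_eq_mul_inv]
    refine le_trans (le_of_eq ?_) this
    simp only [hR, hT]
    congr 2
    refine Finset.sum_congr rfl fun j _ ↦ ?_
    rw [Complex.real_smul, mul_pow]
    push_cast
    ring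
  have hsplit : (fun A ↦ Complex.exp (Complex.I * linA P f A)) = fun A ↦ T A + R A := by
    funext A; simp [hR]
  have hTd : ‖expU n P T - expI P T‖ ≤ 2 * k * (B ^ (2 * k) / n) := by
    rw [hT, expU_sum, expI_sum, ← Finset.sum_sub_distrib]
    have : (2 * k * (B ^ (2 * k) / n) : ℝ) = ∑ j ∈ Finset.range (2 * k), B ^ (2 * k) / n := by
      simp
    rw [this]
    refine norm_sum_le_of_le _ fun j hj ↦ ?_
    rw [expU_smul, expI_smul, ← sub_smul, norm_smul, Real.norm_eq_abs]
    have h1 : ‖Complex.I ^ j / (j.factorial : ℂ)‖ ≤ 1 := by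
      rw [norm_div, norm_pow, Complex.norm_I, one_pow, Complex.norm_natCast]
      exact div_le_one_of_le₀ (by exact_mod_cast j.factorial_pos) (by positivity)
    calc _ ≤ B ^ (2 * k) / n * 1 := by
          gcongr
          exact hmom j (Finset.mem_range.mp hj).le
      _ = _ := mul_one _
  have hUR := norm_expU_le (n := n) (P := P) hRb
  have hIR := norm_expI_le (P := P) (fun A _ ↦ hRb A)
  rw [expU_smul, smul_eq_mul, ← div_eq_mul_inv] at hUR
  rw [expI_smul, smul_eq_mul, ← div_eq_mul_inv] at hIR
  have hM := expI_even_moment_le hf k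
  have hUM : expU n P (fun A ↦ linA P f A ^ (2 * k)) / ((2 * k).factorial : ℝ) ≤
      expI P (fun A ↦ linA P f A ^ (2 * k)) / ((2 * k).factorial : ℝ) + B ^ (2 * k) / n := by
    have h1 := (abs_le.mp (hmom (2 * k) le_rfl)).2
    have h2 : (1:ℝ) ≤ ((2 * k).factorial : ℝ) := by exact_mod_cast (2 * k).factorial_pos
    rw [div_add' _ _ _ (by positivity)]
    gcongr
    have : B ^ (2 * k) / n * 1 ≤ B ^ (2 * k) / n * ((2 * k).factorial : ℝ) := by gcongr
    linarith
  rw [hsplit, expU_add, expI_add, add_sub_add_comm]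
  have h1 := norm_add_le (expU n P T - expI P T) (expU n P R - expI P R)
  have h2 := norm_sub_le (expU n P R) (expI P R)
  have h3 : (2 * k + 1) * B ^ (2 * k) / n = 2 * k * (B ^ (2 * k) / n) + B ^ (2 * k) / n := by ring
  rw [h3]
  linarith

lemma norm_prod_sub_prod_le {ι : Type*} (s : Finset ι) {a b : ι → ℂ}
    (ha : ∀ i ∈ s, ‖a i‖ ≤ 1) (hb : ∀ i ∈ s, ‖b i‖ ≤ 1) :
    ‖∏ i ∈ s, a i - ∏ i ∈ s, b i‖ ≤ ∑ i ∈ s, ‖a i - b i‖ := by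
  classical
  induction s using Finset.induction_on with
  | empty => simp
  | insert i s hi ih =>
    rw [Finset.prod_insert hi, Finset.prod_insert hi, Finset.sum_insert hi]
    have h1 := ih (fun j hj ↦ ha j (Finset.mem_insert_of_mem hj))
      (fun j hj ↦ hb j (Finset.mem_insert_of_mem hj))
    have h2 : ‖∏ i ∈ s, a i‖ ≤ 1 := by
      rw [norm_prod]
      exact Finset.prod_le_one (fun _ _ ↦ norm_nonneg _)
        (fun j hj ↦ ha j (Finset.mem_insert_of_mem hj))
    have h3 := hb i (Finset.mem_insert_self _ _)
    calc _ = ‖(a i - b i) * ∏ i ∈ s, a i + b i * (∏ i ∈ s, a i - ∏ i ∈ s, b i)‖ := by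
          congr 1; ring
      _ ≤ ‖a i - b i‖ * ‖∏ i ∈ s, a i‖ + ‖b i‖ * ‖∏ i ∈ s, a i - ∏ i ∈ s, b i‖ := by
          refine (norm_add_le _ _).trans ?_
          rw [norm_mul, norm_mul]
      _ ≤ ‖a i - b i‖ * 1 + 1 * ∑ i ∈ s, ‖a i - b i‖ := by gcongr
      _ = _ := by ring

lemma norm_factor_sub_le {p : ℝ} (hp : 2 ≤ p) {g ε : ℝ} (hg : |g| ≤ ε) (hε : ε ≤ 1) :
    ‖(1 + (Complex.exp (Complex.I * g) - 1) / p) * Complex.exp (-(Complex.I * (g / p))) -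
      Complex.exp (-(g ^ 2 / (2 * p)))‖ ≤ ε * (g ^ 2 / p) + 4 * ε ^ 2 * (1 / p ^ 2) := by
  have hp0 : 0 < p := by linarith
  have hpc : (p : ℂ) ≠ 0 := by exact_mod_cast hp0.ne'
  set w : ℂ := Complex.I * (g / p) - g ^ 2 / (2 * p) with hw
  have hε0 : 0 ≤ ε := (abs_nonneg g).trans hg
  have hg2 : g ^ 2 ≤ |g| := by
    rw [← sq_abs]; nlinarith [abs_nonneg g]
  have hwn : ‖w‖ ≤ 2 * |g| / p := by
    have h1 : ‖Complex.I * (g / p : ℂ)‖ = |g| / p := by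
      rw [norm_mul, Complex.norm_I, one_mul, norm_div, Complex.norm_real, Complex.norm_real,
        Real.norm_eq_abs, Real.norm_of_nonneg hp0.le]
    have h2 : ‖(g ^ 2 / (2 * p) : ℂ)‖ = g ^ 2 / (2 * p) := by
      rw [← Complex.ofReal_pow, ← Complex.ofReal_ofNat, ← Complex.ofReal_mul, ← Complex.ofReal_div,
        Complex.norm_real, Real.norm_of_nonneg (by positivity)]
    refine (norm_sub_le _ _).trans ?_
    rw [h1, h2]
    have : g ^ 2 / (2 * p) ≤ |g| / p := by
      rw [div_le_div_iff₀ (by positivity) hp0]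
      nlinarith [abs_nonneg g]
    have e : 2 * |g| / p = |g| / p + |g| / p := by ring
    linarith
  have hw1 : ‖w‖ ≤ 1 := hwn.trans (by
    rw [div_le_one hp0]; linarith)
  have e1 : Complex.exp (-(g ^ 2 / (2 * p))) = Complex.exp w * Complex.exp (-(Complex.I * (g / p))) := by
    rw [← Complex.exp_add, hw]; congr 1; ring
  have e2 : ‖Complex.exp (-(Complex.I * (g / p)))‖ = 1 := by
    have : -(Complex.I * (g / p) : ℂ) = ((-(g / p) : ℝ) : ℂ) * Complex.I := by push_cast; ring
    rw [this, Complex.norm_exp_ofReal_mul_I]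
  rw [e1, ← sub_mul, norm_mul, e2, mul_one]
  have h3 := norm_exp_I_mul_sub_taylor_le 3 g
  have h4 := Complex.norm_exp_sub_one_sub_id_le hw1
  have e3 : (1 + (Complex.exp (Complex.I * g) - 1) / p) - Complex.exp w =
      (Complex.exp (Complex.I * g) - ∑ j ∈ Finset.range 3, (Complex.I * g) ^ j / (j.factorial : ℂ)) / p
        - (Complex.exp w - 1 - w) := by
    simp only [Finset.sum_range_succ, Finset.sum_range_zero, mul_pow, Complex.I_sq, hw,
      Nat.factorial]
    push_cast
    field_simp
    ring
  rw [e3]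
  refine (norm_sub_le _ _).trans (add_le_add ?_ ?_)
  · rw [norm_div, Complex.norm_real, Real.norm_of_nonneg hp0.le, ← mul_div_assoc]
    gcongr
    refine h3.trans ?_
    have : |g| ^ 3 / (Nat.factorial 3 : ℝ) ≤ |g| ^ 3 :=
      div_le_self (by positivity) (by norm_num [Nat.factorial])
    refine this.trans ?_
    rw [pow_succ, sq_abs, mul_comm]
    gcongr
  · refine h4.trans ?_
    calc ‖w‖ ^ 2 ≤ (2 * |g| / p) ^ 2 := by gcongr
      _ ≤ (2 * ε / p) ^ 2 := by gcongr
      _ = _ := by ring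

lemma norm_factor_le {p : ℝ} (hp : 2 ≤ p) (g : ℝ) :
    ‖(1 + (Complex.exp (Complex.I * g) - 1) / p) * Complex.exp (-(Complex.I * (g / p)))‖ ≤ 1 := by
  have hp0 : 0 < p := by linarith
  have e2 : ‖Complex.exp (-(Complex.I * (g / p)))‖ = 1 := by
    have : -(Complex.I * (g / p) : ℂ) = ((-(g / p) : ℝ) : ℂ) * Complex.I := by push_cast; ring
    rw [this, Complex.norm_exp_ofReal_mul_I]
  have e3 : ‖Complex.exp (Complex.I * g)‖ = 1 := by
    rw [mul_comm, Complex.norm_exp_ofReal_mul_I]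
  have hpc : (p : ℂ) ≠ 0 := by exact_mod_cast hp0.ne'
  rw [norm_mul, e2, mul_one]
  have e4 : 1 + (Complex.exp (Complex.I * g) - 1) / p =
      (((1 - p⁻¹ : ℝ)) : ℂ) + Complex.exp (Complex.I * g) * ((p⁻¹ : ℝ) : ℂ) := by
    push_cast; field_simp; ring
  rw [e4]
  refine (norm_add_le _ _).trans ?_
  rw [norm_mul, e3, Complex.norm_real, Complex.norm_real, Real.norm_of_nonneg, Real.norm_of_nonneg]
  · linarith
  · positivity
  · rw [sub_nonneg]; exact inv_le_one_of_one_le₀ (by linarith)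

/-- The characteristic function in the independent model is nearly Gaussian. -/
lemma norm_expI_sub_gauss_le {P : Finset ℕ} (hP : ∀ p ∈ P, p.Prime) {g : ℕ → ℝ} {ε : ℝ}
    (hg : ∀ p ∈ P, |g p| ≤ ε) (hε : ε ≤ 1) :
    ‖expI P (fun A ↦ Complex.exp (Complex.I * linA P g A)) -
      Complex.exp (-((∑ p ∈ P, g p ^ 2 / p : ℝ) / 2))‖ ≤
      ε * ∑ p ∈ P, g p ^ 2 / p + 4 * ε ^ 2 * ∑' n : ℕ, 1 / (n : ℝ) ^ 2 := by
  have h1 : expI P (fun A ↦ Complex.exp (Complex.I * linA P g A)) =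
      ∏ p ∈ P, ((1 + (Complex.exp (Complex.I * g p) - 1) / (p : ℝ)) *
        Complex.exp (-(Complex.I * (g p / (p : ℝ))))) := by
    rw [Finset.prod_mul_distrib]
    have := expI_prod P (fun p ↦ Complex.exp (Complex.I * g p))
    simp only [Complex.ofReal_natCast]
    have e : (∏ p ∈ P, (1 + (Complex.exp (Complex.I * g p) - 1) / (p : ℂ))) =
      expI P (fun A ↦ ∏ p ∈ A, Complex.exp (Complex.I * g p)) := by rw [this]
    rw [e, ← Complex.exp_sum]
    unfold expI
    rw [Finset.sum_mul]
    refine Finset.sum_congr rfl fun A _ ↦ ?_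
    rw [smul_mul_assoc]
    beta_reduce
    rw [← Complex.exp_sum, ← Complex.exp_add]
    congr 2
    unfold linA
    push_cast
    rw [mul_sub, Finset.mul_sum, Finset.mul_sum, Finset.sum_neg_distrib]
    ring
  have h2 : Complex.exp (-((∑ p ∈ P, g p ^ 2 / p : ℝ) / 2)) =
      ∏ p ∈ P, Complex.exp (-(g p ^ 2 / (2 * (p : ℝ)))) := by
    rw [← Complex.exp_sum]
    congr 1
    push_cast
    rw [Finset.sum_neg_distrib, Finset.sum_div]
    congr 1
    exact Finset.sum_congr rfl fun p _ ↦ by rw [div_div, mul_comm]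
  have hp2 : ∀ p ∈ P, (2:ℝ) ≤ p := fun p hp ↦ by exact_mod_cast (hP p hp).two_le
  rw [h1, h2]
  refine (norm_prod_sub_prod_le P (fun p hp ↦ norm_factor_le (hp2 p hp) _) fun p hp ↦ ?_).trans ?_
  · have : (-(g p ^ 2 / (2 * (p : ℝ))) : ℂ) = ((-(g p ^ 2 / (2 * (p:ℝ))) : ℝ) : ℂ) := by push_cast; ring
    rw [this, Complex.norm_exp_ofReal, Real.exp_le_one_iff]
    have := hp2 p hp
    rw [neg_nonpos]; positivity
  · refine (Finset.sum_le_sum fun p hp ↦ norm_factor_sub_le (hp2 p hp) (hg p hp) hε).trans ?_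
    rw [Finset.sum_add_distrib, ← Finset.mul_sum, ← Finset.mul_sum]
    gcongr
    exact (Real.summable_one_div_nat_pow.mpr one_lt_two).sum_le_tsum _ fun _ _ ↦ by positivity

/-- The primes up to `N`. -/
abbrev primesTo (N : ℕ) : Finset ℕ := (Finset.range (N + 1)).filter Nat.Prime

lemma tendsto_LL : Tendsto LL atTop atTop :=
  Real.tendsto_log_atTop.comp (Real.tendsto_log_atTop.comp tendsto_natCast_atTop_atTop)

lemma norm_exp_I_sub_exp_I_le (a b : ℝ) :
    ‖Complex.exp (Complex.I * a) - Complex.exp (Complex.I * b)‖ ≤ |a - b| := by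
  have h := norm_exp_I_mul_sub_taylor_le 1 (a - b)
  have e : Complex.exp (Complex.I * a) - Complex.exp (Complex.I * b) =
      Complex.exp (Complex.I * b) * (Complex.exp (Complex.I * ((a - b : ℝ) : ℂ)) - 1) := by
    rw [mul_sub, ← Complex.exp_add]
    push_cast
    ring_nf
  have e3 : ‖Complex.exp (Complex.I * b)‖ = 1 := by
    rw [mul_comm, Complex.norm_exp_ofReal_mul_I]
  rw [e, norm_mul, e3, one_mul]
  simpa using h

/-- An integer `m ≤ n` has few prime factors exceeding `α`. -/
lemma card_large_primeFactors_le {m : ℕ} (hm : 0 < m) {N : ℕ} {α y n : ℝ} (hn : (m:ℝ) ≤ n)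
    (hα : 1 < α) (hαN : α ≤ N + 1) (hy : Real.log n ≤ y * Real.log α) :
    ((m.primeFactors.filter (fun p ↦ N < p)).card : ℝ) ≤ y := by
  set S := m.primeFactors.filter (fun p ↦ N < p)
  have h1 : ∏ p ∈ S, p ≤ m :=
    (Finset.prod_le_prod_of_subset_of_one_le' (Finset.filter_subset _ _)
      (fun p hp _ ↦ (Nat.prime_of_mem_primeFactors hp).one_le)).trans
      (Nat.le_of_dvd hm (Nat.prod_primeFactors_dvd m))
  have h2 : α ^ S.card ≤ ∏ p ∈ S, (p : ℝ) := by
    rw [← Finset.prod_const]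
    refine Finset.prod_le_prod (fun _ _ ↦ by linarith) fun p hp ↦ ?_
    refine hαN.trans ?_
    have := (Finset.mem_filter.mp hp).2
    exact_mod_cast this
  have h3 : α ^ S.card ≤ n := by
    refine h2.trans (le_trans ?_ hn)
    rw [← Nat.cast_prod]
    exact Nat.cast_le.mpr h1
  have h4 := Real.log_le_log (by positivity) h3
  rw [Real.log_pow] at h4
  have h5 := Real.log_pos hα
  exact le_of_mul_le_mul_right (h4.trans hy) h5

lemma expU_congr_norm_le {n : ℕ} {P : Finset ℕ} {h : ℕ → ℂ} {g : Finset ℕ → ℂ} {δ : ℝ} (hδ : 0 ≤ δ)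
    (H : ∀ m ∈ Finset.Ioc 0 n, ‖h m - g (divs P m)‖ ≤ δ) :
    ‖(n : ℝ)⁻¹ • ∑ m ∈ Finset.Ioc 0 n, h m - expU n P g‖ ≤ δ := by
  unfold expU
  rw [← smul_sub, ← Finset.sum_sub_distrib, norm_smul]
  have h1 : ‖∑ m ∈ Finset.Ioc 0 n, (h m - g (divs P m))‖ ≤ n * δ := by
    refine (norm_sum_le_of_le _ H).trans (le_of_eq ?_)
    simp
  rcases Nat.eq_zero_or_pos n with rfl | hn
  · simpa using hδ
  · rw [norm_inv, Real.norm_natCast]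
    have hn' : (0:ℝ) < n := by exact_mod_cast hn
    rw [inv_mul_le_iff₀ hn']
    exact h1

/-- The Erdős–Kac theorem for bounded functions on primes, in terms of characteristic functions. -/
theorem erdosKac_charFun {f : ℕ → ℝ} {K κ V C : ℝ} (hK : ∀ p, |f p| ≤ K)
    (h1 : ∀ x : ℝ, 3 ≤ x →
      |∑ p ∈ primesTo ⌊x⌋₊, f p / p - κ * Real.log (Real.log x)| ≤ C)
    (h2 : ∀ x : ℝ, 3 ≤ x →
      |∑ p ∈ primesTo ⌊x⌋₊, f p ^ 2 / p - V * Real.log (Real.log x)| ≤ C) :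
    Tendsto (fun n : ℕ ↦ (n : ℝ)⁻¹ • ∑ m ∈ Finset.Ioc 0 n, Complex.exp (Complex.I *
      (((∑ p ∈ m.primeFactors, f p - κ * LL n) / Real.sqrt (LL n) : ℝ) : ℂ)))
      atTop (nhds (Complex.exp (-(V / 2)))) := by
  have hK0 : 0 ≤ K := (abs_nonneg _).trans (hK 0)
  set s : ℕ → ℝ := fun n ↦ Real.sqrt (LL n) with hs
  have hs_top : Tendsto s atTop atTop := Real.tendsto_sqrt_atTop.comp tendsto_LL
  set y : ℕ → ℝ := fun n ↦ Real.sqrt (s n) with hy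
  have hy_top : Tendsto y atTop atTop := Real.tendsto_sqrt_atTop.comp hs_top
  set α : ℕ → ℝ := fun n ↦ Real.exp (Real.log n / y n) with hα
  set P : ℕ → Finset ℕ := fun n ↦ primesTo ⌊α n⌋₊ with hP
  have hPp : ∀ n, ∀ p ∈ P n, p.Prime := fun n p hp ↦ (Finset.mem_filter.mp hp).2
  have hlog : Tendsto (fun n : ℕ ↦ Real.log n) atTop atTop :=
    Real.tendsto_log_atTop.comp tendsto_natCast_atTop_atTop
  -- basic eventual facts
  have hs0 : ∀ᶠ n in atTop, 1 ≤ s n := hs_top.eventually_ge_atTop 1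
  have hy4 : ∀ᶠ n in atTop, y n ^ 4 = LL n := by
    filter_upwards [hs_top.eventually_ge_atTop 1, tendsto_LL.eventually_ge_atTop 0] with n h h'
    have e : y n ^ 2 = s n := Real.sq_sqrt (by linarith)
    rw [show y n ^ 4 = (y n ^ 2) ^ 2 by ring, e]
    exact Real.sq_sqrt h'
  have hy2 : ∀ᶠ n in atTop, y n ^ 2 = s n := by
    filter_upwards [hs_top.eventually_ge_atTop 1] with n h
    exact Real.sq_sqrt (by linarith)
  have hratio : Tendsto (fun n : ℕ ↦ Real.log n / y n) atTop atTop := by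
    have hle : ∀ᶠ n : ℕ in atTop, Real.log n / Real.log (Real.log n) ≤ Real.log n / y n := by
      filter_upwards [hy4, hy_top.eventually_ge_atTop 1, hlog.eventually_ge_atTop 0] with n h4 h1 h0
      have : y n ≤ LL n := by
        rw [← h4]; exact le_self_pow₀ h1 (by norm_num)
      exact div_le_div_of_nonneg_left h0 (by linarith) this
    refine tendsto_atTop_mono' _ hle ?_
    have : Tendsto (fun x : ℝ ↦ x / Real.log x) atTop atTop := by
      have h := (Real.isLittleO_log_id_atTop).tendsto_div_nhds_zero
      have h' : Tendsto (fun x : ℝ ↦ (Real.log x / x)⁻¹) atTop atTop := by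
        refine Tendsto.inv_tendsto_nhdsGT_zero (tendsto_nhdsWithin_iff.mpr ⟨h, ?_⟩)
        filter_upwards [eventually_gt_atTop 1] with x hx
        exact div_pos (Real.log_pos hx) (by linarith)
      simpa using h'
    exact this.comp hlog
  have hα3 : ∀ᶠ n in atTop, 3 ≤ α n := (Real.tendsto_exp_atTop.comp hratio).eventually_ge_atTop 3
  have hllα : ∀ᶠ n in atTop, Real.log (Real.log (α n)) = LL n - Real.log (y n) := by
    filter_upwards [hy_top.eventually_ge_atTop 1, hlog.eventually_ge_atTop 1] with n h1 h2
    rw [hα, Real.log_exp, Real.log_div (by linarith) (by linarith)]; rfl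
  set g : ℕ → ℕ → ℝ := fun n p ↦ f p / s n with hg
  set T2 : ℕ → ℝ := fun n ↦ ∑ p ∈ P n, g n p ^ 2 / p with hT2
  have hlogy : Tendsto (fun n ↦ Real.log (y n) / s n) atTop (nhds 0) := by
    have h := (Real.isLittleO_log_id_atTop).tendsto_div_nhds_zero
    have h' : Tendsto (fun n ↦ (Real.log (y n) / y n) * (y n)⁻¹) atTop (nhds (0 * 0)) :=
      (h.comp hy_top).mul (tendsto_inv_atTop_zero.comp hy_top)
    rw [mul_zero] at h'
    refine h'.congr' ?_
    filter_upwards [hy2] with n h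
    rw [← h, sq, div_eq_mul_inv, div_eq_mul_inv, mul_inv, mul_assoc]
  have hys : Tendsto (fun n ↦ y n / s n) atTop (nhds 0) := by
    refine (tendsto_inv_atTop_zero.comp hy_top).congr' ?_
    filter_upwards [hy2, hy_top.eventually_ge_atTop 1] with n h h1
    simp only [Function.comp]
    rw [← h]; field_simp
  have hsinv : Tendsto (fun n ↦ (s n)⁻¹) atTop (nhds 0) := tendsto_inv_atTop_zero.comp hs_top
  have hT2lim : Tendsto T2 atTop (nhds V) := by
    rw [tendsto_iff_norm_sub_tendsto_zero]
    have hb : Tendsto (fun n ↦ |V| * (Real.log (y n) / s n) + C * (s n)⁻¹) atTop (nhds 0) := by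
      simpa using (hlogy.const_mul |V|).add (hsinv.const_mul C)
    refine squeeze_zero' (Eventually.of_forall fun _ ↦ norm_nonneg _) ?_ hb
    filter_upwards [hs0, hα3, hllα, hy_top.eventually_ge_atTop 1,
      tendsto_LL.eventually_ge_atTop 0] with n hs1 ha hl hy1 hL0
    have hsq : s n ^ 2 = LL n := Real.sq_sqrt hL0
    have e : T2 n = (∑ p ∈ P n, f p ^ 2 / p) / s n ^ 2 := by
      simp only [hT2, hg]
      rw [Finset.sum_div]
      exact Finset.sum_congr rfl fun p _ ↦ by rw [div_pow]; ring
    have h := h2 (α n) ha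
    rw [hl] at h
    have hC : 0 ≤ C := (abs_nonneg _).trans h
    have e2 : T2 n - V = ((∑ p ∈ P n, f p ^ 2 / p) - V * (LL n - Real.log (y n))
        - V * Real.log (y n)) / s n ^ 2 := by
      rw [e, ← hsq]; field_simp; ring
    rw [Real.norm_eq_abs, e2, abs_div, abs_of_pos (by positivity : 0 < s n ^ 2)]
    have hly : 0 ≤ Real.log (y n) := Real.log_nonneg hy1
    calc _ ≤ (C + |V| * Real.log (y n)) / s n ^ 2 := by
          gcongr
          refine (abs_sub _ _).trans ?_
          rw [abs_mul, abs_of_nonneg hly]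
          gcongr
      _ ≤ (C + |V| * Real.log (y n)) / s n := by
          gcongr
          exact le_self_pow₀ hs1 (by norm_num)
      _ = _ := by ring
  have hε : Tendsto (fun n ↦ K / s n) atTop (nhds 0) := by
    simpa [div_eq_mul_inv] using hsinv.const_mul K
  have hgε : ∀ᶠ n in atTop, ∀ p, |g n p| ≤ K / s n := by
    filter_upwards [hs0] with n hn p
    rw [hg, abs_div, abs_of_pos (by linarith : 0 < s n)]
    gcongr
    exact hK p
  -- the independent model
  have hI : Tendsto (fun n ↦ expI (P n) (fun A ↦ Complex.exp (Complex.I * linA (P n) (g n) A)))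
      atTop (nhds (Complex.exp (-(V / 2)))) := by
    have hgau : Tendsto (fun n ↦ Complex.exp (-((T2 n : ℝ) / 2))) atTop
        (nhds (Complex.exp (-(V / 2)))) := by
      refine (Complex.continuous_exp.tendsto _).comp ?_
      exact (((Complex.continuous_ofReal.tendsto V).comp hT2lim).div_const 2).neg
    refine tendsto_of_tendsto_of_dist hgau ?_
    have hb : Tendsto (fun n ↦ K / s n * T2 n + 4 * (K / s n) ^ 2 * ∑' n : ℕ, 1 / (n : ℝ) ^ 2)
        atTop (nhds 0) := by
      have := (hε.mul hT2lim).add (((hε.pow 2).const_mul 4).mul_const (∑' n : ℕ, 1 / (n : ℝ) ^ 2))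
      simpa using this
    refine squeeze_zero' (Eventually.of_forall fun _ ↦ dist_nonneg) ?_ hb
    filter_upwards [hgε, hε.eventually_le_const (zero_lt_one)] with n h1 h2
    rw [dist_comm, dist_eq_norm]
    exact norm_expI_sub_gauss_le (hPp n) (fun p _ ↦ h1 p) h2
  -- comparison of the models
  have hcmp : Tendsto (fun n ↦ dist
      (expI (P n) (fun A ↦ Complex.exp (Complex.I * linA (P n) (g n) A)))
      (expU n (P n) (fun A ↦ Complex.exp (Complex.I * linA (P n) (g n) A)))) atTop (nhds 0) := by
    have hgε' : ∀ᶠ n in atTop, ∀ p, |g n p| ≤ 1 / 2 := by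
      filter_upwards [hgε, hε.eventually_le_const (by norm_num : (0:ℝ) < 1 / 2)] with n h1 h2 p
      exact (h1 p).trans h2
    rw [Metric.tendsto_nhds]
    intro η hη
    obtain ⟨k, hk⟩ : ∃ k : ℕ, 4 * (1 / 4) ^ k * Real.exp (4 * (V + 1)) < η / 2 := by
      have : Tendsto (fun k : ℕ ↦ 4 * (1 / 4 : ℝ) ^ k * Real.exp (4 * (V + 1))) atTop (nhds 0) := by
        simpa using ((tendsto_pow_atTop_nhds_zero_of_lt_one (by norm_num : (0:ℝ) ≤ 1 / 4)
          (by norm_num)).const_mul 4).mul_const (Real.exp (4 * (V + 1)))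
      exact (this.eventually_lt_const (by positivity)).exists
    have hsmall : Tendsto (fun n : ℕ ↦ (2 * k + 1) * (4 ^ k * Real.exp (-(Real.log n / 2))))
        atTop (nhds 0) := by
      have h : Tendsto (fun n : ℕ ↦ Real.exp (-(Real.log n / 2))) atTop (nhds 0) :=
        Real.tendsto_exp_neg_atTop_nhds_zero.comp (hlog.atTop_div_const (by norm_num))
      simpa using (h.const_mul ((4:ℝ) ^ k)).const_mul (2 * (k:ℝ) + 1)
    filter_upwards [hgε', hsmall.eventually_lt_const (by positivity : 0 < η / 2), hα3,
      hT2lim.eventually_le_const (lt_add_one V), hy_top.eventually_ge_atTop (4 * k + 1),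
      hlog.eventually_ge_atTop 0, eventually_gt_atTop 0] with n hgn hsm ha hT hyk hl0 hn
    have hn' : (0:ℝ) < n := by exact_mod_cast hn
    rw [Real.dist_eq, sub_zero, abs_of_nonneg dist_nonneg, dist_comm, dist_eq_norm]
    refine (norm_expU_sub_expI_le hn (hPp n) (fun p _ ↦ hgn p) k).trans_lt ?_
    have hcard : ((P n).card : ℝ) + 1 ≤ 2 * α n := by
      have : (P n).card ≤ ⌊α n⌋₊ + 1 := (Finset.card_filter_le _ _).trans (by simp)
      have h3 := Nat.floor_le (by linarith : 0 ≤ α n)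
      have : ((P n).card : ℝ) ≤ ⌊α n⌋₊ + 1 := by exact_mod_cast this
      linarith
    have h4 : ((P n).card + 1 : ℝ) ^ (2 * k) / n ≤ 4 ^ k * Real.exp (-(Real.log n / 2)) := by
      rw [div_le_iff₀ hn']
      calc _ ≤ (2 * α n) ^ (2 * k) := by gcongr
        _ = 4 ^ k * Real.exp ((2 * k : ℕ) * (Real.log n / y n)) := by
            rw [mul_pow, pow_mul, Real.exp_nat_mul]; norm_num [hα]
        _ ≤ 4 ^ k * Real.exp (-(Real.log n / 2) + Real.log n) := by
            gcongr
            push_cast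
            rw [← mul_div_assoc, div_le_iff₀ (by linarith [Nat.cast_nonneg (α := ℝ) k])]
            nlinarith
        _ = _ := by rw [Real.exp_add, Real.exp_log hn', mul_assoc]
    have h5 : (2 * k + 1) * ((P n).card + 1 : ℝ) ^ (2 * k) / n < η / 2 := by
      rw [mul_div_assoc]
      refine lt_of_le_of_lt ?_ hsm
      gcongr
    have h6 : 4 * (1 / 4) ^ k * Real.exp (4 * T2 n) ≤ 4 * (1 / 4) ^ k * Real.exp (4 * (V + 1)) := by
      gcongr
    linarith
  have hU := tendsto_of_tendsto_of_dist hI hcmp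
  refine tendsto_of_tendsto_of_dist hU ?_
  have hb : Tendsto (fun n ↦ K * (y n / s n) + |κ| * (Real.log (y n) / s n) + C * (s n)⁻¹)
      atTop (nhds 0) := by
    simpa using ((hys.const_mul K).add (hlogy.const_mul |κ|)).add (hsinv.const_mul C)
  refine squeeze_zero' (Eventually.of_forall fun _ ↦ dist_nonneg) ?_ hb
  filter_upwards [hα3, hllα, hy_top.eventually_ge_atTop 1, hs0, hlog.eventually_ge_atTop 0]
    with n ha hl hy1 hs1 hl0
  have h := h1 (α n) ha
  have hC : 0 ≤ C := (abs_nonneg _).trans h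
  have hly : 0 ≤ Real.log (y n) := Real.log_nonneg hy1
  rw [dist_comm, dist_eq_norm]
  refine expU_congr_norm_le (by positivity) fun m hm ↦ ?_
  obtain ⟨hm0, hmn⟩ := Finset.mem_Ioc.mp hm
  refine (norm_exp_I_sub_exp_I_le _ _).trans ?_
  have hcl := card_large_primeFactors_le (N := ⌊α n⌋₊) hm0 (Nat.cast_le (α := ℝ).mpr hmn)
    (by linarith : 1 < α n) (Nat.lt_floor_add_one _).le (y := y n)
    (by rw [hα, Real.log_exp]; exact (mul_div_cancel₀ _ (by linarith)).ge)
  have hsplit : ∑ p ∈ m.primeFactors, f p = ∑ p ∈ divs (P n) m, f p +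
      ∑ p ∈ m.primeFactors.filter (fun p ↦ ⌊α n⌋₊ < p), f p := by
    rw [← Finset.sum_filter_add_sum_filter_not m.primeFactors (fun p ↦ ⌊α n⌋₊ < p), add_comm]
    congr 1
    refine Finset.sum_congr ?_ fun _ _ ↦ rfl
    ext p
    simp only [hP, divs, primesTo, Finset.mem_filter, Nat.mem_primeFactors, Finset.mem_range]
    constructor
    · rintro ⟨⟨h1, h2, h3⟩, h4⟩; exact ⟨⟨by omega, h1⟩, h2⟩
    · rintro ⟨⟨h1, h2⟩, h3⟩; exact ⟨⟨h2, h3, by omega⟩, by omega⟩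
  have hlarge : |∑ p ∈ m.primeFactors.filter (fun p ↦ ⌊α n⌋₊ < p), f p| ≤ K * y n := by
    refine (Finset.abs_sum_le_sum_abs _ _).trans ?_
    refine (Finset.sum_le_card_nsmul _ _ K fun p _ ↦ hK p).trans ?_
    rw [nsmul_eq_mul, mul_comm]
    gcongr
  have hlin : linA (P n) (g n) (divs (P n) m) =
      (∑ p ∈ divs (P n) m, f p - ∑ p ∈ P n, f p / p) / s n := by
    simp only [linA, hg]
    rw [sub_div, Finset.sum_div, Finset.sum_div]
    congr 1
    exact Finset.sum_congr rfl fun p _ ↦ by ring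
  rw [hlin, ← sub_div, abs_div, abs_of_pos (by linarith : 0 < s n)]
  rw [hl] at h
  have : K * (y n / s n) + |κ| * (Real.log (y n) / s n) + C * (s n)⁻¹ =
      (K * y n + |κ| * Real.log (y n) + C) / s n := by ring
  rw [this]
  gcongr
  rw [hsplit]
  have e : ∑ p ∈ divs (P n) m, f p +
      ∑ p ∈ m.primeFactors.filter (fun p ↦ ⌊α n⌋₊ < p), f p - κ * LL n -
      (∑ p ∈ divs (P n) m, f p - ∑ p ∈ P n, f p / p) =
      ∑ p ∈ m.primeFactors.filter (fun p ↦ ⌊α n⌋₊ < p), f p +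
      -(κ * Real.log (y n)) + (∑ p ∈ P n, f p / p - κ * (LL n - Real.log (y n))) := by ring
  rw [e]
  refine (abs_add_le _ _).trans (add_le_add ((abs_add_le _ _).trans (add_le_add hlarge ?_)) h)
  rw [abs_neg, abs_mul, abs_of_nonneg hly]

/-- Proportion of `1 ≤ m ≤ n` satisfying `S`. -/
def prb (n : ℕ) (S : ℕ → Prop) : ℝ := (cnt S n : ℝ) / n

open Classical in
lemma cnt_eq (S : ℕ → Prop) (n : ℕ) : cnt S n = ((Finset.Ioc 0 n).filter S).card := by
  rw [cnt, ← Set.ncard_coe_finset]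
  congr 1
  ext m
  simp only [Set.mem_ofPred_eq, Finset.coe_filter, Finset.mem_Ioc, Nat.one_le_iff_ne_zero,
    Nat.pos_iff_ne_zero, and_assoc]

lemma prb_nonneg (n : ℕ) (S : ℕ → Prop) : 0 ≤ prb n S := by unfold prb; positivity

lemma prb_mono {n : ℕ} {S T : ℕ → Prop} (h : ∀ m ∈ Finset.Ioc 0 n, S m → T m) :
    prb n S ≤ prb n T := by
  classical
  unfold prb
  rw [cnt_eq, cnt_eq]
  gcongr ?_ / _
  exact_mod_cast Finset.card_le_card fun m hm ↦ by
    rw [Finset.mem_filter] at hm ⊢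
    exact ⟨hm.1, h m hm.1 hm.2⟩

lemma prb_or_le (n : ℕ) (S T : ℕ → Prop) : prb n (fun m ↦ S m ∨ T m) ≤ prb n S + prb n T := by
  classical
  unfold prb
  rw [cnt_eq, cnt_eq, cnt_eq, ← add_div]
  gcongr ?_ / _
  rw [← Nat.cast_add, Nat.cast_le]
  refine le_trans (Finset.card_le_card fun m hm ↦ ?_) (Finset.card_union_le _ _)
  have h := (@Finset.mem_filter _ _ (_) _ _).mp hm
  rw [Finset.mem_union, Finset.mem_filter, Finset.mem_filter]
  tauto

lemma prb_biUnion_le {ι : Type*} (n : ℕ) (s : Finset ι) (S : ι → ℕ → Prop) :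
    prb n (fun m ↦ ∃ i ∈ s, S i m) ≤ ∑ i ∈ s, prb n (S i) := by
  classical
  induction s using Finset.induction_on with
  | empty => simp [prb, cnt]
  | insert i s hi ih =>
    rw [Finset.sum_insert hi]
    refine (prb_mono (T := fun m ↦ S i m ∨ ∃ j ∈ s, S j m) fun m _ h ↦ ?_).trans
      ((prb_or_le _ _ _).trans (by gcongr))
    simpa using h

open Classical in
lemma prb_eq_sum (n : ℕ) (S : ℕ → Prop) :
    prb n S = (n : ℝ)⁻¹ * ∑ m ∈ Finset.Ioc 0 n, if S m then 1 else 0 := by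
  rw [prb, cnt_eq, div_eq_inv_mul, Finset.sum_boole]

/-- Markov's inequality. -/
lemma prb_le_of_mean {n : ℕ} {S : ℕ → Prop} {g : ℕ → ℝ} {a : ℝ} (ha : 0 < a) (hg : ∀ m, 0 ≤ g m)
    (h : ∀ m ∈ Finset.Ioc 0 n, S m → a ≤ g m) :
    prb n S ≤ ((n : ℝ)⁻¹ * ∑ m ∈ Finset.Ioc 0 n, g m) / a := by
  classical
  rw [prb_eq_sum, le_div_iff₀ ha, mul_assoc, Finset.sum_mul]
  gcongr with m hm
  split_ifs with hS
  · simpa using h m hm hS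
  · simpa using hg m

/-- A family of events (depending on the cutoff `n`) of asymptotic proportion zero. -/
def Negl (S : ℕ → ℕ → Prop) : Prop := Tendsto (fun n ↦ prb n (S n)) atTop (nhds 0)

lemma Negl.mono {S T : ℕ → ℕ → Prop} (hT : Negl T)
    (h : ∀ᶠ n in atTop, ∀ m ∈ Finset.Ioc 0 n, S n m → T n m) : Negl S := by
  refine squeeze_zero' (Eventually.of_forall fun n ↦ prb_nonneg _ _) ?_ hT
  filter_upwards [h] with n hn using prb_mono hn

lemma Negl.or {S T : ℕ → ℕ → Prop} (hS : Negl S) (hT : Negl T) :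
    Negl (fun n m ↦ S n m ∨ T n m) := by
  refine squeeze_zero (fun n ↦ prb_nonneg _ _) (fun n ↦ prb_or_le _ _ _) ?_
  simpa using Tendsto.add hS hT

lemma Negl.biUnion {ι : Type*} (s : Finset ι) {S : ι → ℕ → ℕ → Prop} (h : ∀ i ∈ s, Negl (S i)) :
    Negl (fun n m ↦ ∃ i ∈ s, S i n m) := by
  refine squeeze_zero (fun n ↦ prb_nonneg _ _) (fun n ↦ prb_biUnion_le n s (fun i ↦ S i n)) ?_
  simpa using tendsto_finsetSum s h

section Empirical
variable {E : Type*} [MeasurableSpace E]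

/-- Empirical distribution of `X 1, …, X n`. -/
def emp (n : ℕ) (X : ℕ → E) : Measure E := (n : ENNReal)⁻¹ • ∑ m ∈ Finset.Ioc 0 n, Measure.dirac (X m)

lemma emp_isProbabilityMeasure {n : ℕ} (hn : n ≠ 0) (X : ℕ → E) : IsProbabilityMeasure (emp n X) := by
  constructor
  simp only [emp, Measure.smul_apply, Measure.finsetSum_apply, measure_univ, smul_eq_mul]
  simp only [Finset.sum_const, Nat.card_Ioc, tsub_zero, nsmul_eq_mul, mul_one]
  exact ENNReal.inv_mul_cancel (by exact_mod_cast hn) (by simp)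

lemma emp_real_apply (n : ℕ) (X : ℕ → E) {S : Set E} (hS : MeasurableSet S) :
    (emp n X S).toReal = prb n (fun m ↦ X m ∈ S) := by
  classical
  rw [prb_eq_sum]
  simp only [emp, Measure.smul_apply, Measure.finsetSum_apply, Measure.dirac_apply' _ hS, smul_eq_mul]
  rw [ENNReal.toReal_mul, ENNReal.toReal_inv, ENNReal.toReal_natCast, ENNReal.toReal_sum]
  · congr 1
    refine Finset.sum_congr rfl fun m _ ↦ ?_
    by_cases h : X m ∈ S <;> simp [h]
  · intro m _
    by_cases h : X m ∈ S <;> simp [h]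

lemma emp_charFun [NormedAddCommGroup E] [InnerProductSpace ℝ E] [BorelSpace E] (n : ℕ)
    [SecondCountableTopology E] (X : ℕ → E) (t : E) :
    charFun (emp n X) t =
      (n : ℝ)⁻¹ • ∑ m ∈ Finset.Ioc 0 n, Complex.exp (Complex.I * ((inner ℝ (X m) t : ℝ) : ℂ)) := by
  rw [charFun_apply, emp, integral_smul_measure, integral_finsetSum_measure]
  · congr 1
    · simp
    · refine Finset.sum_congr rfl fun m _ ↦ ?_
      rw [integral_dirac, mul_comm]
  · intro m _
    exact integrable_dirac (by simp)

end Empirical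

lemma tendsto_prb_of_charFun {k : ℕ} (X : ℕ → ℕ → EuclideanSpace ℝ (Fin k))
    (hX : ∀ t : EuclideanSpace ℝ (Fin k), Tendsto (fun n : ℕ ↦ (n : ℝ)⁻¹ • ∑ m ∈ Finset.Ioc 0 n,
      Complex.exp (Complex.I * ((inner ℝ (X n m) t : ℝ) : ℂ))) atTop
      (nhds (Complex.exp (- ‖t‖ ^ 2 / 2))))
    {S : Set (Fin k → ℝ)} (hSm : MeasurableSet S)
    (hS : (_root_.stdGaussian k) (frontier S) = 0) :
    Tendsto (fun n ↦ prb n (fun m ↦ (X n m).ofLp ∈ S)) atTop (nhds ((_root_.stdGaussian k) S).toReal) := by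
  set ν : ProbabilityMeasure (EuclideanSpace ℝ (Fin k)) :=
    ⟨ProbabilityTheory.stdGaussian _, inferInstance⟩ with hν
  have hmap : (ν : Measure (EuclideanSpace ℝ (Fin k))) = (_root_.stdGaussian k).map (WithLp.toLp 2) :=
    map_pi_eq_stdGaussian.symm
  let μ : ℕ → ProbabilityMeasure (EuclideanSpace ℝ (Fin k)) := fun n ↦
    ⟨emp (n + 1) (X (n + 1)), emp_isProbabilityMeasure (Nat.succ_ne_zero n) _⟩
  have hlim : Tendsto μ atTop (nhds ν) := by
    refine ProbabilityMeasure.tendsto_of_tendsto_charFun fun t ↦ ?_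
    have := (tendsto_add_atTop_iff_nat 1).mpr (hX t)
    simp only [μ, ProbabilityMeasure.coe_mk, emp_charFun, hν, charFun_stdGaussian]
    exact this
  set T : Set (EuclideanSpace ℝ (Fin k)) := (WithLp.ofLp : EuclideanSpace ℝ (Fin k) → _) ⁻¹' S with hT
  have hTm : MeasurableSet T := hSm.preimage (by fun_prop)
  have hpre : ∀ U : Set (Fin k → ℝ), MeasurableSet U → (ν : Measure (EuclideanSpace ℝ (Fin k)))
      ((WithLp.ofLp : EuclideanSpace ℝ (Fin k) → _) ⁻¹' U) = (_root_.stdGaussian k) U := by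
    intro U hU
    rw [hmap, Measure.map_apply (by fun_prop) (hU.preimage (by fun_prop))]
    rfl
  have hTf : (ν : Measure (EuclideanSpace ℝ (Fin k))) (frontier T) = 0 := by
    refine measure_mono_null ?_ ((hpre _ isClosed_frontier.measurableSet).trans hS)
    exact Continuous.frontier_preimage_subset (PiLp.continuous_ofLp 2 _) S
  have h := ProbabilityMeasure.tendsto_measure_of_null_frontier_of_tendsto' hlim hTf
  rw [hpre S hSm] at h
  rw [← tendsto_add_atTop_iff_nat 1]
  have hfin : (_root_.stdGaussian k) S ≠ ⊤ := by
    rw [← hpre S hSm]; exact measure_ne_top _ _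
  refine ((ENNReal.tendsto_toReal hfin).comp h).congr fun n ↦ ?_
  exact emp_real_apply (n + 1) (X (n + 1)) hTm

/-- Law of large numbers for bounded functions on primes. -/
theorem negl_additive_deviation {f : ℕ → ℝ} {K κ V C : ℝ} (hK : ∀ p, |f p| ≤ K)
    (h1 : ∀ x : ℝ, 3 ≤ x →
      |∑ p ∈ primesTo ⌊x⌋₊, f p / p - κ * Real.log (Real.log x)| ≤ C)
    (h2 : ∀ x : ℝ, 3 ≤ x →
      |∑ p ∈ primesTo ⌊x⌋₊, f p ^ 2 / p - V * Real.log (Real.log x)| ≤ C) {δ : ℝ} (hδ : 0 < δ) :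
    Negl (fun n m ↦ δ * LL n < |∑ p ∈ m.primeFactors, f p - κ * LL n|) := by
  set X : ℕ → ℕ → ℝ := fun n m ↦ (∑ p ∈ m.primeFactors, f p - κ * LL n) / Real.sqrt (LL n) with hX
  let μ : ℕ → Measure ℝ := fun n ↦ emp (n + 1) (X (n + 1))
  have : ∀ n, IsProbabilityMeasure (μ n) := fun n ↦ emp_isProbabilityMeasure (Nat.succ_ne_zero n) _
  have htight : IsTightMeasureSet (Set.range μ) := by
    refine isTightMeasureSet_of_tendsto_charFun
      (f := fun t : ℝ ↦ Complex.exp (-((t ^ 2 * V : ℝ) / 2))) (by fun_prop) fun t ↦ ?_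
    have h := erdosKac_charFun (f := fun p ↦ t * f p) (K := |t| * K) (κ := t * κ) (V := t ^ 2 * V)
      (C := (|t| + t ^ 2) * C) (fun p ↦ by rw [abs_mul]; gcongr; exact hK p)
      (fun x hx ↦ by
        have h := h1 x hx
        have hC : 0 ≤ C := (abs_nonneg _).trans h
        have e : ∑ p ∈ primesTo ⌊x⌋₊, t * f p / p - t * κ * Real.log (Real.log x) =
          t * (∑ p ∈ primesTo ⌊x⌋₊, f p / p - κ * Real.log (Real.log x)) := by
          rw [mul_sub, Finset.mul_sum]; simp only [mul_div_assoc, mul_assoc]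
        rw [e, abs_mul]
        nlinarith [mul_le_mul_of_nonneg_left h (abs_nonneg t), sq_nonneg t])
      (fun x hx ↦ by
        have h := h2 x hx
        have hC : 0 ≤ C := (abs_nonneg _).trans h
        have e : ∑ p ∈ primesTo ⌊x⌋₊, (t * f p) ^ 2 / p - t ^ 2 * V * Real.log (Real.log x) =
          t ^ 2 * (∑ p ∈ primesTo ⌊x⌋₊, f p ^ 2 / p - V * Real.log (Real.log x)) := by
          rw [mul_sub, Finset.mul_sum]; simp only [mul_div_assoc, mul_assoc, mul_pow]
        rw [e, abs_mul, abs_of_nonneg (sq_nonneg t)]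
        nlinarith [mul_le_mul_of_nonneg_left h (sq_nonneg t), mul_nonneg (abs_nonneg t) hC])
    have h' := (tendsto_add_atTop_iff_nat 1).mpr h
    refine h'.congr fun n ↦ ?_
    simp only [μ]
    rw [emp_charFun]
    congr 1
    refine Finset.sum_congr rfl fun m _ ↦ ?_
    congr 3
    simp only [hX, RCLike.inner_apply, conj_trivial, ← Finset.mul_sum]
    ring
  rw [isTightMeasureSet_iff_tendsto_measure_norm_gt] at htight
  unfold Negl
  rw [Metric.tendsto_nhds]
  intro η hη
  have h3 := (ENNReal.tendsto_nhds_zero.mp htight) (ENNReal.ofReal (η / 2)) (by simpa using hη)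
  obtain ⟨R, hR⟩ := h3.exists
  have hs_top : Tendsto (fun n ↦ Real.sqrt (LL n)) atTop atTop :=
    Real.tendsto_sqrt_atTop.comp tendsto_LL
  filter_upwards [hs_top.eventually_ge_atTop (max 1 (R / δ)), eventually_gt_atTop 0] with n hn hn0
  obtain ⟨n, rfl⟩ := Nat.exists_eq_succ_of_ne_zero hn0.ne'
  rw [Real.dist_eq, sub_zero, abs_of_nonneg (prb_nonneg _ _)]
  have h4 : μ n {x | R < ‖x‖} ≤ ENNReal.ofReal (η / 2) :=
    (le_iSup₂ (f := fun (ν : Measure ℝ) (_ : ν ∈ Set.range μ) ↦ ν {x | R < ‖x‖}) (μ n) ⟨n, rfl⟩).trans hR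
  have h5 := ENNReal.toReal_mono (by simp) h4
  rw [ENNReal.toReal_ofReal (by positivity), emp_real_apply _ _
    (measurableSet_lt measurable_const measurable_norm)] at h5
  refine lt_of_le_of_lt ((prb_mono fun m _ hm ↦ ?_).trans h5) (by linarith)
  set s := Real.sqrt (LL (n + 1)) with hs
  have hs1 : 1 ≤ s := (le_max_left _ _).trans hn
  have hsq : s ^ 2 = LL (n + 1) := by
    apply Real.sq_sqrt
    by_contra h
    rw [hs, Real.sqrt_eq_zero_of_nonpos (by linarith)] at hs1
    linarith
  have h6 : R ≤ δ * s := by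
    have := (le_max_right _ _).trans hn
    rw [div_le_iff₀ hδ] at this; linarith
  simp only [Set.mem_ofPred_eq, hX]
  rw [Real.norm_eq_abs, abs_div, ← hs, abs_of_pos (by linarith : 0 < s), lt_div_iff₀ (by linarith)]
  refine lt_of_le_of_lt ?_ hm
  rw [Nat.succ_eq_add_one, ← hsq]
  nlinarith

/-- Exponential moment of the number of prime divisors from a finite set. -/
lemma mean_pow_card_divs_le (n : ℕ) {P : Finset ℕ} (hP : ∀ p ∈ P, p.Prime) {z : ℝ} (hz : 1 ≤ z) :
    (n : ℝ)⁻¹ * ∑ m ∈ Finset.Ioc 0 n, z ^ (divs P m).card ≤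
      Real.exp ((z - 1) * ∑ p ∈ P, 1 / (p : ℝ)) := by
  have hexp : ∀ m, z ^ (divs P m).card =
      ∑ D ∈ P.powerset, (if D ⊆ divs P m then 1 else 0) * (z - 1) ^ D.card := by
    intro m
    have h1 := Finset.prod_one_add (f := fun _ : ℕ ↦ z - 1) (s := divs P m)
    simp only [add_sub_cancel, Finset.prod_const] at h1
    rw [h1]
    simp only [ite_mul, one_mul, zero_mul]
    rw [← Finset.sum_filter]
    refine Finset.sum_congr ?_ fun _ _ ↦ rfl
    ext D
    simp only [Finset.mem_powerset, Finset.mem_filter]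
    exact ⟨fun h ↦ ⟨h.trans (Finset.filter_subset _ _), h⟩, fun h ↦ h.2⟩
  simp only [hexp]
  rw [Finset.sum_comm, Finset.mul_sum]
  calc _ ≤ ∑ D ∈ P.powerset, ∏ p ∈ D, ((z - 1) * (1 / (p : ℝ))) := by
        refine Finset.sum_le_sum fun D hD ↦ ?_
        rw [← Finset.sum_mul, ← mul_assoc]
        have h2 := expU_indicator (n := n) hP (Finset.mem_powerset.mp hD)
        simp only [expU, smul_eq_mul] at h2
        rw [h2, Finset.prod_mul_distrib, Finset.prod_const, mul_comm]
        refine mul_le_mul_of_nonneg_left ?_ (pow_nonneg (by linarith) _)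
        · rcases Nat.eq_zero_or_pos n with rfl | hn
          · simp
            exact Finset.prod_nonneg fun _ _ ↦ by positivity
          have hn' : (0:ℝ) < n := by exact_mod_cast hn
          rw [inv_mul_le_iff₀ hn']
          refine (Nat.cast_div_le).trans (le_of_eq ?_)
          simp [div_eq_mul_inv]
    _ = ∏ p ∈ P, (1 + (z - 1) * (1 / (p : ℝ))) := (Finset.prod_one_add _).symm
    _ ≤ ∏ p ∈ P, Real.exp ((z - 1) * (1 / (p : ℝ))) := by
        refine Finset.prod_le_prod (fun p _ ↦ ?_) fun p _ ↦ ?_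
        · have : 0 ≤ z - 1 := by linarith
          positivity
        · rw [add_comm]; exact Real.add_one_le_exp _
    _ = _ := by rw [← Real.exp_sum, Finset.mul_sum]

/-- The primes `r ≤ n` congruent to `1` modulo `q`. -/
abbrev resPrimes (n q : ℕ) : Finset ℕ := (primesTo n).filter (fun r ↦ r % q = 1 % q)

lemma omegaQ_eq_card_divs {m n : ℕ} (hm : m ∈ Finset.Ioc 0 n) (q : ℕ) :
    omegaQ m q = (divs (resPrimes n q) m).card := by
  obtain ⟨h0, h1⟩ := Finset.mem_Ioc.mp hm
  unfold omegaQ divs resPrimes primesTo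
  congr 1
  ext r
  simp only [Finset.mem_filter, Nat.mem_primeFactors, Finset.mem_range]
  constructor
  · rintro ⟨⟨h2, h3, h4⟩, h5⟩
    exact ⟨⟨⟨by have := Nat.le_of_dvd h0 h3; omega, h2⟩, h5⟩, h3⟩
  · rintro ⟨⟨⟨h2, h3⟩, h4⟩, h5⟩
    exact ⟨⟨h3, h5, by omega⟩, h4⟩

/-- Chernoff bound for `ω(m;q,1)`. -/
lemma prb_le_omegaQ_le {n q : ℕ} {z a : ℝ} (hz : 1 ≤ z) :
    prb n (fun m ↦ a ≤ omegaQ m q) ≤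
      Real.exp ((z - 1) * ∑ p ∈ resPrimes n q, 1 / (p : ℝ)) / z ^ a := by
  have hz0 : 0 < z := by linarith
  have h := prb_le_of_mean (n := n) (S := fun m ↦ a ≤ omegaQ m q)
    (g := fun m ↦ z ^ (divs (resPrimes n q) m).card) (a := z ^ a) (by positivity)
    (fun m ↦ by positivity) (fun m hm h ↦ by
      rw [← omegaQ_eq_card_divs hm, ← Real.rpow_natCast]
      exact Real.rpow_le_rpow_of_exponent_le hz h)
  refine h.trans ?_
  gcongr
  exact mean_pow_card_divs_le n (fun p hp ↦
    (Finset.mem_filter.mp (Finset.mem_filter.mp hp).1).2) hz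

lemma prime_mod_eq_one {r p : ℕ} (hp : p.Prime) (hr : r.Prime) (h : r % p = 1 % p) :
    ∃ k, 1 ≤ k ∧ r = 1 + k * p := by
  refine ⟨r / p, ?_, ?_⟩
  · rw [Nat.one_mod_eq_one.mpr hp.one_lt.ne'] at h
    rw [Nat.one_le_div_iff hp.pos]
    by_contra hlt
    rw [Nat.mod_eq_of_lt (by omega)] at h
    exact hr.one_lt.ne' h
  · rw [Nat.one_mod_eq_one.mpr hp.one_lt.ne'] at h
    have := Nat.mod_add_div r p
    rw [h] at this
    linarith

lemma ordCompl_factorial_dvd_prod {p : ℕ} (K : ℕ) (hp : p.Prime) :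
    ordCompl[p] K.factorial ∣ ∏ k ∈ Finset.range K, (1 + (k + 1) * p) := by
  set N := ordCompl[p] K.factorial
  have hcop : Nat.Coprime p N := Nat.coprime_ordCompl hp K.factorial_ne_zero
  have : NeZero N := ⟨(Nat.ordCompl_pos p K.factorial_ne_zero).ne'⟩
  have hN : N ∣ K.factorial := Nat.ordCompl_dvd _ _
  obtain ⟨u, hu⟩ := ZMod.natCast_zmod_surjective ((p : ZMod N)⁻¹)
  have hpu : (p : ZMod N) * u = 1 := by rw [hu]; exact ZMod.coe_mul_inv_eq_one p hcop
  rw [← ZMod.natCast_eq_zero_iff]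
  have h1 : ((∏ k ∈ Finset.range K, (u + 1 + k) : ℕ) : ZMod N) = 0 := by
    rw [ZMod.natCast_eq_zero_iff, ← Nat.ascFactorial_eq_prod_range]
    exact hN.trans (Nat.factorial_dvd_ascFactorial _ _)
  have h2 : ((∏ k ∈ Finset.range K, (1 + (k + 1) * p) : ℕ) : ZMod N) =
      p ^ K * ((∏ k ∈ Finset.range K, (u + 1 + k) : ℕ) : ZMod N) := by
    push_cast
    rw [← Finset.card_range K, ← Finset.prod_const, Finset.card_range, ← Finset.prod_mul_distrib]
    refine Finset.prod_congr rfl fun k _ ↦ ?_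
    linear_combination (-1 : ZMod N) * hpu
  rw [h2, h1, mul_zero]

/-- An elementary Chebyshev-type bound in the progression `1 mod p`. -/
lemma prod_primes_le {p K : ℕ} (hp : p.Prime) {S : Finset ℕ}
    (hS : ∀ r ∈ S, r.Prime ∧ r % p = 1 % p ∧ K < r ∧ r ≤ K * p + 1) :
    ∏ r ∈ S, r ≤ (p + 1) ^ (2 * K) := by
  set N := ordCompl[p] K.factorial with hNdef
  have hN0 : 0 < N := Nat.ordCompl_pos p K.factorial_ne_zero
  have h1 : ∏ r ∈ S, r ∣ ∏ k ∈ Finset.range K, (1 + (k + 1) * p) := by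
    refine Finset.prod_primes_dvd _ (fun r hr ↦ (hS r hr).1.prime) fun r hr ↦ ?_
    obtain ⟨hr1, hr2, hr3, hr4⟩ := hS r hr
    obtain ⟨k, hk1, hk⟩ := prime_mod_eq_one hp hr1 hr2
    have hkK : k ≤ K := by
      refine le_of_mul_le_mul_right (a := p) ?_ hp.pos
      omega
    obtain ⟨j, rfl⟩ := Nat.exists_eq_add_of_le' hk1
    rw [hk]
    exact Finset.dvd_prod_of_mem (fun k ↦ 1 + (k + 1) * p) (Finset.mem_range.mpr (by omega))
  have hcop : Nat.Coprime (∏ r ∈ S, r) N := by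
    refine Nat.Coprime.prod_left fun r hr ↦ ?_
    obtain ⟨hr1, hr2, hr3, hr4⟩ := hS r hr
    rw [hr1.coprime_iff_not_dvd]
    intro h
    have := (hr1.dvd_factorial).mp (h.trans (Nat.ordCompl_dvd _ _))
    omega
  have h2 := Nat.le_of_dvd (Finset.prod_pos fun k _ ↦ by positivity)
    (hcop.mul_dvd_of_dvd_of_dvd h1 (ordCompl_factorial_dvd_prod K hp))
  have h3 : ∏ k ∈ Finset.range K, (1 + (k + 1) * p) ≤ K.factorial * (p + 1) ^ K := by
    rw [← Finset.prod_range_add_one_eq_factorial]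
    have h : (p + 1) ^ K = ∏ _k ∈ Finset.range K, (p + 1) := by simp
    rw [h, ← Finset.prod_mul_distrib]
    exact Finset.prod_le_prod' fun k _ ↦ by nlinarith
  have h4 : K.factorial = p ^ (K.factorial.factorization p) * N := (Nat.ordProj_mul_ordCompl_eq_self _ _).symm
  have : Fact p.Prime := ⟨hp⟩
  have h5 : K.factorial.factorization p ≤ K := by
    rw [Nat.factorization_def _ hp]; exact padicValNat_factorial_le p K
  have h6 : p ^ (K.factorial.factorization p) ≤ (p + 1) ^ K :=
    (Nat.pow_le_pow_right hp.pos h5).trans (Nat.pow_le_pow_left (by omega) _)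
  refine le_of_mul_le_mul_right (a := N) ?_ hN0
  calc _ ≤ K.factorial * (p + 1) ^ K := h2.trans h3
    _ = p ^ (K.factorial.factorization p) * N * (p + 1) ^ K := by rw [← h4]
    _ ≤ (p + 1) ^ K * N * (p + 1) ^ K := by gcongr
    _ = _ := by rw [two_mul, pow_add]; ring

/-- The contribution of a dyadic block. -/
lemma sum_inv_block_le {p j : ℕ} (hp : p.Prime) (hj : 1 ≤ j) {S : Finset ℕ}
    (hS : ∀ r ∈ S, r.Prime ∧ r % p = 1 % p ∧ 2 ^ j ≤ r ∧ r < 2 ^ (j + 1)) :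
    ∑ r ∈ S, 1 / (r : ℝ) ≤ 4 / Real.log 2 * (Real.log (p + 1) / p) * (1 / j) := by
  set K := (2 ^ (j + 1) - 2) / p with hK
  have hp2 := hp.two_le
  have h2j : 2 ≤ 2 ^ j := by simpa using Nat.pow_le_pow_right (n := 2) (by norm_num) hj
  have hK1 : K ≤ 2 ^ j - 1 := by
    rw [hK]; refine (Nat.div_le_div_left hp2 (by norm_num)).trans ?_
    rw [pow_succ]; omega
  have h := prod_primes_le hp (K := K) (S := S) (fun r hr ↦ by
    obtain ⟨h1, h2, h3, h4⟩ := hS r hr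
    refine ⟨h1, h2, by omega, ?_⟩
    obtain ⟨k, hk1, hk⟩ := prime_mod_eq_one hp h1 h2
    have : k ≤ K := by
      rw [hK, Nat.le_div_iff_mul_le hp.pos]; omega
    have := Nat.mul_le_mul_right p this
    omega)
  have hlogs : ∑ r ∈ S, Real.log r ≤ 2 * K * Real.log (p + 1) := by
    have h0 : ∀ r ∈ S, (r : ℝ) ≠ 0 := fun r hr ↦ by exact_mod_cast (hS r hr).1.ne_zero
    rw [← Real.log_prod h0, ← Nat.cast_prod]
    have h7 : (((∏ r ∈ S, r : ℕ)) : ℝ) ≤ ((p : ℝ) + 1) ^ (2 * K) := by exact_mod_cast h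
    have h8 : (0:ℝ) < ((∏ r ∈ S, r : ℕ) : ℝ) := by
      exact_mod_cast Finset.prod_pos fun r hr ↦ (hS r hr).1.pos
    have := Real.log_le_log h8 h7
    rw [Real.log_pow] at this
    exact_mod_cast this
  have hpR : (0:ℝ) < p := by exact_mod_cast hp.pos
  have hjR : (0:ℝ) < j := by exact_mod_cast hj
  have hlog2 : 0 < Real.log 2 := Real.log_pos (by norm_num)
  have hlp : 0 ≤ Real.log ((p:ℝ) + 1) := Real.log_nonneg (by linarith)
  have hKR : (K : ℝ) ≤ 2 ^ (j + 1) / p := by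
    rw [hK]
    refine Nat.cast_div_le.trans ?_
    gcongr
    have : 2 ^ (j + 1) - 2 ≤ 2 ^ (j + 1) := Nat.sub_le _ _
    exact_mod_cast this
  have hterm : ∀ r ∈ S, 1 / (r : ℝ) ≤ Real.log r * (1 / (2 ^ j * (j * Real.log 2))) := by
    intro r hr
    obtain ⟨h1, h2, h3, h4⟩ := hS r hr
    have h3' : (2:ℝ) ^ j ≤ r := by exact_mod_cast h3
    have h5 : j * Real.log 2 ≤ Real.log r := by
      rw [← Real.log_pow]; exact Real.log_le_log (by positivity) h3'
    rw [mul_one_div, div_le_div_iff₀ (by linarith [pow_pos (zero_lt_two' ℝ) j]) (by positivity), one_mul]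
    rw [mul_comm (Real.log _)]
    gcongr
  calc _ ≤ ∑ r ∈ S, Real.log r * (1 / (2 ^ j * (j * Real.log 2))) := Finset.sum_le_sum hterm
    _ = (∑ r ∈ S, Real.log r) * (1 / (2 ^ j * (j * Real.log 2))) := by rw [Finset.sum_mul]
    _ ≤ 2 * (2 ^ (j + 1) / p) * Real.log (p + 1) * (1 / (2 ^ j * (j * Real.log 2))) := by
        gcongr
        refine hlogs.trans ?_
        gcongr
    _ = _ := by rw [pow_succ]; field_simp; ring

lemma sum_inv_resPrimes_le {p n : ℕ} (hp : p.Prime) (hn : 2 ≤ n) :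
    ∑ r ∈ resPrimes n p, 1 / (r : ℝ) ≤ 4 / Real.log 2 * (Real.log (p + 1) / p) * (LL n + 2) := by
  have hlog2 : 0 < Real.log 2 := Real.log_pos (by norm_num)
  have hmaps : ∀ r ∈ resPrimes n p, Nat.log 2 r ∈ Finset.Icc 1 (Nat.log 2 n) := by
    intro r hr
    simp only [resPrimes, primesTo, Finset.mem_filter, Finset.mem_range] at hr
    rw [Finset.mem_Icc]
    exact ⟨Nat.log_pos (by norm_num) hr.1.2.two_le, Nat.log_mono_right (by omega)⟩
  rw [← Finset.sum_fiberwise_of_maps_to hmaps]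
  have hb : ∀ j ∈ Finset.Icc 1 (Nat.log 2 n),
      ∑ r ∈ (resPrimes n p).filter (fun r ↦ Nat.log 2 r = j), 1 / (r : ℝ) ≤
        4 / Real.log 2 * (Real.log (p + 1) / p) * (1 / j) := by
    intro j hj
    refine sum_inv_block_le hp (Finset.mem_Icc.mp hj).1 fun r hr ↦ ?_
    simp only [resPrimes, primesTo, Finset.mem_filter, Finset.mem_range] at hr
    obtain ⟨⟨⟨h1, h2⟩, h3⟩, rfl⟩ := hr
    exact ⟨h2, h3, Nat.pow_log_le_self 2 h2.ne_zero, Nat.lt_pow_succ_log_self (by norm_num) r⟩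
  refine (Finset.sum_le_sum hb).trans ?_
  rw [← Finset.mul_sum]
  have hpR : (0:ℝ) < p := by exact_mod_cast hp.pos
  have hlp : 0 ≤ Real.log ((p:ℝ) + 1) := Real.log_nonneg (by linarith)
  gcongr
  have h1 := harmonic_le_one_add_log (Nat.log 2 n)
  have h2 : ((harmonic (Nat.log 2 n) : ℚ) : ℝ) = ∑ j ∈ Finset.Icc 1 (Nat.log 2 n), 1 / (j : ℝ) := by
    rw [harmonic_eq_sum_Icc]; push_cast; simp
  rw [← h2]
  refine h1.trans ?_
  have hlog1 : 1 ≤ Nat.log 2 n := Nat.log_pos (by norm_num) hn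
  have h3 : (Nat.log 2 n : ℝ) * Real.log 2 ≤ Real.log n := by
    rw [← Real.log_pow]
    refine Real.log_le_log (by positivity) ?_
    exact_mod_cast Nat.pow_log_le_self 2 (by omega)
  have h4 : Real.log (Nat.log 2 n) + Real.log (Real.log 2) ≤ LL n := by
    have hpos : (0:ℝ) < Nat.log 2 n := by exact_mod_cast hlog1
    rw [← Real.log_mul hpos.ne' hlog2.ne']
    exact Real.log_le_log (by positivity) h3
  have h5 : -1 ≤ Real.log (Real.log 2) := by
    rw [Real.le_log_iff_exp_le hlog2]
    have := Real.log_two_gt_d9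
    have h6 : Real.exp (-1) ≤ 1 / 2 := by
      rw [Real.exp_neg, one_div]
      gcongr
      linarith [Real.add_one_le_exp (1:ℝ)]
    linarith
  linarith

lemma sum_inv_resPrimes_le_log {p n : ℕ} (hp : p.Prime) :
    ∑ r ∈ resPrimes n p, 1 / (r : ℝ) ≤ (1 + Real.log n) / p := by
  have hpR : (0:ℝ) < p := by exact_mod_cast hp.pos
  have hmem : ∀ r ∈ resPrimes n p, r ≤ n ∧ ∃ k, 1 ≤ k ∧ r = 1 + k * p ∧ r / p = k := by
    intro r hr
    simp only [resPrimes, primesTo, Finset.mem_filter, Finset.mem_range] at hr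
    obtain ⟨k, hk, rfl⟩ := prime_mod_eq_one hp hr.1.2 hr.2
    refine ⟨by omega, k, hk, rfl, ?_⟩
    rw [Nat.add_mul_div_right _ _ hp.pos, Nat.div_eq_of_lt hp.one_lt, zero_add]
  calc ∑ r ∈ resPrimes n p, 1 / (r : ℝ)
      ≤ ∑ r ∈ resPrimes n p, 1 / (p : ℝ) * (1 / ((r / p : ℕ) : ℝ)) := by
        refine Finset.sum_le_sum fun r hr ↦ ?_
        obtain ⟨-, k, hk, h1, h2⟩ := hmem r hr
        have hkR : (0:ℝ) < k := by exact_mod_cast hk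
        rw [h2, h1, one_div_mul_one_div]
        push_cast
        gcongr
        linarith [mul_comm (k:ℝ) p]
    _ = ∑ k ∈ (resPrimes n p).image (· / p), 1 / (p : ℝ) * (1 / (k : ℝ)) := by
        rw [Finset.sum_image]
        intro r hr s hs hrs
        obtain ⟨-, k, hk, h1, h2⟩ := hmem r hr
        obtain ⟨-, l, hl, h3, h4⟩ := hmem s hs
        simp only at hrs
        rw [h2, h4] at hrs
        rw [h1, h3, hrs]
    _ ≤ ∑ k ∈ Finset.Icc 1 n, 1 / (p : ℝ) * (1 / (k : ℝ)) := by
        refine Finset.sum_le_sum_of_subset_of_nonneg ?_ fun _ _ _ ↦ by positivity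
        intro k hk
        obtain ⟨r, hr, rfl⟩ := Finset.mem_image.mp hk
        obtain ⟨h0, k, hk, h1, h2⟩ := hmem r hr
        rw [Finset.mem_Icc]
        exact ⟨by simpa [h2] using hk, (Nat.div_le_self _ _).trans h0⟩
    _ ≤ _ := by
        rw [← Finset.mul_sum]
        have h1 := harmonic_le_one_add_log n
        have h2 : ((harmonic n : ℚ) : ℝ) = ∑ j ∈ Finset.Icc 1 n, 1 / (j : ℝ) := by
          rw [harmonic_eq_sum_Icc]; push_cast; simp
        rw [← h2, div_mul_eq_mul_div, one_mul]
        gcongr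

/-- Few integers have two prime factors congruent to `1` modulo a large prime. -/
lemma prb_two_le_omegaQ_le {p n : ℕ} (hp : p.Prime) (hn : 1 ≤ n) :
    prb n (fun m ↦ (2 : ℝ) ≤ omegaQ m p) ≤ Real.exp 1 * ((1 + Real.log n) ^ 2 * ((p : ℝ) ^ 2)⁻¹) := by
  have hpR : (0:ℝ) < p := by exact_mod_cast hp.pos
  have hlog : 0 ≤ Real.log n := Real.log_nonneg (by exact_mod_cast hn)
  set T := (1 + Real.log n) / p with hT
  have hT0 : 0 < T := by positivity
  have h := prb_le_omegaQ_le (n := n) (q := p) (a := 2) (z := 1 + 1 / T)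
    (by have : 0 < 1 / T := by positivity
        linarith)
  refine h.trans ?_
  have h1 : (1 + 1 / T - 1) * ∑ r ∈ resPrimes n p, 1 / (r : ℝ) ≤ 1 := by
    rw [add_sub_cancel_left, div_mul_eq_mul_div, one_mul, div_le_one hT0]
    exact sum_inv_resPrimes_le_log hp
  have h2 : (1 / T) ^ 2 ≤ (1 + 1 / T) ^ (2:ℝ) := by
    rw [Real.rpow_two]
    gcongr
    linarith
  calc _ ≤ Real.exp 1 / (1 / T) ^ 2 := by gcongr
    _ = _ := by rw [hT]; field_simp

lemma negl_very_large_prime : Negl (fun n m ↦ ∃ p : ℕ, p.Prime ∧ Real.log n ^ 3 < p ∧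
    2 ≤ omegaQ m p) := by
  have hlim : Tendsto (fun n : ℕ ↦ Real.exp 1 * (2 * (1 + Real.log n) ^ 2 / Real.log n ^ 3))
      atTop (nhds 0) := by
    have h0 : Tendsto (fun x : ℝ ↦ Real.exp 1 * (2 * (1 + x) ^ 2 / x ^ 3)) atTop (nhds 0) := by
      have hinv := tendsto_inv_atTop_zero (𝕜 := ℝ)
      have h1 : Tendsto (fun x : ℝ ↦ Real.exp 1 * (2 * (x⁻¹ + 1) ^ 2 * x⁻¹)) atTop
          (nhds (Real.exp 1 * (2 * (0 + 1) ^ 2 * 0))) :=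
        ((((hinv.add_const 1).pow 2).const_mul 2).mul hinv).const_mul _
      simp only [mul_zero] at h1
      refine h1.congr' ?_
      filter_upwards [eventually_gt_atTop 0] with x hx
      field_simp
    exact h0.comp (Real.tendsto_log_atTop.comp tendsto_natCast_atTop_atTop)
  refine squeeze_zero' (Eventually.of_forall fun n ↦ prb_nonneg _ _) ?_ hlim
  filter_upwards [eventually_ge_atTop 3] with n hn
  have hlogpos : 0 < Real.log n := Real.log_pos (by exact_mod_cast (by omega : 1 < n))
  set k := ⌊Real.log n ^ 3⌋₊ with hk
  have hmono : prb n (fun m ↦ ∃ p : ℕ, p.Prime ∧ Real.log n ^ 3 < p ∧ 2 ≤ omegaQ m p) ≤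
      prb n (fun m ↦ ∃ p ∈ (Finset.Ioo k (n + 1)).filter Nat.Prime, (2:ℝ) ≤ omegaQ m p) := by
    refine prb_mono ?_
    rintro m hm ⟨p, hp, hpl, h2⟩
    refine ⟨p, ?_, by exact_mod_cast h2⟩
    rw [Finset.mem_filter, Finset.mem_Ioo]
    refine ⟨⟨(Nat.floor_lt (by positivity)).mpr hpl, ?_⟩, hp⟩
    have h3 : 0 < omegaQ m p := by omega
    obtain ⟨r, hr⟩ := Finset.card_pos.mp h3
    rw [Finset.mem_filter, Nat.mem_primeFactors] at hr
    obtain ⟨j, hj1, hj⟩ := prime_mod_eq_one hp hr.1.1 hr.2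
    have h4 := Nat.le_of_dvd (Finset.mem_Ioc.mp hm).1 hr.1.2.1
    have h5 := (Finset.mem_Ioc.mp hm).2
    have : 1 * p ≤ j * p := Nat.mul_le_mul_right _ hj1
    omega
  refine hmono.trans ((prb_biUnion_le _ _ _).trans ?_)
  calc _ ≤ ∑ p ∈ (Finset.Ioo k (n + 1)).filter Nat.Prime,
        Real.exp 1 * ((1 + Real.log n) ^ 2 * ((p : ℝ) ^ 2)⁻¹) :=
        Finset.sum_le_sum fun p hp ↦
          prb_two_le_omegaQ_le (Finset.mem_filter.mp hp).2 (by omega)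
    _ ≤ ∑ p ∈ Finset.Ioo k (n + 1),
        Real.exp 1 * ((1 + Real.log n) ^ 2 * ((p : ℝ) ^ 2)⁻¹) :=
        Finset.sum_le_sum_of_subset_of_nonneg (Finset.filter_subset _ _) fun _ _ _ ↦ by positivity
    _ ≤ Real.exp 1 * ((1 + Real.log n) ^ 2 * (2 / (k + 1))) := by
        rw [← Finset.mul_sum, ← Finset.mul_sum]
        gcongr
        exact sum_Ioo_inv_sq_le k (n + 1)
    _ ≤ Real.exp 1 * ((1 + Real.log n) ^ 2 * (2 / Real.log n ^ 3)) := by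
        gcongr
        exact (Nat.lt_floor_add_one _).le
    _ = _ := by ring

lemma negl_medium_prime {c : ℝ} (hc : 0 < c) : ∃ y : ℕ, Negl (fun n m ↦ ∃ p : ℕ, p.Prime ∧ y < p ∧
    (p : ℝ) ≤ Real.log n ^ 3 ∧ c * LL n ≤ omegaQ m p) := by
  set z := Real.exp (5 / c) with hz
  have hz1 : 1 ≤ z := Real.one_le_exp (by positivity)
  have hy : ∃ y : ℕ, ∀ p : ℕ, y < p → (z - 1) * (4 / Real.log 2 * (Real.log (p + 1) / p)) ≤ 1 := by
    have h1 : Tendsto (fun p : ℕ ↦ Real.log ((p:ℝ) + 1) / p) atTop (nhds 0) := by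
      have h2 := (Real.isLittleO_log_id_atTop.tendsto_div_nhds_zero).comp
        (tendsto_atTop_add_const_right _ (1:ℝ) tendsto_natCast_atTop_atTop)
      have h3 : Tendsto (fun p : ℕ ↦ 2 * (Real.log ((p:ℝ) + 1) / ((p:ℝ) + 1))) atTop (nhds 0) := by
        simpa using h2.const_mul 2
      refine squeeze_zero' ?_ ?_ h3
      · filter_upwards with p
        have : 0 ≤ Real.log ((p:ℝ) + 1) := Real.log_nonneg (by linarith [p.cast_nonneg (α := ℝ)])
        positivity
      · filter_upwards [eventually_ge_atTop 1] with p hp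
        have : 0 ≤ Real.log ((p:ℝ) + 1) := Real.log_nonneg (by linarith [p.cast_nonneg (α := ℝ)])
        have hp' : (1:ℝ) ≤ p := by exact_mod_cast hp
        rw [← mul_div_assoc, div_le_div_iff₀ (by linarith) (by linarith)]
        nlinarith
    have h4 := (h1.const_mul (4 / Real.log 2)).const_mul (z - 1)
    simp only [mul_zero] at h4
    obtain ⟨y, hy⟩ := eventually_atTop.mp (h4.eventually_le_const one_pos)
    exact ⟨y, fun p hp ↦ hy p hp.le⟩
  obtain ⟨y, hy⟩ := hy
  refine ⟨y, ?_⟩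
  have hlim : Tendsto (fun n : ℕ ↦ (Real.log n ^ 3 + 1) * (Real.exp 2 * (Real.log n ^ 4)⁻¹))
      atTop (nhds 0) := by
    have h0 : Tendsto (fun x : ℝ ↦ (x ^ 3 + 1) * (Real.exp 2 * (x ^ 4)⁻¹)) atTop (nhds 0) := by
      have hinv := tendsto_inv_atTop_zero (𝕜 := ℝ)
      have h1 : Tendsto (fun x : ℝ ↦ Real.exp 2 * (x⁻¹ + x⁻¹ ^ 4)) atTop
          (nhds (Real.exp 2 * (0 + 0 ^ 4))) := (hinv.add (hinv.pow 4)).const_mul _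
      simp only [ne_eq, OfNat.ofNat_ne_zero, not_false_eq_true, zero_pow, add_zero, mul_zero] at h1
      refine h1.congr' ?_
      filter_upwards [eventually_gt_atTop 0] with x hx
      field_simp
    exact h0.comp (Real.tendsto_log_atTop.comp tendsto_natCast_atTop_atTop)
  refine squeeze_zero' (Eventually.of_forall fun n ↦ prb_nonneg _ _) ?_ hlim
  filter_upwards [eventually_ge_atTop 3, tendsto_LL.eventually_ge_atTop 0] with n hn hLL
  have hlogpos : 0 < Real.log n := Real.log_pos (by exact_mod_cast (by omega : 1 < n))
  have hexpLL : Real.exp (LL n) = Real.log n := Real.exp_log hlogpos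
  set k := ⌊Real.log n ^ 3⌋₊ with hk
  have hmono : prb n (fun m ↦ ∃ p : ℕ, p.Prime ∧ y < p ∧ (p : ℝ) ≤ Real.log n ^ 3 ∧
      c * LL n ≤ omegaQ m p) ≤
      prb n (fun m ↦ ∃ p ∈ (Finset.range (k + 1)).filter (fun p ↦ p.Prime ∧ y < p),
        c * LL n ≤ omegaQ m p) := by
    refine prb_mono ?_
    rintro m hm ⟨p, hp, hyp, hpl, h2⟩
    refine ⟨p, ?_, h2⟩
    rw [Finset.mem_filter, Finset.mem_range, Nat.lt_succ_iff]
    exact ⟨Nat.le_floor hpl, hp, hyp⟩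
  refine hmono.trans ((prb_biUnion_le _ _ _).trans ?_)
  have hterm : ∀ p ∈ (Finset.range (k + 1)).filter (fun p ↦ p.Prime ∧ y < p),
      prb n (fun m ↦ c * LL n ≤ omegaQ m p) ≤ Real.exp 2 * (Real.log n ^ 4)⁻¹ := by
    intro p hp
    obtain ⟨-, hp, hyp⟩ := Finset.mem_filter.mp hp
    refine (prb_le_omegaQ_le hz1).trans ?_
    have h1 : (z - 1) * ∑ r ∈ resPrimes n p, 1 / (r : ℝ) ≤ LL n + 2 := by
      calc _ ≤ (z - 1) * (4 / Real.log 2 * (Real.log (p + 1) / p) * (LL n + 2)) :=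
            mul_le_mul_of_nonneg_left (sum_inv_resPrimes_le hp (by omega)) (by linarith)
        _ = (z - 1) * (4 / Real.log 2 * (Real.log (p + 1) / p)) * (LL n + 2) := by ring
        _ ≤ 1 * (LL n + 2) := mul_le_mul_of_nonneg_right (hy p hyp) (by linarith)
        _ = _ := one_mul _
    have h2 : z ^ (c * LL n) = Real.log n ^ 5 := by
      rw [hz, ← Real.exp_mul, ← hexpLL, ← Real.exp_nat_mul]
      congr 1
      push_cast
      field_simp
    rw [h2]
    calc _ ≤ Real.exp (LL n + 2) / Real.log n ^ 5 := by gcongr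
      _ = _ := by rw [Real.exp_add, hexpLL]; field_simp
  refine (Finset.sum_le_card_nsmul _ _ _ hterm).trans ?_
  rw [nsmul_eq_mul]
  gcongr
  calc _ ≤ ((k + 1 : ℕ) : ℝ) := by
        exact_mod_cast (Finset.card_filter_le _ _).trans (Finset.card_range _).le
    _ ≤ _ := by
        push_cast
        gcongr
        exact Nat.floor_le (by positivity)

/-- Typically no large prime `p` has many prime factors of `m` congruent to `1` modulo `p`. -/
theorem negl_large_prime {c : ℝ} (hc : 0 < c) : ∃ y : ℕ, Negl (fun n m ↦ ∃ p : ℕ, p.Prime ∧ y < p ∧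
    c * LL n ≤ omegaQ m p) := by
  obtain ⟨y, hy⟩ := negl_medium_prime hc
  refine ⟨y, (hy.or negl_very_large_prime).mono ?_⟩
  filter_upwards [tendsto_LL.eventually_gt_atTop (1 / c)] with n hn m hm
  rintro ⟨p, hp, hyp, h⟩
  rcases le_or_gt (p : ℝ) (Real.log n ^ 3) with hle | hlt
  · exact Or.inl ⟨p, hp, hyp, hle, h⟩
  · refine Or.inr ⟨p, hp, hlt, ?_⟩
    have h1 : (1:ℝ) < omegaQ m p := by
      rw [div_lt_iff₀ hc] at hn
      linarith
    exact_mod_cast h1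

/-- The product of the cyclic groups `ℤ/a` for `a` in a list. -/
abbrev PiList (l : List ℕ) : Type := ∀ j : Fin l.length, ZMod (l.get j)

/-- Splitting off the first factor. -/
def piListCons (a : ℕ) (l : List ℕ) : ZMod a × PiList l ≃+ PiList (a :: l) :=
  (Fin.consLinearEquiv ℕ (fun j : Fin (l.length + 1) ↦ ZMod ((a :: l).get j))).toAddEquiv

def zmodMulEquiv {m n : ℕ} (h : m.Coprime n) : ZMod (m * n) ≃+ ZMod m × ZMod n :=
  (ZMod.chineseRemainder h).toAddEquiv

lemma exists_gcd_lcm_equiv {p : ℕ} (hp : p.Prime) (e : ℕ) {a : ℕ} (ha : 0 < a) :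
    ∃ f a', p ^ f ∣ a ∧ a ∣ a' ∧ 0 < a' ∧ (∀ N, p ^ e ∣ N → a ∣ N → a' ∣ N) ∧
      Nonempty (ZMod (p ^ e) × ZMod a ≃+ ZMod (p ^ f) × ZMod a') := by
  obtain ⟨v, u, hu, rfl⟩ := Nat.exists_eq_pow_mul_and_not_dvd ha.ne' p hp.ne_one
  have hcop : ∀ k, Nat.Coprime (p ^ k) u := fun k ↦
    Nat.Coprime.pow_left k ((hp.coprime_iff_not_dvd).mpr hu)
  have hu0 : 0 < u := Nat.pos_of_ne_zero fun h ↦ hu (h ▸ dvd_zero p)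
  rcases le_or_gt e v with h | h
  · exact ⟨e, _, (pow_dvd_pow p h).trans (dvd_mul_right _ _), dvd_rfl, ha, fun N _ h ↦ h,
      ⟨AddEquiv.refl _⟩⟩
  · refine ⟨v, p ^ e * u, dvd_mul_right _ _, mul_dvd_mul_right (pow_dvd_pow p h.le) u,
      Nat.mul_pos (pow_pos hp.pos e) hu0, fun N h1 h2 ↦
        (hcop e).mul_dvd_of_dvd_of_dvd h1 ((dvd_mul_left _ _).trans h2), ⟨?_⟩⟩
    exact ((AddEquiv.refl _).prodCongr (zmodMulEquiv (hcop v))).trans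
      (AddEquiv.prodAssoc.symm.trans ((AddEquiv.prodComm.prodCongr (AddEquiv.refl _)).trans
        (AddEquiv.prodAssoc.trans ((AddEquiv.refl _).prodCongr (zmodMulEquiv (hcop e)).symm))))

lemma exists_chain_insert {p : ℕ} (hp : p.Prime) (l : List ℕ) :
    ∀ e : ℕ, l.Pairwise (fun a b ↦ b ∣ a) → (∀ a ∈ l, 1 < a) →
    ∃ l' : List ℕ, l'.Pairwise (fun a b ↦ b ∣ a) ∧ (∀ a ∈ l', 1 < a) ∧
      (∀ N, p ^ e ∣ N → (∀ a ∈ l, a ∣ N) → ∀ a ∈ l', a ∣ N) ∧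
      Nonempty (ZMod (p ^ e) × PiList l ≃+ PiList l') := by
  induction l with
  | nil =>
    intro e _ _
    rcases Nat.eq_zero_or_pos e with rfl | he
    · refine ⟨[], by simp, by simp, by simp, ⟨?_⟩⟩
      have : Unique (ZMod (p ^ 0)) := by
        rw [pow_zero]; exact ⟨⟨0⟩, fun _ ↦ Subsingleton.elim _ _⟩
      exact AddEquiv.uniqueProd
    · refine ⟨[p ^ e], by simp, ?_, ?_, ⟨piListCons _ _⟩⟩
      · simpa using Nat.one_lt_pow he.ne' hp.one_lt
      · simp
  | cons a t ih =>
    intro e hl h1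
    rw [List.pairwise_cons] at hl
    obtain ⟨f, a', hfa, haa', ha'0, hlcm, ⟨E⟩⟩ :=
      exists_gcd_lcm_equiv hp e (a := a) (by have := h1 a (by simp); omega)
    obtain ⟨t', ht', h1', hN', ⟨E'⟩⟩ := ih f hl.2 (fun b hb ↦ h1 b (by simp [hb]))
    have hall : ∀ b ∈ t', b ∣ a := hN' a hfa hl.1
    refine ⟨a' :: t', List.pairwise_cons.mpr ⟨fun b hb ↦ (hall b hb).trans haa', ht'⟩, ?_, ?_, ⟨?_⟩⟩
    · intro b hb
      rcases List.mem_cons.mp hb with rfl | hb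
      · exact (h1 a (by simp)).trans_le (Nat.le_of_dvd ha'0 haa')
      · exact h1' b hb
    · intro N hN hN2 b hb
      have haN : a ∣ N := hN2 a (by simp)
      rcases List.mem_cons.mp hb with rfl | hb
      · exact hlcm N hN haN
      · exact (hall b hb).trans haN
    · exact ((AddEquiv.refl _).prodCongr (piListCons a t).symm).trans
        (AddEquiv.prodAssoc.symm.trans (((E.trans AddEquiv.prodComm).prodCongr (AddEquiv.refl _)).trans
          (AddEquiv.prodAssoc.trans (((AddEquiv.refl _).prodCongr E').trans (piListCons a' t')))))

lemma exists_chain_pi (n : ℕ) : ∀ (p e : Fin n → ℕ), (∀ i, (p i).Prime) →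
    ∃ l : List ℕ, l.Pairwise (fun a b ↦ b ∣ a) ∧ (∀ a ∈ l, 1 < a) ∧
      Nonempty ((∀ i, ZMod (p i ^ e i)) ≃+ PiList l) := by
  induction n with
  | zero =>
    intro p e _
    refine ⟨[], by simp, by simp, ⟨?_⟩⟩
    exact { toFun := fun _ j ↦ Fin.elim0 j, invFun := fun _ j ↦ Fin.elim0 j
            left_inv := fun _ ↦ Subsingleton.elim _ _, right_inv := fun _ ↦ funext fun j ↦ Fin.elim0 j
            map_add' := fun _ _ ↦ funext fun j ↦ Fin.elim0 j }
  | succ n ih =>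
    intro p e hp
    obtain ⟨l, hl, h1, ⟨E⟩⟩ := ih (fun i ↦ p i.succ) (fun i ↦ e i.succ) (fun i ↦ hp _)
    obtain ⟨l', hl', h1', -, ⟨E'⟩⟩ := exists_chain_insert (hp 0) l (e 0) hl h1
    refine ⟨l', hl', h1', ⟨?_⟩⟩
    exact (Fin.consLinearEquiv ℕ (fun j : Fin (n + 1) ↦ ZMod (p j ^ e j))).toAddEquiv.symm.trans
      (((AddEquiv.refl _).prodCongr E).trans E')

/-- Existence of the invariant factor decomposition of a finite abelian group. -/
theorem exists_invariant_factors (G : Type*) [CommGroup G] [Finite G] :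
    ∃ (K : ℕ) (lam : Fin K → ℕ), (∀ j, 1 < lam j) ∧ (∀ j k : Fin K, j ≤ k → lam j ∣ lam k) ∧
      Nonempty (G ≃* Multiplicative (∀ j : Fin K, ZMod (lam j))) := by
  obtain ⟨ι, _, p, hp, e, ⟨E⟩⟩ := AddCommGroup.equiv_directSum_zmod_of_finite (Additive G)
  let r := (Fintype.equivFin ι).symm
  obtain ⟨l, hl, h1, ⟨E'⟩⟩ := exists_chain_pi (Fintype.card ι) (p ∘ r) (e ∘ r) (fun i ↦ hp _)
  refine ⟨l.length, fun j ↦ l.get j.rev, fun j ↦ h1 _ (List.get_mem _ _), fun j k hjk ↦ ?_, ⟨?_⟩⟩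
  · rcases hjk.eq_or_lt with rfl | hlt
    · exact dvd_rfl
    · exact List.pairwise_iff_get.mp hl _ _ (Fin.rev_lt_rev.mpr hlt)
  · have e1 : Additive G ≃+ ∀ i, ZMod (p i ^ e i) := E.trans (DirectSum.addEquivProd _)
    have e2 : (∀ i, ZMod (p i ^ e i)) ≃+ ∀ j, ZMod ((p ∘ r) j ^ (e ∘ r) j) :=
      (LinearEquiv.piCongrLeft ℕ (fun i ↦ ZMod (p i ^ e i)) r).toAddEquiv.symm
    have e3 : PiList l ≃+ ∀ j : Fin l.length, ZMod (l.get j.rev) :=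
      (LinearEquiv.piCongrLeft ℕ (fun j : Fin l.length ↦ ZMod (l.get j)) Fin.revPerm).toAddEquiv.symm
    exact AddEquiv.toMultiplicativeRight (e1.trans (e2.trans (E'.trans e3)))

/-- The number of solutions of `x ^ k = 1`. -/
def tor (G : Type*) [CommGroup G] (k : ℕ) : ℕ := Nat.card (powMonoidHom k : G →* G).ker

lemma mem_powKer {G : Type*} [CommGroup G] {k : ℕ} {x : G} :
    x ∈ (powMonoidHom k : G →* G).ker ↔ x ^ k = 1 := Iff.rfl

lemma tor_congr {G H : Type*} [CommGroup G] [CommGroup H] (e : G ≃* H) (k : ℕ) :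
    tor G k = tor H k := by
  refine Nat.card_congr (e.toEquiv.subtypeEquiv fun x ↦ ?_)
  rw [mem_powKer, mem_powKer]
  change _ ↔ e x ^ k = 1
  rw [← map_pow, map_eq_one_iff e e.injective]

lemma tor_pi {ι : Type*} [Fintype ι] (G : ι → Type*) [∀ i, CommGroup (G i)] (k : ℕ) :
    tor (∀ i, G i) k = ∏ i, tor (G i) k := by
  unfold tor
  rw [← Nat.card_pi]
  refine Nat.card_congr
    { toFun := fun x i ↦ ⟨x.1 i, mem_powKer.mpr (congrFun (mem_powKer.mp x.2) i)⟩
      invFun := fun y ↦ ⟨fun i ↦ (y i).1, mem_powKer.mpr (funext fun i ↦ mem_powKer.mp (y i).2)⟩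
      left_inv := fun _ ↦ rfl
      right_inv := fun _ ↦ rfl }

lemma tor_mono {G : Type*} [CommGroup G] [Finite G] {a b : ℕ} (h : a ∣ b) : tor G a ≤ tor G b := by
  refine Subgroup.card_le_of_le fun x hx ↦ ?_
  obtain ⟨c, rfl⟩ := h
  rw [mem_powKer] at hx ⊢
  rw [pow_mul, hx, one_pow]

lemma tor_pos {G : Type*} [CommGroup G] [Finite G] (a : ℕ) : 0 < tor G a := Nat.card_pos

lemma card_eq_ker_mul_range {A B : Type*} [Group A] [Group B] (f : A →* B) :
    Nat.card A = Nat.card f.ker * Nat.card f.range := by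
  rw [← Subgroup.card_mul_index f.ker, Subgroup.index_ker]

lemma tor_mul_le {G : Type*} [CommGroup G] [Finite G] (a b : ℕ) :
    tor G (a * b) ≤ tor G a * tor G b := by
  set f := (powMonoidHom a : G →* G).comp (powMonoidHom (a * b) : G →* G).ker.subtype
  rw [tor, card_eq_ker_mul_range f]
  refine Nat.mul_le_mul ?_ ?_
  · refine Nat.card_le_card_of_injective
      (fun x : f.ker ↦ (⟨x.1.1, mem_powKer.mpr x.2⟩ : (powMonoidHom a : G →* G).ker)) ?_
    intro x y hxy
    exact Subtype.ext (Subtype.ext (congrArg (fun z ↦ z.1) hxy))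
  · refine Subgroup.card_le_of_le ?_
    rintro _ ⟨x, rfl⟩
    rw [mem_powKer]
    have := mem_powKer.mp x.2
    change ((x : G) ^ a) ^ b = 1
    rw [← pow_mul, this]

lemma tor_le_mul_index {G : Type*} [CommGroup G] [Finite G] (C : Subgroup G) (k : ℕ) :
    tor G k ≤ tor C k * C.index := by
  set f := (QuotientGroup.mk' C).comp (powMonoidHom k : G →* G).ker.subtype
  rw [tor, card_eq_ker_mul_range f]
  refine Nat.mul_le_mul ?_ ?_
  · refine Nat.card_le_card_of_injective (fun x : f.ker ↦ (⟨⟨x.1.1, ?_⟩, ?_⟩ :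
      (powMonoidHom k : C →* C).ker)) ?_
    · exact (QuotientGroup.eq_one_iff _).mp x.2
    · rw [mem_powKer]
      exact Subtype.ext (mem_powKer.mp x.1.2)
    · intro x y hxy
      exact Subtype.ext (Subtype.ext (congrArg (fun z ↦ z.1.1) hxy))
  · exact Subgroup.card_le_card_group _

lemma tor_cyclic {G : Type*} [CommGroup G] [Finite G] [IsCyclic G] (k : ℕ) :
    tor G k = (Nat.card G).gcd k := IsCyclic.card_powMonoidHom_ker G k

lemma gcd_prime_pow_succ {l : ℕ} (hl : l.Prime) (N α : ℕ) :
    N.gcd (l ^ (α + 1)) = N.gcd (l ^ α) * l ^ (if l ^ (α + 1) ∣ N then 1 else 0) := by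
  split_ifs with h
  · rw [Nat.gcd_eq_right h, Nat.gcd_eq_right ((pow_dvd_pow l (Nat.le_succ α)).trans h), pow_succ,
      pow_one]
  · rw [pow_zero, mul_one]
    refine Nat.dvd_antisymm (Nat.dvd_gcd (Nat.gcd_dvd_left _ _) ?_)
      (Nat.gcd_dvd_gcd_of_dvd_right _ (pow_dvd_pow l (Nat.le_succ α)))
    obtain ⟨k, hk, hk'⟩ := (Nat.dvd_prime_pow hl).mp (Nat.gcd_dvd_right N (l ^ (α + 1)))
    rw [hk']
    refine pow_dvd_pow l ?_
    by_contra hlt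
    have : k = α + 1 := by omega
    rw [this] at hk'
    exact h (hk' ▸ Nat.gcd_dvd_left _ _)

lemma tor_cyclic_pow_succ {G : Type*} [CommGroup G] [Finite G] [IsCyclic G] {l : ℕ} (hl : l.Prime)
    (α : ℕ) : tor G (l ^ (α + 1)) =
      tor G (l ^ α) * l ^ (if l ^ (α + 1) ∣ Nat.card G then 1 else 0) := by
  rw [tor_cyclic, tor_cyclic, gcd_prime_pow_succ hl]

lemma card_units_prime_pow {p v : ℕ} (hp : p.Prime) (hv : 0 < v) :
    Nat.card (ZMod (p ^ v))ˣ = p ^ (v - 1) * (p - 1) := by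
  have : NeZero (p ^ v) := ⟨pow_ne_zero _ hp.ne_zero⟩
  rw [Nat.card_eq_fintype_card, ZMod.card_units_eq_totient, Nat.totient_prime_pow hp hv]

lemma tor_units_two_pow_le {v l : ℕ} (hv : 0 < v) (hl : l.Prime) :
    tor (ZMod (2 ^ v))ˣ l ≤ l ^ 2 := by
  have hne : NeZero (2 ^ v) := ⟨pow_ne_zero _ two_ne_zero⟩
  have hcard := card_units_prime_pow Nat.prime_two hv
  rcases Nat.lt_or_ge v 2 with h | h
  · have : v = 1 := by omega
    subst this
    refine (Subgroup.card_le_card_group _).trans ?_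
    rw [hcard]
    simpa using Nat.one_le_pow 2 l hl.pos
  · obtain ⟨n, rfl⟩ := Nat.exists_eq_add_of_le' h
    have h5 : IsUnit (5 : ZMod (2 ^ (n + 2))) := by
      have : ((5 : ℕ) : ZMod (2 ^ (n + 2))) = 5 := by norm_num
      rw [← this, ZMod.isUnit_iff_coprime]
      exact Nat.Coprime.pow_right _ (by norm_num)
    obtain ⟨g, hg⟩ := h5
    have hord : Nat.card (Subgroup.zpowers g) = 2 ^ n := by
      rw [Nat.card_zpowers, ← orderOf_units, hg, ZMod.orderOf_five]
    have hidx : (Subgroup.zpowers g).index = 2 := by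
      have := Subgroup.card_mul_index (Subgroup.zpowers g)
      rw [hcard, hord] at this
      have h2 : 2 ^ n * (Subgroup.zpowers g).index = 2 ^ n * 2 := by
        rw [this]; simp [pow_succ]
      exact Nat.eq_of_mul_eq_mul_left (by positivity) h2
    calc _ ≤ tor (Subgroup.zpowers g) l * (Subgroup.zpowers g).index := tor_le_mul_index _ _
      _ ≤ l * l := by
        rw [hidx, tor_cyclic]
        exact Nat.mul_le_mul (Nat.le_of_dvd hl.pos (Nat.gcd_dvd_right _ _)) hl.two_le
      _ = l ^ 2 := (sq l).symm

lemma tor_units_prime_pow {p v l α : ℕ} (hp : p.Prime) (hv : 0 < v) (hl : l.Prime) :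
    tor (ZMod (p ^ v))ˣ (l ^ α) * l ^ (if p % l ^ (α + 1) = 1 % l ^ (α + 1) then 1 else 0) ≤
      tor (ZMod (p ^ v))ˣ (l ^ (α + 1)) ∧
    tor (ZMod (p ^ v))ˣ (l ^ (α + 1)) ≤
      tor (ZMod (p ^ v))ˣ (l ^ α) * l ^ (if p % l ^ (α + 1) = 1 % l ^ (α + 1) then 1 else 0) *
        l ^ (if p = 2 then 2 else if p = l then 1 else 0) := by
  have hne : NeZero (p ^ v) := ⟨pow_ne_zero _ hp.ne_zero⟩
  have hq : 1 < l ^ (α + 1) := Nat.one_lt_pow (by omega) hl.one_lt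
  have h1q : 1 % l ^ (α + 1) = 1 := Nat.mod_eq_of_lt hq
  have hmono : tor (ZMod (p ^ v))ˣ (l ^ α) ≤ tor (ZMod (p ^ v))ˣ (l ^ (α + 1)) :=
    tor_mono (pow_dvd_pow l (Nat.le_succ α))
  by_cases h2 : p = 2
  · subst h2
    have hw : ¬ 2 % l ^ (α + 1) = 1 % l ^ (α + 1) := by
      rw [h1q]
      rcases (Nat.succ_le_of_lt hq).eq_or_lt with h | h
      · rw [← h]; norm_num
      · rw [Nat.mod_eq_of_lt h]; norm_num
    rw [if_neg hw, if_pos rfl, pow_zero, mul_one]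
    refine ⟨hmono, ?_⟩
    rw [pow_succ]
    exact (tor_mul_le _ _).trans (Nat.mul_le_mul_left _ (tor_units_two_pow_le hv hl))
  · have hcyc := ZMod.isCyclic_units_of_prime_pow p hp h2 v
    have hcard := card_units_prime_pow hp hv
    rw [if_neg h2]
    by_cases hpl : p = l
    · subst hpl
      have hw : ¬ p % p ^ (α + 1) = 1 % p ^ (α + 1) := by
        rw [h1q]
        intro h
        have h3 : p ^ (α + 1) ∣ p - 1 :=
          (Nat.modEq_iff_dvd' hp.pos).mp (by unfold Nat.ModEq; rw [h1q, h])
        have h4 := Nat.le_of_dvd (by have := hp.two_le; omega) ((dvd_pow_self p (by omega)).trans h3)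
        have := hp.two_le
        omega
      rw [if_neg hw, if_pos rfl, pow_zero, mul_one]
      refine ⟨hmono, ?_⟩
      rw [tor_cyclic_pow_succ hl]
      refine Nat.mul_le_mul_left _ (Nat.pow_le_pow_right hl.pos ?_)
      split_ifs <;> norm_num
    · rw [if_neg hpl, pow_zero, mul_one, tor_cyclic_pow_succ hl]
      have hiff : l ^ (α + 1) ∣ Nat.card (ZMod (p ^ v))ˣ ↔ p % l ^ (α + 1) = 1 % l ^ (α + 1) := by
        rw [hcard, Nat.Coprime.dvd_mul_left
          (Nat.Coprime.pow _ _ ((Nat.coprime_primes hl hp).mpr (Ne.symm hpl))),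
          ← Nat.modEq_iff_dvd' hp.pos]
        exact eq_comm
      simp only [hiff]
      exact ⟨le_rfl, le_rfl⟩

lemma tor_eq_of_invariant_factors {G : Type*} [CommGroup G] {K : ℕ} {lam : Fin K → ℕ}
    (h1 : ∀ j, 1 < lam j) (E : G ≃* Multiplicative (∀ j : Fin K, ZMod (lam j))) {l : ℕ}
    (hl : l.Prime) (α : ℕ) :
    tor G (l ^ (α + 1)) = tor G (l ^ α) *
      l ^ (Finset.univ.filter fun j : Fin K ↦ l ^ (α + 1) ∣ lam j).card := by
  have hne : ∀ j, NeZero (lam j) := fun j ↦ ⟨by have := h1 j; omega⟩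
  have h : ∀ k, tor G k = ∏ j, tor (Multiplicative (ZMod (lam j))) k := fun k ↦ by
    rw [tor_congr (E.trans (MulEquiv.piMultiplicative fun j ↦ ZMod (lam j))), tor_pi]
  rw [h, h, Finset.card_filter, ← Finset.prod_pow_eq_pow_sum, ← Finset.prod_mul_distrib]
  refine Finset.prod_congr rfl fun j _ ↦ ?_
  rw [tor_cyclic_pow_succ hl]
  have : Nat.card (Multiplicative (ZMod (lam j))) = lam j := Nat.card_zmod _
  rw [this]

/-- The number of invariant factors divisible by a prime power `q` is `ω(m;q,1) + O(1)`. -/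
theorem omegaQ_le_card_dvd_le {m : ℕ} (hm : 1 ≤ m) {K : ℕ} {lam : Fin K → ℕ}
    (h1 : ∀ j, 1 < lam j) (E : (ZMod m)ˣ ≃* Multiplicative (∀ j : Fin K, ZMod (lam j))) {q : ℕ}
    (hq : IsPrimePow q) :
    omegaQ m q ≤ (Finset.univ.filter fun j : Fin K ↦ q ∣ lam j).card ∧
      (Finset.univ.filter fun j : Fin K ↦ q ∣ lam j).card ≤ omegaQ m q + 3 := by
  obtain ⟨l, β, hl, hβ, rfl⟩ := (isPrimePow_nat_iff _).mp hq
  obtain ⟨α, rfl⟩ := Nat.exists_eq_add_of_le' hβ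
  have hm0 : m ≠ 0 := by omega
  have hmne : NeZero m := ⟨hm0⟩
  have hG := tor_eq_of_invariant_factors h1 E hl α
  set c := (Finset.univ.filter fun j : Fin K ↦ l ^ (α + 1) ∣ lam j).card with hc
  have hprod : ∀ k, tor (ZMod m)ˣ k =
      ∏ p : m.primeFactors, tor (ZMod ((p : ℕ) ^ m.factorization p))ˣ k := fun k ↦ by
    rw [tor_congr ((Units.mapEquiv (ZMod.equivPi m hm0).toMulEquiv).trans MulEquiv.piUnits), tor_pi]
  have hv : ∀ p : m.primeFactors, 0 < m.factorization p := fun p ↦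
    (Nat.prime_of_mem_primeFactors p.2).factorization_pos_of_dvd hm0 (Nat.dvd_of_mem_primeFactors p.2)
  have hω : omegaQ m (l ^ (α + 1)) =
      ∑ p : m.primeFactors, if (p : ℕ) % l ^ (α + 1) = 1 % l ^ (α + 1) then 1 else 0 := by
    rw [omegaQ, Finset.card_filter, ← Finset.sum_coe_sort]
  have hfac := fun p : m.primeFactors ↦
    tor_units_prime_pow (α := α) (Nat.prime_of_mem_primeFactors p.2) (hv p) hl
  have hlow : tor (ZMod m)ˣ (l ^ α) * l ^ omegaQ m (l ^ (α + 1)) ≤ tor (ZMod m)ˣ (l ^ (α + 1)) := by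
    rw [hprod, hprod, hω, ← Finset.prod_pow_eq_pow_sum, ← Finset.prod_mul_distrib]
    exact Finset.prod_le_prod' fun p _ ↦ (hfac p).1
  have hexc : ∑ p : m.primeFactors, (if (p : ℕ) = 2 then 2 else if (p : ℕ) = l then 1 else 0) ≤ 3 := by
    rw [Finset.sum_coe_sort m.primeFactors (fun p ↦ if p = 2 then 2 else if p = l then 1 else 0)]
    calc _ ≤ ∑ p ∈ m.primeFactors, ((if p = 2 then 2 else 0) + (if p = l then 1 else 0)) :=
          Finset.sum_le_sum fun p _ ↦ by split_ifs <;> norm_num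
      _ ≤ 2 + 1 := by
          rw [Finset.sum_add_distrib, Finset.sum_ite_eq', Finset.sum_ite_eq']
          split_ifs <;> norm_num
  have hup : tor (ZMod m)ˣ (l ^ (α + 1)) ≤
      tor (ZMod m)ˣ (l ^ α) * l ^ (omegaQ m (l ^ (α + 1)) + 3) := by
    refine le_trans ?_ (Nat.mul_le_mul_left _ (Nat.pow_le_pow_right hl.pos (Nat.add_le_add_left hexc _)))
    rw [hprod, hprod, pow_add l (omegaQ m (l ^ (α + 1))), hω, ← Finset.prod_pow_eq_pow_sum, ← Finset.prod_pow_eq_pow_sum,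
      ← mul_assoc, ← Finset.prod_mul_distrib, ← Finset.prod_mul_distrib]
    exact Finset.prod_le_prod' fun p _ ↦ (hfac p).2
  rw [hG] at hlow hup
  have htor := tor_pos (G := (ZMod m)ˣ) (l ^ α)
  exact ⟨(Nat.pow_le_pow_iff_right hl.one_lt).mp (Nat.le_of_mul_le_mul_left hlow htor),
    (Nat.pow_le_pow_iff_right hl.one_lt).mp (Nat.le_of_mul_le_mul_left hup htor)⟩

/-- The indicator of `p ≡ 1 (mod q)`. -/
def resInd (q p : ℕ) : ℝ := if p % q = 1 % q then 1 else 0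

lemma resInd_sq (q p : ℕ) : resInd q p ^ 2 = resInd q p := by
  unfold resInd; split_ifs <;> norm_num

lemma abs_resInd_le (q p : ℕ) : |resInd q p| ≤ 1 := by
  unfold resInd; split_ifs <;> norm_num

lemma resInd_mul {q r : ℕ} (h : q.Coprime r) (p : ℕ) : resInd q p * resInd r p = resInd (q * r) p := by
  have : p % (q * r) = 1 % (q * r) ↔ p % q = 1 % q ∧ p % r = 1 % r :=
    (Nat.modEq_and_modEq_iff_modEq_mul h).symm
  unfold resInd
  simp only [this]
  split_ifs <;> simp_all

lemma sum_resInd (m q : ℕ) : ∑ p ∈ m.primeFactors, resInd q p = omegaQ m q := by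
  simp only [resInd, Finset.sum_boole, omegaQ]

lemma mertens_resInd {q : ℕ} (hq : 0 < q) : ∃ C : ℝ, ∀ x : ℝ, 3 ≤ x →
    |∑ p ∈ primesTo ⌊x⌋₊, resInd q p / p - (q.totient : ℝ)⁻¹ * Real.log (Real.log x)| ≤ C := by
  have : NeZero q := ⟨hq.ne'⟩
  obtain ⟨C, hC⟩ := mertens_primeInd (q := q) (a := 1) isUnit_one
  refine ⟨C, fun x hx ↦ ?_⟩
  convert hC x hx using 3
  rw [primesTo, Finset.sum_filter]
  refine Finset.sum_congr rfl fun p _ ↦ ?_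
  have h : ((p : ZMod q) = 1) ↔ p % q = 1 % q := by
    rw [← Nat.cast_one, ZMod.natCast_eq_natCast_iff']
  unfold resInd primeInd
  by_cases h1 : p.Prime <;> by_cases h2 : p % q = 1 % q <;> simp [h, h1, h2]

/-- The normal order of `ω(m;q,1)`. -/
lemma negl_omegaQ_deviation {q : ℕ} (hq : 0 < q) {δ : ℝ} (hδ : 0 < δ) :
    Negl (fun n m ↦ δ * LL n < |(omegaQ m q : ℝ) - (q.totient : ℝ)⁻¹ * LL n|) := by
  obtain ⟨C, hC⟩ := mertens_resInd hq
  have := negl_additive_deviation (f := resInd q) (abs_resInd_le q) hC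
    (V := (q.totient : ℝ)⁻¹) (by simpa only [resInd_sq] using hC) hδ
  simpa only [sum_resInd] using this

lemma omegaQ_anti (m : ℕ) {q r : ℕ} (h : q ∣ r) : omegaQ m r ≤ omegaQ m q := by
  refine Finset.card_le_card fun p hp ↦ ?_
  rw [Finset.mem_filter] at hp ⊢
  exact ⟨hp.1, (show p ≡ 1 [MOD r] from hp.2).of_dvd h⟩

lemma dvd_of_primePow_dvd {a b : ℕ} (h : ∀ q, IsPrimePow q → q ∣ a → q ∣ b) : a ∣ b := by
  refine (Nat.dvd_iff_prime_pow_dvd_dvd b a).mpr fun p k hp hpk ↦ ?_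
  rcases Nat.eq_zero_or_pos k with rfl | hk
  · simp
  · exact h _ (hp.isPrimePow.pow hk.ne') hpk

/-- In a divisibility chain, the multiplicity of `d` is determined by the numbers of terms
divisible by prime powers. -/
lemma card_chain_eq {K : ℕ} {lam : Fin K → ℕ}
    (hch : ∀ j k : Fin K, j ≤ k → lam j ∣ lam k) {d : ℕ} {c : ℕ → ℕ}
    (hc : ∀ q, c q = (Finset.univ.filter fun j : Fin K ↦ q ∣ lam j).card) {q₁ q₂ q₃ q₄ : ℕ}
    (h₁ : IsPrimePow q₁ ∧ q₁ ∣ d) (h₂ : IsPrimePow q₂ ∧ q₂ ∣ d)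
    (h₃ : IsPrimePow q₃ ∧ ¬ q₃ ∣ d) (h₄ : IsPrimePow q₄ ∧ ¬ q₄ ∣ d)
    (hmin : ∀ q, IsPrimePow q → q ∣ d → min (c q₁) (c q₂) ≤ c q)
    (hmax : ∀ q, IsPrimePow q → ¬ q ∣ d → c q ≤ max (c q₃) (c q₄)) :
    (Finset.univ.filter fun j : Fin K ↦ lam j = d).card = min (c q₁) (c q₂) - max (c q₃) (c q₄) := by
  have hcK : ∀ q, c q ≤ K := fun q ↦ by
    rw [hc]; exact (Finset.card_filter_le _ _).trans (by simp)
  have hdvd : ∀ q (j : Fin K), q ∣ lam j ↔ K ≤ j + c q := by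
    intro q j
    constructor
    · intro h
      have hsub : Finset.Ici j ⊆ Finset.univ.filter fun j : Fin K ↦ q ∣ lam j := fun k hk ↦ by
        simpa using h.trans (hch j k (Finset.mem_Ici.mp hk))
      have := Finset.card_le_card hsub
      rw [Fin.card_Ici, ← hc] at this
      omega
    · intro h
      by_contra hn
      have hsub : (Finset.univ.filter fun j : Fin K ↦ q ∣ lam j) ⊆ Finset.Ioi j := fun k hk ↦ by
        rw [Finset.mem_Ioi]
        by_contra hle
        exact hn ((Finset.mem_filter.mp hk).2.trans (hch k j (not_lt.mp hle)))
      have := Finset.card_le_card hsub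
      rw [Fin.card_Ioi, ← hc] at this
      have := j.2
      omega
  set M := min (c q₁) (c q₂) with hM
  set N := max (c q₃) (c q₄) with hN
  have hMK : M ≤ K := (min_le_left _ _).trans (hcK _)
  have hiff : ∀ j : Fin K, lam j = d ↔ K ≤ j + M ∧ ¬ K ≤ j + N := by
    intro j
    constructor
    · intro h
      constructor
      · rcases min_choice (c q₁) (c q₂) with h' | h' <;> rw [hM, h', ← hdvd, h]
        exacts [h₁.2, h₂.2]
      · rcases max_choice (c q₃) (c q₄) with h' | h' <;> rw [hN, h', ← hdvd, h]
        exacts [h₃.2, h₄.2]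
    · rintro ⟨h, h'⟩
      refine Nat.dvd_antisymm (dvd_of_primePow_dvd fun q hq hqj ↦ ?_)
        (dvd_of_primePow_dvd fun q hq hqd ↦ ?_)
      · by_contra hqd
        have := hmax q hq hqd
        rw [hdvd] at hqj
        omega
      · rw [hdvd]
        have := hmin q hq hqd
        omega
  simp only [hiff]
  rw [← Finset.card_map Fin.valEmbedding]
  have : (Finset.univ.filter fun j : Fin K ↦ K ≤ j + M ∧ ¬ K ≤ j + N).map Fin.valEmbedding =
      Finset.Ico (K - M) (K - N) := by
    ext x
    simp only [Finset.mem_map, Finset.mem_filter, Finset.mem_univ, true_and, Fin.valEmbedding_apply,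
      Finset.mem_Ico]
    constructor
    · rintro ⟨j, hj, rfl⟩
      omega
    · intro hx
      exact ⟨⟨x, by omega⟩, by simp only; omega, rfl⟩
  rw [this, Nat.card_Ico]
  omega

lemma exists_small_primePow_dvd {B y q : ℕ} (hB : 1 ≤ B) (hq : IsPrimePow q) (hφ : B < q.totient)
    (hy : ∀ p : ℕ, p.Prime → p ∣ q → p ≤ y) :
    ∃ q', q' ∣ q ∧ 0 < q' ∧ B < q'.totient ∧ q' ≤ 2 * B * y := by
  classical
  obtain ⟨l, α, hl, hα, rfl⟩ := (isPrimePow_nat_iff _).mp hq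
  have hly : l ≤ y := hy l hl (dvd_pow_self l hα.ne')
  have hex : ∃ k, B < (l ^ k).totient := ⟨α, hφ⟩
  refine ⟨l ^ Nat.find hex, pow_dvd_pow l (Nat.find_min' hex hφ), pow_pos hl.pos _,
    Nat.find_spec hex, ?_⟩
  have hpos : 0 < Nat.find hex := by
    by_contra h
    have h0 : Nat.find hex = 0 := by omega
    have := Nat.find_spec hex
    rw [h0] at this
    simp at this
    omega
  obtain ⟨k, hk⟩ : ∃ k, Nat.find hex = k + 1 := ⟨_, (Nat.succ_pred_eq_of_pos hpos).symm⟩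
  have hkB := Nat.find_min hex (m := k) (by omega)
  rw [hk, pow_succ]
  refine Nat.mul_le_mul ?_ hly
  rcases Nat.eq_zero_or_pos k with rfl | hk0
  · simp; omega
  · rw [Nat.totient_prime_pow hl hk0] at hkB
    obtain ⟨j, rfl⟩ : ∃ j, k = j + 1 := ⟨_, (Nat.succ_pred_eq_of_pos hk0).symm⟩
    have := hl.two_le
    have h2 : l ≤ 2 * (l - 1) := by omega
    calc l ^ (j + 1) = l ^ j * l := pow_succ _ _
      _ ≤ l ^ j * (2 * (l - 1)) := Nat.mul_le_mul_left _ h2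
      _ = 2 * (l ^ (j + 1 - 1) * (l - 1)) := by rw [Nat.add_sub_cancel]; ring
      _ ≤ 2 * B := by omega

/-- The arithmetic data around a singleton factor order set between two ties. -/
structure TieData (d q₁ q₂ q₃ q₄ A B : ℕ) : Prop where
  A_pos : 1 ≤ A
  A_lt_B : A < B
  pp₁ : IsPrimePow q₁
  pp₂ : IsPrimePow q₂
  pp₃ : IsPrimePow q₃
  pp₄ : IsPrimePow q₄
  tot₁ : q₁.totient = A
  tot₂ : q₂.totient = A
  tot₃ : q₃.totient = B
  tot₄ : q₄.totient = B
  dvd_iff : ∀ q : ℕ, IsPrimePow q → (q ∣ d ↔ q.totient ≤ A)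
  eq_A : ∀ q : ℕ, IsPrimePow q → q.totient = A → q = q₁ ∨ q = q₂
  B_le : ∀ q : ℕ, IsPrimePow q → A < q.totient → B ≤ q.totient
  eq_B : ∀ q : ℕ, IsPrimePow q → q.totient = B → q = q₃ ∨ q = q₄

/-- Typically the multiplicity of `d` is `min (ω₁, ω₂) - max (ω₃, ω₄)` up to a bounded error. -/
theorem negl_invCount_deviation {d q₁ q₂ q₃ q₄ A B : ℕ} (h : TieData d q₁ q₂ q₃ q₄ A B)
    {J : ℕ → ℕ} (hJ : IsInvCount d J) :
    Negl (fun _ m ↦ ¬ |(J m : ℝ) - (min (omegaQ m q₁ : ℝ) (omegaQ m q₂) -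
      max (omegaQ m q₃ : ℝ) (omegaQ m q₄))| ≤ 3) := by
  have hAR : (1:ℝ) ≤ A := by exact_mod_cast h.A_pos
  have hABR : (A:ℝ) + 1 ≤ B := by exact_mod_cast h.A_lt_B
  set g : ℝ := 1 / (B * (B + 1)) with hg
  have hBpos : (0:ℝ) < B := by linarith
  have hg0 : 0 < g := by positivity
  have hgap : ∀ s t : ℕ, 1 ≤ s → s < t → s ≤ B → g ≤ (s : ℝ)⁻¹ - (t : ℝ)⁻¹ := by
    intro s t hs hst hsB
    have h1 : (1:ℝ) ≤ s := by exact_mod_cast hs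
    have h2 : (s:ℝ) + 1 ≤ t := by exact_mod_cast hst
    have h3 : (s:ℝ) ≤ B := by exact_mod_cast hsB
    calc g ≤ 1 / ((s:ℝ) * (s + 1)) := by rw [hg]; gcongr
      _ = (s:ℝ)⁻¹ - ((s:ℝ) + 1)⁻¹ := by field_simp; ring
      _ ≤ _ := by gcongr
  set δ := g / 4 with hδ
  have hδ0 : 0 < δ := by positivity
  obtain ⟨y, hy⟩ := negl_large_prime hδ0
  set Y := 2 * B * y + d + q₁ + q₂ + q₃ + q₄ with hY
  have hLLN := Negl.biUnion (Finset.Icc 1 Y) (S := fun q n m ↦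
    δ * LL n < |(omegaQ m q : ℝ) - (q.totient : ℝ)⁻¹ * LL n|)
    (fun q hq ↦ negl_omegaQ_deviation (Finset.mem_Icc.mp hq).1 hδ0)
  refine (hy.or hLLN).mono ?_
  filter_upwards [tendsto_LL.eventually_ge_atTop (3 / (2 * δ))] with n hn m hm hbad
  by_contra hgood
  refine hbad ?_
  push Not at hgood
  obtain ⟨hlarge, hlln⟩ := hgood
  have hL : 3 ≤ 2 * δ * LL n := by
    rw [div_le_iff₀ (by positivity)] at hn; linarith
  have hL0 : 0 < LL n := by
    by_contra hneg
    nlinarith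
  have hm1 : 1 ≤ m := (Finset.mem_Ioc.mp hm).1
  have hmne : NeZero m := ⟨by omega⟩
  obtain ⟨K, lam, hlam1, hch, ⟨E⟩⟩ := exists_invariant_factors (ZMod m)ˣ
  have hJm := hJ m hm1 K lam hlam1 hch ⟨E⟩
  set c : ℕ → ℕ := fun q ↦ (Finset.univ.filter fun j : Fin K ↦ q ∣ lam j).card with hc
  have hcω : ∀ q, IsPrimePow q → omegaQ m q ≤ c q ∧ c q ≤ omegaQ m q + 3 := fun q hq ↦
    omegaQ_le_card_dvd_le hm1 hlam1 E hq
  have hd0 : 0 < d := by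
    rcases Nat.eq_zero_or_pos d with rfl | hd
    · have := (h.dvd_iff q₃ h.pp₃).mp (dvd_zero _)
      have := h.tot₃
      have := h.A_lt_B
      omega
    · exact hd
  have hsep : ∀ q r, q ∈ Finset.Icc 1 Y → r ∈ Finset.Icc 1 Y → q.totient < r.totient →
      q.totient ≤ B → omegaQ m r + 3 ≤ omegaQ m q := by
    intro q r hq hr hqr hqB
    have h1 := hgap q.totient r.totient (Nat.totient_pos.mpr (Finset.mem_Icc.mp hq).1) hqr hqB
    have h2 := abs_le.mp (hlln q hq)
    have h3 := abs_le.mp (hlln r hr)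
    have h4 : (4 * δ) * LL n ≤ ((q.totient : ℝ)⁻¹ - (r.totient : ℝ)⁻¹) * LL n := by
      gcongr
      rw [hδ]; linarith
    have h5 : (omegaQ m r : ℝ) + 3 ≤ omegaQ m q := by nlinarith [h2.1, h2.2, h3.1, h3.2]
    exact_mod_cast h5
  have hmem : ∀ q, IsPrimePow q → q ≤ Y → q ∈ Finset.Icc 1 Y := fun q hq hqY ↦
    Finset.mem_Icc.mpr ⟨hq.pos, hqY⟩
  have hm₁ := hmem q₁ h.pp₁ (by omega)
  have hm₂ := hmem q₂ h.pp₂ (by omega)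
  have hm₃ := hmem q₃ h.pp₃ (by omega)
  have hm₄ := hmem q₄ h.pp₄ (by omega)
  have hAB := h.A_lt_B
  have ht₁ := h.tot₁
  have ht₂ := h.tot₂
  have ht₃ := h.tot₃
  have ht₄ := h.tot₄
  have hc₁ := hcω q₁ h.pp₁
  have hc₂ := hcω q₂ h.pp₂
  have hc₃ := hcω q₃ h.pp₃
  have hc₄ := hcω q₄ h.pp₄
  have h13 := hsep q₁ q₃ hm₁ hm₃ (by omega) (by omega)
  have h14 := hsep q₁ q₄ hm₁ hm₄ (by omega) (by omega)
  have h23 := hsep q₂ q₃ hm₂ hm₃ (by omega) (by omega)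
  have h24 := hsep q₂ q₄ hm₂ hm₄ (by omega) (by omega)
  have hcard := card_chain_eq hch (d := d) (c := c) (fun _ ↦ rfl) (q₁ := q₁) (q₂ := q₂) (q₃ := q₃)
    (q₄ := q₄) ⟨h.pp₁, (h.dvd_iff _ h.pp₁).mpr (by omega)⟩ ⟨h.pp₂, (h.dvd_iff _ h.pp₂).mpr (by omega)⟩
    ⟨h.pp₃, fun hd ↦ by have := (h.dvd_iff _ h.pp₃).mp hd; omega⟩
    ⟨h.pp₄, fun hd ↦ by have := (h.dvd_iff _ h.pp₄).mp hd; omega⟩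
    (fun q hq hqd ↦ by
      have hle := (h.dvd_iff q hq).mp hqd
      rcases hle.eq_or_lt with heq | hlt
      · rcases h.eq_A q hq heq with rfl | rfl
        exacts [min_le_left _ _, min_le_right _ _]
      · have := hsep q q₁ (hmem q hq (by have := Nat.le_of_dvd hd0 hqd; omega)) hm₁ (by omega) (by omega)
        have := hcω q hq
        exact (min_le_left _ _).trans (by omega))
    (fun q hq hqd ↦ by
      have hlt : A < q.totient := by
        by_contra hle
        exact hqd ((h.dvd_iff q hq).mpr (by omega))
      rcases (h.B_le q hq hlt).eq_or_lt with heq | hBlt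
      · rcases h.eq_B q hq heq.symm with rfl | rfl
        exacts [le_max_left _ _, le_max_right _ _]
      · have hkey : omegaQ m q + 3 ≤ omegaQ m q₃ := by
          by_cases hyq : ∀ p : ℕ, p.Prime → p ∣ q → p ≤ y
          · obtain ⟨q', hq'1, hq'0, hq'2, hq'3⟩ :=
              exists_small_primePow_dvd (B := B) (by omega) hq hBlt hyq
            have := hsep q₃ q' hm₃ (Finset.mem_Icc.mpr ⟨hq'0, by omega⟩) (by omega) (by omega)
            have := omegaQ_anti m hq'1
            omega
          · push Not at hyq
            obtain ⟨p, hp, hpq, hyp⟩ := hyq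
            have h1 := hlarge p hp hyp
            have h2 : (omegaQ m q : ℝ) ≤ omegaQ m p := by exact_mod_cast omegaQ_anti m hpq
            have h3 := abs_le.mp (hlln q₃ hm₃)
            rw [ht₃] at h3
            have h4 := hgap B (B + 1) (by omega) (by omega) le_rfl
            have h5 : (4 * δ) * LL n ≤ (B : ℝ)⁻¹ * LL n := by
              gcongr
              rw [hδ]
              have : (0:ℝ) ≤ ((B + 1 : ℕ) : ℝ)⁻¹ := by positivity
              linarith
            have h6 : (omegaQ m q : ℝ) + 3 ≤ omegaQ m q₃ := by nlinarith [h3.1]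
            exact_mod_cast h6
        have := hcω q hq
        exact le_trans (by omega) (le_max_left _ _))
  rw [← hJm] at hcard
  have hmaxle : max (c q₃) (c q₄) ≤ min (c q₁) (c q₂) :=
    max_le (le_min (by omega) (by omega)) (le_min (by omega) (by omega))
  have hJR : (J m : ℝ) = min (c q₁ : ℝ) (c q₂) - max (c q₃ : ℝ) (c q₄) := by
    rw [hcard, Nat.cast_sub hmaxle]; push_cast; rfl
  rw [hJR]
  have e : ∀ q, IsPrimePow q → (omegaQ m q : ℝ) ≤ c q ∧ (c q : ℝ) ≤ omegaQ m q + 3 := fun q hq ↦ by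
    exact_mod_cast hcω q hq
  have e₁ := e q₁ h.pp₁
  have e₂ := e q₂ h.pp₂
  have e₃ := e q₃ h.pp₃
  have e₄ := e q₄ h.pp₄
  have a1 : min (omegaQ m q₁ : ℝ) (omegaQ m q₂) ≤ min (c q₁ : ℝ) (c q₂) := min_le_min e₁.1 e₂.1
  have a2 : min (c q₁ : ℝ) (c q₂) ≤ min (omegaQ m q₁ : ℝ) (omegaQ m q₂) + 3 := by
    rw [← min_add_add_right]; exact min_le_min e₁.2 e₂.2
  have a3 : max (omegaQ m q₃ : ℝ) (omegaQ m q₄) ≤ max (c q₃ : ℝ) (c q₄) := max_le_max e₃.1 e₄.1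
  have a4 : max (c q₃ : ℝ) (c q₄) ≤ max (omegaQ m q₃ : ℝ) (omegaQ m q₄) + 3 := by
    rw [← max_add_add_right]; exact max_le_max e₃.2 e₄.2
  rw [abs_le]
  constructor <;> linarith

lemma IsPrimePow.le_two_mul_totient {q : ℕ} (hq : IsPrimePow q) : q ≤ 2 * q.totient := by
  obtain ⟨p, k, hp, hk, rfl⟩ := (isPrimePow_nat_iff q).mp hq
  obtain ⟨j, rfl⟩ : ∃ j, k = j + 1 := ⟨_, (Nat.succ_pred_eq_of_pos hk).symm⟩
  rw [Nat.totient_prime_pow_succ hp, pow_succ, mul_left_comm]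
  have := hp.two_le
  exact Nat.mul_le_mul_left _ (by omega)

lemma ppKey_lt_of_totient_lt {q r : ℕ} (hq : IsPrimePow q) (h : q.totient < r.totient) :
    ppKey q < ppKey r := by
  have h1 := hq.le_two_mul_totient
  have h2 := Nat.totient_le r
  have h3 : (q.totient + 1) ^ 2 ≤ r.totient ^ 2 := Nat.pow_le_pow_left h 2
  unfold ppKey
  nlinarith

lemma ppKey_inj {q r : ℕ} (hq : IsPrimePow q) (hr : IsPrimePow r) (h : ppKey q = ppKey r) :
    q = r := by
  rcases lt_trichotomy q.totient r.totient with h1 | h1 | h1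
  · have := ppKey_lt_of_totient_lt hq h1; omega
  · unfold ppKey at h; rw [h1] at h; omega
  · have := ppKey_lt_of_totient_lt hr h1; omega

lemma infinite_ppKey : (Set.ofPred fun k ↦ ∃ q : ℕ, IsPrimePow q ∧ ppKey q = k).Infinite := by
  have h := Nat.infinite_setOfPred_prime.image (f := ppKey) (fun p hp r hr h ↦
    ppKey_inj (Nat.Prime.isPrimePow hp) (Nat.Prime.isPrimePow hr) h)
  refine h.mono ?_
  rintro _ ⟨p, hp, rfl⟩
  exact ⟨p, Nat.Prime.isPrimePow hp, rfl⟩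

lemma qt_spec (i : ℕ) : IsPrimePow (qt i) ∧ ppKey (qt i) = ppNthKey (i - 1) :=
  Nat.sInf_mem (s := {q : ℕ | IsPrimePow q ∧ ppKey q = ppNthKey (i - 1)})
    (Nat.nth_mem_of_infinite infinite_ppKey (i - 1))

lemma totient_qt_mono {i j : ℕ} (hij : i ≤ j) : (qt i).totient ≤ (qt j).totient := by
  by_contra! h
  have h1 := ppKey_lt_of_totient_lt (qt_spec j).1 h
  rw [(qt_spec i).2, (qt_spec j).2] at h1
  have h2 := (Nat.nth_strictMono infinite_ppKey).lt_iff_lt.mp h1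
  omega

lemma qt_inj {i j : ℕ} (hi : 1 ≤ i) (hj : 1 ≤ j) (h : qt i = qt j) : i = j := by
  have h1 : ppNthKey (i - 1) = ppNthKey (j - 1) := by
    rw [← (qt_spec i).2, ← (qt_spec j).2, h]
  have h2 := Nat.nth_injective infinite_ppKey h1
  omega

lemma exists_qt_eq {q : ℕ} (hq : IsPrimePow q) : ∃ j, 1 ≤ j ∧ qt j = q := by
  have h : ppKey q ∈ Set.range (Nat.nth fun k ↦ ∃ q : ℕ, IsPrimePow q ∧ ppKey q = k) := by
    rw [Nat.range_nth_of_infinite infinite_ppKey]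
    exact ⟨q, hq, rfl⟩
  obtain ⟨n, hn⟩ := h
  refine ⟨n + 1, by omega, ppKey_inj (qt_spec _).1 hq ?_⟩
  rw [(qt_spec _).2, Nat.add_sub_cancel, ← hn]
  rfl

lemma dvd_of_primePow_dvd_lcm {q : ℕ} (hq : IsPrimePow q) (s : Finset ℕ) (f : ℕ → ℕ)
    (hf : ∀ j ∈ s, f j ≠ 0) (h : q ∣ s.lcm f) : ∃ j ∈ s, q ∣ f j := by
  induction s using Finset.induction_on with
  | empty =>
    rw [Finset.lcm_empty, Nat.dvd_one] at h
    exact absurd h hq.ne_one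
  | insert a s ha ih =>
    rw [Finset.lcm_insert] at h
    have ha0 := hf a (Finset.mem_insert_self a s)
    have hs0 : s.lcm f ≠ 0 := by
      rw [Ne, Finset.lcm_eq_zero_iff]
      rintro ⟨j, hj, hj0⟩
      exact hf j (Finset.mem_insert_of_mem hj) hj0
    obtain ⟨p, k, hp, hk, rfl⟩ := (isPrimePow_nat_iff q).mp hq
    change p ^ k ∣ Nat.lcm (f a) (s.lcm f) at h
    rw [hp.pow_dvd_iff_le_factorization (Nat.lcm_ne_zero ha0 hs0),
      Nat.factorization_lcm ha0 hs0, Finsupp.sup_apply, le_sup_iff,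
      ← hp.pow_dvd_iff_le_factorization ha0, ← hp.pow_dvd_iff_le_factorization hs0] at h
    rcases h with h | h
    · exact ⟨a, Finset.mem_insert_self a s, h⟩
    · obtain ⟨j, hj, hjd⟩ := ih (fun j hj ↦ hf j (Finset.mem_insert_of_mem hj)) h
      exact ⟨j, Finset.mem_insert_of_mem hj, hjd⟩

lemma exists_eq_pow_add_two {q : ℕ} (hq : IsPrimePow q) (h : ¬ q.Prime) :
    ∃ p k : ℕ, p.Prime ∧ q = p ^ (k + 2) := by
  obtain ⟨p, k, hp, hk, rfl⟩ := (isPrimePow_nat_iff q).mp hq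
  rcases k with _ | _ | k
  · omega
  · simp [hp] at h
  · exact ⟨p, k, hp, rfl⟩

lemma totient_pow_add_two {p : ℕ} (hp : p.Prime) (k : ℕ) :
    (p ^ (k + 2)).totient = p ^ (k + 1) * (p - 1) :=
  Nat.totient_prime_pow_succ hp (k + 1)

lemma le_of_dvd_pow_mul_pred {p r k : ℕ} (hp : p.Prime) (hr : r.Prime) (h : r ∣ p ^ k * (p - 1)) :
    r ≤ p := by
  rcases hr.dvd_mul.mp h with h | h
  · exact Nat.le_of_dvd hp.pos (hr.dvd_of_dvd_pow h)
  · have := hp.two_le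
    have := Nat.le_of_dvd (by omega) h
    omega

lemma base_eq_of_totient_eq {p r k l : ℕ} (hp : p.Prime) (hr : r.Prime)
    (h : p ^ (k + 1) * (p - 1) = r ^ (l + 1) * (r - 1)) : p = r := by
  refine le_antisymm (le_of_dvd_pow_mul_pred hr hp (k := l + 1) ?_)
    (le_of_dvd_pow_mul_pred hp hr (k := k + 1) ?_)
  · rw [← h]; exact (dvd_pow_self p (by omega)).mul_right _
  · rw [h]; exact (dvd_pow_self r (by omega)).mul_right _

lemma eq_of_totient_eq {q r : ℕ} (hq : IsPrimePow q) (hr : IsPrimePow r)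
    (h : q.totient = r.totient) (hqr : q.Prime ↔ r.Prime) : q = r := by
  by_cases hqp : q.Prime
  · have hrp := hqr.mp hqp
    rw [Nat.totient_prime hqp, Nat.totient_prime hrp] at h
    have := hqp.two_le
    have := hrp.two_le
    omega
  · obtain ⟨p, k, hp, rfl⟩ := exists_eq_pow_add_two hq hqp
    obtain ⟨s, l, hs, rfl⟩ := exists_eq_pow_add_two hr (fun h' ↦ hqp (hqr.mpr h'))
    rw [totient_pow_add_two hp, totient_pow_add_two hs] at h
    obtain rfl := base_eq_of_totient_eq hp hs h
    have h1 : 0 < p - 1 := by have := hp.two_le; omega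
    have h2 := Nat.pow_right_injective hp.two_le (Nat.eq_of_mul_eq_mul_right h1 h)
    have : k = l := by simpa using h2
    rw [this]

lemma eq_or_eq_of_totient_eq {q r s : ℕ} (hq : IsPrimePow q) (hr : IsPrimePow r)
    (hs : IsPrimePow s) (hqr : q ≠ r) (h1 : q.totient = r.totient) (h2 : s.totient = q.totient) :
    s = q ∨ s = r := by
  by_contra! h
  have a1 := mt (eq_of_totient_eq hq hr h1) hqr
  have a2 := mt (eq_of_totient_eq hs hq h2) h.1
  have a3 := mt (eq_of_totient_eq hs hr (h2.trans h1)) h.2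
  tauto

/-- A tie `φ(q) = φ(r)` occurs only between a prime and a proper prime power. -/
lemma exists_prime_of_tie {q r : ℕ} (hq : IsPrimePow q) (hr : IsPrimePow r) (hqr : q ≠ r)
    (h : q.totient = r.totient) :
    ∃ p k : ℕ, p.Prime ∧ (q.totient + 1).Prime ∧ q.totient = p ^ (k + 1) * (p - 1) ∧
      ((q = q.totient + 1 ∧ r = p ^ (k + 2)) ∨ (r = q.totient + 1 ∧ q = p ^ (k + 2))) := by
  have aux : ∀ q r : ℕ, IsPrimePow r → q.totient = r.totient → q.Prime → ¬ r.Prime →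
      ∃ p k : ℕ, p.Prime ∧ (q.totient + 1).Prime ∧ q.totient = p ^ (k + 1) * (p - 1) ∧
        q = q.totient + 1 ∧ r = p ^ (k + 2) := by
    intro q r hr h hqp hrp
    obtain ⟨p, k, hp, rfl⟩ := exists_eq_pow_add_two hr hrp
    have hq1 : q.totient + 1 = q := by
      rw [Nat.totient_prime hqp]; have := hqp.two_le; omega
    exact ⟨p, k, hp, by rwa [hq1], by rw [h, totient_pow_add_two hp], hq1.symm, rfl⟩
  have hne := mt (eq_of_totient_eq hq hr h) hqr
  by_cases hqp : q.Prime
  · obtain ⟨p, k, h1, h2, h3, h4⟩ := aux q r hr h hqp (by tauto)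
    exact ⟨p, k, h1, h2, h3, Or.inl h4⟩
  · obtain ⟨p, k, h1, h2, h3, h4⟩ := aux r q hq h.symm (by tauto) hqp
    rw [← h] at h2 h3 h4
    exact ⟨p, k, h1, h2, h3, Or.inr h4⟩

lemma not_prime_two_pow_succ_pair {k : ℕ} (hk : 2 ≤ k) (h1 : (2 ^ k + 1).Prime) :
    ¬ (2 ^ (k + 1) + 1).Prime := by
  intro h2
  have h4 : 4 ≤ 2 ^ k := by
    calc 4 = 2 ^ 2 := by norm_num
      _ ≤ 2 ^ k := Nat.pow_le_pow_right (by norm_num) hk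
  have h3 : ¬ 3 ∣ 2 ^ k := fun h ↦ by
    have := (Nat.prime_dvd_prime_iff_eq Nat.prime_three Nat.prime_two).mp
      (Nat.prime_three.dvd_of_dvd_pow h)
    omega
  rw [pow_succ] at h2
  generalize 2 ^ k = x at h1 h2 h3 h4
  have h5 : x % 3 = 1 ∨ x % 3 = 2 := by omega
  have : 3 ∣ x + 1 ∨ 3 ∣ x * 2 + 1 := by omega
  rcases this with h | h
  · have := (Nat.prime_dvd_prime_iff_eq Nat.prime_three h1).mp h; omega
  · have := (Nat.prime_dvd_prime_iff_eq Nat.prime_three h2).mp h; omega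

/-- Members of two consecutive ties are pairwise coprime. -/
lemma coprime_of_ties {A B q₁ q₂ q₃ q₄ : ℕ} (hA : 3 ≤ A) (hAB : A < B) (hBA : B ≤ 2 * A + 1)
    (pp₁ : IsPrimePow q₁) (pp₂ : IsPrimePow q₂) (pp₃ : IsPrimePow q₃) (pp₄ : IsPrimePow q₄)
    (tot₁ : q₁.totient = A) (tot₂ : q₂.totient = A) (tot₃ : q₃.totient = B)
    (tot₄ : q₄.totient = B) (h12 : q₁ ≠ q₂) (h34 : q₃ ≠ q₄) :
    (q₁.Coprime q₂ ∧ q₃.Coprime q₄) ∧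
      ((q₁.Coprime q₃ ∧ q₁.Coprime q₄) ∧ (q₂.Coprime q₃ ∧ q₂.Coprime q₄)) := by
  obtain ⟨p, k, hp, hPA, hAe, hA'⟩ := exists_prime_of_tie pp₁ pp₂ h12 (by omega)
  obtain ⟨r, l, hr, hPB, hBe, hB'⟩ := exists_prime_of_tie pp₃ pp₄ h34 (by omega)
  rw [tot₁] at hPA hAe hA'
  rw [tot₃] at hPB hBe hB'
  have hp2 := hp.two_le
  have hr2 := hr.two_le
  have hpA : p ≤ A := Nat.le_of_dvd (by omega)
    (hAe ▸ (dvd_pow_self p (by omega)).mul_right _)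
  have hrB : r ≤ B := Nat.le_of_dvd (by omega)
    (hBe ▸ (dvd_pow_self r (by omega)).mul_right _)
  have n1 : A + 1 ≠ r := by
    rintro rfl
    have h1 : (A + 1) * A ≤ B := by
      rw [hBe, Nat.add_sub_cancel]
      exact Nat.mul_le_mul_right _ (Nat.le_self_pow (by omega) _)
    nlinarith
  have n2 : p ≠ r := by
    rintro rfl
    have hkl : k < l := by
      by_contra! hlk
      have : p ^ (l + 1) * (p - 1) ≤ p ^ (k + 1) * (p - 1) :=
        Nat.mul_le_mul_right _ (Nat.pow_le_pow_right hp.pos (by omega))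
      omega
    have hdvd : A * p ^ (l - k) = B := by
      rw [hAe, hBe, mul_right_comm, ← pow_add]
      congr 2
      omega
    have hp2' : p ^ (l - k) < 3 := by
      by_contra! h
      have := Nat.mul_le_mul_left A h
      omega
    have hple : p ≤ p ^ (l - k) := Nat.le_self_pow (by omega) _
    obtain rfl : p = 2 := by omega
    have hlk : l = k + 1 := by
      by_contra hne
      have : 2 ^ 2 ≤ 2 ^ (l - k) := Nat.pow_le_pow_right (by norm_num) (by omega)
      omega
    subst hlk
    simp only [Nat.add_one_sub_one, mul_one] at hAe hBe
    have hk1 : 2 ≤ k + 1 := by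
      by_contra hk
      have : k = 0 := by omega
      subst this
      omega
    rw [hAe] at hPA
    rw [hBe] at hPB
    exact not_prime_two_pow_succ_pair hk1 hPA hPB
  have c1 : (A + 1).Coprime (p ^ (k + 2)) :=
    ((Nat.coprime_primes hPA hp).mpr (by omega)).pow_right _
  have c2 : (B + 1).Coprime (r ^ (l + 2)) :=
    ((Nat.coprime_primes hPB hr).mpr (by omega)).pow_right _
  have c3 : (A + 1).Coprime (B + 1) := (Nat.coprime_primes hPA hPB).mpr (by omega)
  have c4 : (A + 1).Coprime (r ^ (l + 2)) := ((Nat.coprime_primes hPA hr).mpr n1).pow_right _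
  have c5 : (p ^ (k + 2)).Coprime (B + 1) :=
    ((Nat.coprime_primes hp hPB).mpr (by omega)).pow_left _
  have c6 : (p ^ (k + 2)).Coprime (r ^ (l + 2)) := ((Nat.coprime_primes hp hr).mpr n2).pow _ _
  rcases hA' with ⟨rfl, rfl⟩ | ⟨rfl, rfl⟩ <;> rcases hB' with ⟨rfl, rfl⟩ | ⟨rfl, rfl⟩
  · exact ⟨⟨c1, c2⟩, ⟨c3, c4⟩, c5, c6⟩
  · exact ⟨⟨c1, c2.symm⟩, ⟨c4, c3⟩, c6, c5⟩
  · exact ⟨⟨c1.symm, c2⟩, ⟨c5, c6⟩, c3, c4⟩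
  · exact ⟨⟨c1.symm, c2.symm⟩, ⟨c6, c5⟩, c4, c3⟩

lemma le_three_of_totient_le_two {q : ℕ} (hq : IsPrimePow q) (h : q.totient ≤ 2) :
    q ∈ ({2, 3, 4} : Finset ℕ) := by
  have h1 := hq.le_two_mul_totient
  have h2 := hq.one_lt
  simp only [Finset.mem_insert, Finset.mem_singleton]
  omega

lemma three_le_totient_qt {i : ℕ} (hi : 3 < i) : 3 ≤ (qt i).totient := by
  by_contra! h
  have h1 : (Finset.Icc 1 i).image qt ⊆ ({2, 3, 4} : Finset ℕ) := by
    intro q hq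
    obtain ⟨j, hj, rfl⟩ := Finset.mem_image.mp hq
    have := totient_qt_mono (Finset.mem_Icc.mp hj).2
    exact le_three_of_totient_le_two (qt_spec j).1 (by omega)
  have h2 := Finset.card_le_card h1
  rw [Finset.card_image_of_injOn fun a ha b hb hab ↦
    qt_inj (Finset.mem_Icc.mp ha).1 (Finset.mem_Icc.mp hb).1 hab] at h2
  simp at h2
  omega

lemma totient_eq_of_ncard_UFO {i : ℕ} (h : (UFO i).ncard = 2) :
    (qt i).totient = (qt (i + 1)).totient := by
  refine le_antisymm (totient_qt_mono (Nat.le_succ i)) ?_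
  by_contra! hlt
  simp [UFO, hlt] at h

/-- A singleton factor order set between two ties yields `TieData`. -/
theorem tieData_of_ncard_UFO {i d : ℕ} (hi : 3 < i) (h1 : (UFO (i - 1)).ncard = 2)
    (h3 : (UFO (i + 1)).ncard = 2) (hd : UFO i = {d}) :
    TieData d (qt (i - 1)) (qt i) (qt (i + 1)) (qt (i + 2)) (qt i).totient
      (qt (i + 1)).totient := by
  have t1 := totient_eq_of_ncard_UFO h1
  rw [Nat.sub_add_cancel (by omega)] at t1
  have t3 := totient_eq_of_ncard_UFO h3
  have ne12 : qt (i - 1) ≠ qt i := fun h ↦ by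
    have := qt_inj (by omega) (by omega) h; omega
  have ne34 : qt (i + 1) ≠ qt (i + 2) := fun h ↦ by
    have := qt_inj (by omega) (by omega) h; omega
  have eqA : ∀ q : ℕ, IsPrimePow q → q.totient = (qt i).totient → q = qt (i - 1) ∨ q = qt i :=
    fun q hq h ↦ eq_or_eq_of_totient_eq (qt_spec _).1 (qt_spec _).1 hq ne12 t1 (h.trans t1.symm)
  have hlt : (qt i).totient < (qt (i + 1)).totient := by
    refine lt_of_le_of_ne (totient_qt_mono (Nat.le_succ i)) fun h ↦ ?_
    rcases eqA _ (qt_spec (i + 1)).1 h.symm with h' | h'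
    all_goals
      have := qt_inj (by omega) (by omega) h'
      omega
  have hdL : d = Lseq i := by
    rw [UFO, if_pos hlt] at hd
    exact (Set.singleton_injective hd).symm
  have := three_le_totient_qt hi
  exact
    { A_pos := by omega
      A_lt_B := hlt
      pp₁ := (qt_spec _).1
      pp₂ := (qt_spec _).1
      pp₃ := (qt_spec _).1
      pp₄ := (qt_spec _).1
      tot₁ := t1
      tot₂ := rfl
      tot₃ := rfl
      tot₄ := t3.symm
      dvd_iff := fun q hq ↦ by
        rw [hdL]
        constructor
        · intro h
          obtain ⟨j, hj, hqj⟩ := dvd_of_primePow_dvd_lcm hq _ _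
            (fun j _ ↦ (qt_spec j).1.pos.ne') h
          exact (Nat.le_of_dvd (Nat.totient_pos.mpr (qt_spec j).1.pos)
            (Nat.totient_dvd_of_dvd hqj)).trans (totient_qt_mono (Finset.mem_Icc.mp hj).2)
        · intro h
          obtain ⟨j, hj, rfl⟩ := exists_qt_eq hq
          refine Finset.dvd_lcm (Finset.mem_Icc.mpr ⟨hj, ?_⟩)
          by_contra! hij
          have := totient_qt_mono (Nat.succ_le_of_lt hij)
          simp only [Nat.succ_eq_add_one] at this
          omega
      eq_A := eqA
      B_le := fun q hq h ↦ by
        obtain ⟨j, hj, rfl⟩ := exists_qt_eq hq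
        by_contra! hB
        have : j ≤ i := by
          by_contra! hij
          have := totient_qt_mono (Nat.succ_le_of_lt hij)
          simp only [Nat.succ_eq_add_one] at this
          omega
        have := totient_qt_mono this
        omega
      eq_B := fun q hq h ↦
        eq_or_eq_of_totient_eq (qt_spec _).1 (qt_spec _).1 hq ne34 t3 h }

/-- In the situation of `tieData_of_ncard_UFO` the four prime powers are pairwise coprime. -/
theorem TieData.coprime {d q₁ q₂ q₃ q₄ A B : ℕ} (h : TieData d q₁ q₂ q₃ q₄ A B) (hA : 3 ≤ A)
    (h12 : q₁ ≠ q₂) (h34 : q₃ ≠ q₄) :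
    (q₁.Coprime q₂ ∧ q₃.Coprime q₄) ∧
      ((q₁.Coprime q₃ ∧ q₁.Coprime q₄) ∧ (q₂.Coprime q₃ ∧ q₂.Coprime q₄)) := by
  refine coprime_of_ties hA h.A_lt_B ?_ h.pp₁ h.pp₂ h.pp₃ h.pp₄ h.tot₁ h.tot₂ h.tot₃ h.tot₄ h12 h34
  obtain ⟨s, hs, h1, h2⟩ := Nat.exists_prime_lt_and_le_two_mul (A + 1) (by omega)
  have := h.B_le s hs.isPrimePow (by rw [Nat.totient_prime hs]; omega)
  rw [Nat.totient_prime hs] at this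
  omega

/-- The sums of `g p / p` over primes are `κ log log x + O(1)`. -/
def HasMertens (g : ℕ → ℝ) (κ : ℝ) : Prop :=
  ∃ C : ℝ, ∀ x : ℝ, 3 ≤ x →
    |∑ p ∈ primesTo ⌊x⌋₊, g p / p - κ * Real.log (Real.log x)| ≤ C

lemma HasMertens.const_mul {g : ℕ → ℝ} {κ : ℝ} (h : HasMertens g κ) (c : ℝ) :
    HasMertens (fun p ↦ c * g p) (c * κ) := by
  obtain ⟨C, hC⟩ := h
  refine ⟨|c| * C, fun x hx ↦ ?_⟩
  have e : ∑ p ∈ primesTo ⌊x⌋₊, c * g p / p - c * κ * Real.log (Real.log x) =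
      c * (∑ p ∈ primesTo ⌊x⌋₊, g p / p - κ * Real.log (Real.log x)) := by
    simp only [mul_div_assoc, ← Finset.mul_sum]
    ring
  rw [e, abs_mul]
  exact mul_le_mul_of_nonneg_left (hC x hx) (abs_nonneg c)

lemma HasMertens.sum {ι : Type*} (s : Finset ι) {g : ι → ℕ → ℝ} {κ : ι → ℝ}
    (h : ∀ j ∈ s, HasMertens (g j) (κ j)) :
    HasMertens (fun p ↦ ∑ j ∈ s, g j p) (∑ j ∈ s, κ j) := by
  choose! C hC using h
  refine ⟨∑ j ∈ s, C j, fun x hx ↦ ?_⟩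
  have e : ∑ p ∈ primesTo ⌊x⌋₊, (∑ j ∈ s, g j p) / p - (∑ j ∈ s, κ j) * Real.log (Real.log x) =
      ∑ j ∈ s, (∑ p ∈ primesTo ⌊x⌋₊, g j p / p - κ j * Real.log (Real.log x)) := by
    simp only [Finset.sum_div, Finset.sum_sub_distrib, Finset.sum_mul]
    rw [Finset.sum_comm]
  rw [e]
  exact (Finset.abs_sum_le_sum_abs _ _).trans (Finset.sum_le_sum fun j hj ↦ hC j hj x hx)

/-- A linear combination of the functions `ω(m; q_j, 1)` with pairwise coprime moduli satisfies a
central limit theorem, expressed through characteristic functions. -/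
theorem tendsto_charAvg_omegaQ {k : ℕ} (q : Fin k → ℕ) (hq : ∀ j, 0 < q j)
    (hcop : ∀ i j, i ≠ j → (q i).Coprime (q j)) (c : Fin k → ℝ) {V κ : ℝ}
    (hκ : κ = ∑ j, c j * ((q j).totient : ℝ)⁻¹)
    (hV : V = ∑ i, ∑ j, c i * c j * if i = j then ((q i).totient : ℝ)⁻¹ else
      ((q i).totient : ℝ)⁻¹ * ((q j).totient : ℝ)⁻¹) :
    Tendsto (fun n : ℕ ↦ (n : ℝ)⁻¹ • ∑ m ∈ Finset.Ioc 0 n, Complex.exp (Complex.I *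
      (((∑ j, c j * (omegaQ m (q j) : ℝ) - κ * LL n) / Real.sqrt (LL n) : ℝ) : ℂ)))
      atTop (nhds (Complex.exp (-(V / 2)))) := by
  set f : ℕ → ℝ := fun p ↦ ∑ j, c j * resInd (q j) p with hf
  have hK : ∀ p, |f p| ≤ ∑ j, |c j| := fun p ↦
    (Finset.abs_sum_le_sum_abs _ _).trans (Finset.sum_le_sum fun j _ ↦ by
      rw [abs_mul]
      exact mul_le_of_le_one_right (abs_nonneg _) (abs_resInd_le _ _))
  have h1 : HasMertens f κ := by
    rw [hκ]
    exact HasMertens.sum _ fun j _ ↦ HasMertens.const_mul (mertens_resInd (hq j)) (c j)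
  have h2 : HasMertens (fun p ↦ f p ^ 2) V := by
    have e : (fun p ↦ f p ^ 2) = fun p ↦ ∑ i, ∑ j, c i * c j * (resInd (q i) p * resInd (q j) p) := by
      ext p
      rw [sq, hf, Finset.sum_mul_sum]
      exact Finset.sum_congr rfl fun i _ ↦ Finset.sum_congr rfl fun j _ ↦ by ring
    rw [e, hV]
    refine HasMertens.sum _ fun i _ ↦ HasMertens.sum _ fun j _ ↦ HasMertens.const_mul ?_ _
    split_ifs with hij
    · subst hij
      simp only [← sq, resInd_sq]
      exact mertens_resInd (hq i)
    · have hc := hcop i j hij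
      simp only [resInd_mul hc]
      have := mertens_resInd (Nat.mul_pos (hq i) (hq j))
      rwa [Nat.totient_mul hc, Nat.cast_mul, mul_inv] at this
  obtain ⟨C₁, hC₁⟩ := h1
  obtain ⟨C₂, hC₂⟩ := h2
  have h := erdosKac_charFun (K := ∑ j, |c j|) (C := max C₁ C₂) hK
    (fun x hx ↦ (hC₁ x hx).trans (le_max_left _ _)) (fun x hx ↦ (hC₂ x hx).trans (le_max_right _ _))
  have e : ∀ m : ℕ, ∑ p ∈ m.primeFactors, f p = ∑ j, c j * (omegaQ m (q j) : ℝ) := fun m ↦ by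
    rw [hf, Finset.sum_comm]
    simp only [← Finset.mul_sum, sum_resInd]
  simpa only [e] using h

/-- Characteristic function averages are insensitive to perturbations which are small outside a
negligible set. -/
lemma tendsto_charAvg_of_negl {Y Z : ℕ → ℕ → ℝ} {ε : ℕ → ℝ} {l : ℂ}
    (hZ : Tendsto (fun n : ℕ ↦ (n : ℝ)⁻¹ • ∑ m ∈ Finset.Ioc 0 n,
      Complex.exp (Complex.I * (Z n m : ℂ))) atTop (nhds l))
    (hε : Tendsto ε atTop (nhds 0)) (h : Negl fun n m ↦ ¬ |Y n m - Z n m| ≤ ε n) :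
    Tendsto (fun n : ℕ ↦ (n : ℝ)⁻¹ • ∑ m ∈ Finset.Ioc 0 n,
      Complex.exp (Complex.I * (Y n m : ℂ))) atTop (nhds l) := by
  classical
  refine hZ.congr_dist ?_
  refine squeeze_zero (g := fun n ↦ |ε n| + 2 * prb n (fun m ↦ ¬ |Y n m - Z n m| ≤ ε n))
    (fun n ↦ dist_nonneg) (fun n ↦ ?_) ?_
  · rw [dist_comm, dist_eq_norm, ← smul_sub, ← Finset.sum_sub_distrib, norm_smul, prb_eq_sum]
    have h1 : ‖∑ m ∈ Finset.Ioc 0 n, (Complex.exp (Complex.I * (Y n m : ℂ)) -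
        Complex.exp (Complex.I * (Z n m : ℂ)))‖ ≤
        ∑ m ∈ Finset.Ioc 0 n, (|ε n| + 2 * if ¬ |Y n m - Z n m| ≤ ε n then (1:ℝ) else 0) := by
      refine (norm_sum_le _ _).trans (Finset.sum_le_sum fun m _ ↦ ?_)
      by_cases hm : |Y n m - Z n m| ≤ ε n
      · rw [if_neg (not_not.mpr hm), mul_zero, add_zero]
        exact (norm_exp_I_sub_exp_I_le _ _).trans (hm.trans (le_abs_self _))
      · rw [if_pos hm, mul_one]
        refine (norm_sub_le _ _).trans ?_
        rw [mul_comm Complex.I, mul_comm Complex.I, Complex.norm_exp_ofReal_mul_I,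
          Complex.norm_exp_ofReal_mul_I]
        linarith [abs_nonneg (ε n)]
    rw [Finset.sum_add_distrib, ← Finset.mul_sum, Finset.sum_const, Nat.card_Ioc, tsub_zero,
      nsmul_eq_mul] at h1
    rw [norm_inv, Real.norm_natCast]
    calc (n : ℝ)⁻¹ * _ ≤ (n : ℝ)⁻¹ * _ := mul_le_mul_of_nonneg_left h1 (by positivity)
      _ = ((n : ℝ)⁻¹ * n) * |ε n| + 2 * ((n : ℝ)⁻¹ *
          ∑ m ∈ Finset.Ioc 0 n, if ¬ |Y n m - Z n m| ≤ ε n then (1:ℝ) else 0) := by ring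
      _ ≤ _ := by
        gcongr with m
        · exact mul_le_of_le_one_left (abs_nonneg _) (inv_mul_le_one_of_le₀ le_rfl (by positivity))
        · exact le_of_eq (by congr)
  · have := (hε.abs).add (Tendsto.const_mul 2 h)
    simpa using this

/-- A level set of a function which is injective in the first coordinate is a Gaussian null set. -/
lemma stdGaussian_levelSet {k : ℕ} {g : (Fin (k + 1) → ℝ) → ℝ} (hg : Continuous g) (c : ℝ)
    (hinj : ∀ y : Fin k → ℝ, Function.Injective fun x : ℝ ↦ g (Fin.cons x y)) :
    (_root_.stdGaussian (k + 1)) {z | g z = c} = 0 := by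
  have hmp := measurePreserving_piFinSuccAbove (fun _ : Fin (k + 1) ↦ gaussianReal 0 1) 0
  have hS : MeasurableSet {z | g z = c} := (isClosed_eq hg continuous_const).measurableSet
  have e := hmp.symm.measure_preimage hS.nullMeasurableSet
  rw [_root_.stdGaussian, ← e, Measure.prod_apply_symm (hmp.symm.measurable hS)]
  refine lintegral_eq_zero_of_ae_eq_zero (Eventually.of_forall fun y ↦ ?_)
  have hna : NullSingletonClass (gaussianReal 0 1) :=
    nullSingletonClass_gaussianReal (by norm_num)
  refine Set.Subsingleton.measure_zero (fun a ha b hb ↦ hinj y ?_) _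
  have key : ∀ a : ℝ, (MeasurableEquiv.piFinSuccAbove (fun _ : Fin (k + 1) ↦ ℝ) 0).symm (a, y) =
      Fin.cons a y := fun a ↦ by
    simp [MeasurableEquiv.piFinSuccAbove, Fin.consEquiv]
  simp only [Set.mem_preimage, Set.mem_ofPred_eq, key] at ha hb
  exact ha.trans hb.symm

lemma two_mul_min_sub_max (w x y z : ℝ) :
    2 * (min w x - max y z) = (w + x - y - z) - |w - x| - |y - z| := by
  rcases le_total w x with h1 | h1 <;> rcases le_total y z with h2 | h2 <;>
    simp only [min_eq_left, min_eq_right, max_eq_left, max_eq_right, h1, h2] <;>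
    [rw [abs_of_nonpos (sub_nonpos.mpr h1), abs_of_nonpos (sub_nonpos.mpr h2)];
     rw [abs_of_nonpos (sub_nonpos.mpr h1), abs_of_nonneg (sub_nonneg.mpr h2)];
     rw [abs_of_nonneg (sub_nonneg.mpr h1), abs_of_nonpos (sub_nonpos.mpr h2)];
     rw [abs_of_nonneg (sub_nonneg.mpr h1), abs_of_nonneg (sub_nonneg.mpr h2)]] <;> ring

/-- The joint limit law of the multiplicity of `d`, corrected by the two differences inside the
ties, and of these differences. -/
theorem TieData.tendsto_charAvg {d q₁ q₂ q₃ q₄ A B : ℕ} (h : TieData d q₁ q₂ q₃ q₄ A B)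
    (hcop : (q₁.Coprime q₂ ∧ q₃.Coprime q₄) ∧
      ((q₁.Coprime q₃ ∧ q₁.Coprime q₄) ∧ (q₂.Coprime q₃ ∧ q₂.Coprime q₄)))
    {J : ℕ → ℕ} (hJ : IsInvCount d J) (α β γ : ℝ) {u v V : ℝ} (hu : u = (A : ℝ)⁻¹)
    (hv : v = (B : ℝ)⁻¹)
    (hV : V = α ^ 2 * (2 * u + 2 * v + 2 * u ^ 2 + 2 * v ^ 2 - 8 * u * v) +
      β ^ 2 * (2 * v - 2 * v ^ 2) + γ ^ 2 * (2 * u - 2 * u ^ 2)) :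
    Tendsto (fun n : ℕ ↦ (n : ℝ)⁻¹ • ∑ m ∈ Finset.Ioc 0 n, Complex.exp (Complex.I *
      (((α * (2 * J m - 2 * (u - v) * LL n + |(omegaQ m q₁ : ℝ) - omegaQ m q₂| +
          |(omegaQ m q₃ : ℝ) - omegaQ m q₄|) + β * ((omegaQ m q₃ : ℝ) - omegaQ m q₄) +
          γ * ((omegaQ m q₁ : ℝ) - omegaQ m q₂)) / Real.sqrt (LL n) : ℝ) : ℂ)))
      atTop (nhds (Complex.exp (-(V / 2)))) := by
  obtain ⟨⟨c12, c34⟩, ⟨c13, c14⟩, c23, c24⟩ := hcop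
  have hclt := tendsto_charAvg_omegaQ ![q₁, q₂, q₃, q₄]
    (by intro j; fin_cases j; exacts [h.pp₁.pos, h.pp₂.pos, h.pp₃.pos, h.pp₄.pos])
    (by
      intro i j hij
      fin_cases i <;> fin_cases j
      exacts [absurd rfl hij, c12, c13, c14, c12.symm, absurd rfl hij, c23, c24,
        c13.symm, c23.symm, absurd rfl hij, c34, c14.symm, c24.symm, c34.symm, absurd rfl hij])
    ![α + γ, α - γ, -α + β, -α - β] (V := V) (κ := 2 * α * (u - v))
    (by
      simp only [Fin.sum_univ_four, Matrix.cons_val, h.tot₁, h.tot₂, h.tot₃, h.tot₄, ← hu, ← hv]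
      ring)
    (by
      simp only [Fin.sum_univ_four, Matrix.cons_val, h.tot₁, h.tot₂, h.tot₃, h.tot₄, ← hu, ← hv,
        Fin.reduceEq, if_true, if_false, hV]
      ring)
  have hε : Tendsto (fun n ↦ 6 * |α| / Real.sqrt (LL n)) atTop (nhds 0) :=
    (Real.tendsto_sqrt_atTop.comp tendsto_LL).const_div_atTop _
  refine tendsto_charAvg_of_negl hclt hε ((negl_invCount_deviation h hJ).mono ?_)
  refine Eventually.of_forall fun n m _ hbad hgood ↦ hbad ?_
  rw [← sub_div, abs_div, abs_of_nonneg (Real.sqrt_nonneg _)]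
  refine div_le_div_of_nonneg_right ?_ (Real.sqrt_nonneg _)
  have e := two_mul_min_sub_max (omegaQ m q₁ : ℝ) (omegaQ m q₂) (omegaQ m q₃) (omegaQ m q₄)
  simp only [Fin.sum_univ_four, Matrix.cons_val]
  have e2 : α * (2 * J m - 2 * (u - v) * LL n + |(omegaQ m q₁ : ℝ) - omegaQ m q₂| +
      |(omegaQ m q₃ : ℝ) - omegaQ m q₄|) + β * ((omegaQ m q₃ : ℝ) - omegaQ m q₄) +
      γ * ((omegaQ m q₁ : ℝ) - omegaQ m q₂) - ((α + γ) * (omegaQ m q₁ : ℝ) +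
      (α - γ) * (omegaQ m q₂ : ℝ) + (-α + β) * (omegaQ m q₃ : ℝ) + (-α - β) * (omegaQ m q₄ : ℝ) -
      2 * α * (u - v) * LL n) = 2 * α * ((J m : ℝ) - (min (omegaQ m q₁ : ℝ) (omegaQ m q₂) -
        max (omegaQ m q₃ : ℝ) (omegaQ m q₄))) := by
    linear_combination α * e
  rw [e2, abs_mul, abs_mul, abs_two]
  nlinarith [abs_nonneg α]

/-- The limit law of the multiplicity of `d` between two ties. -/
theorem TieData.tendsto_prb {d q₁ q₂ q₃ q₄ A B : ℕ} (h : TieData d q₁ q₂ q₃ q₄ A B)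
    (hcop : (q₁.Coprime q₂ ∧ q₃.Coprime q₄) ∧
      ((q₁.Coprime q₃ ∧ q₁.Coprime q₄) ∧ (q₂.Coprime q₃ ∧ q₂.Coprime q₄)))
    {J : ℕ → ℕ} (hJ : IsInvCount d J) {u v μ σ l₁ l₂ l₃ : ℝ} (hu : u = (A : ℝ)⁻¹)
    (hv : v = (B : ℝ)⁻¹) (hμ : μ = u - v) (hσ : 0 < σ) (hl₁ : 0 < l₁) (hl₂ : 0 < l₂) (hl₃ : 0 < l₃)
    (e₁ : σ ^ 2 * l₁ = 2 * u + 2 * v + 2 * u ^ 2 + 2 * v ^ 2 - 8 * u * v)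
    (e₂ : σ ^ 2 * l₂ = 2 * v - 2 * v ^ 2) (e₃ : σ ^ 2 * l₃ = 2 * u - 2 * u ^ 2) (x : ℝ) :
    Tendsto (fun n ↦ prb n fun m ↦ (J m : ℝ) ≤ μ * LL n + x * σ * Real.sqrt (LL n)) atTop
      (nhds ((_root_.stdGaussian 3 {z : Fin 3 → ℝ |
        Real.sqrt l₁ * z 0 - Real.sqrt l₂ * |z 1| - Real.sqrt l₃ * |z 2| ≤ 2 * x}).toReal)) := by
  have s₁ := Real.sq_sqrt hl₁.le
  have s₂ := Real.sq_sqrt hl₂.le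
  have s₃ := Real.sq_sqrt hl₃.le
  have p₁ := Real.sqrt_pos.mpr hl₁
  have p₂ := Real.sqrt_pos.mpr hl₂
  have p₃ := Real.sqrt_pos.mpr hl₃
  set r₁ := Real.sqrt l₁
  set r₂ := Real.sqrt l₂
  set r₃ := Real.sqrt l₃
  set X : ℕ → ℕ → EuclideanSpace ℝ (Fin 3) := fun n m ↦ !₂[
    (2 * J m - 2 * μ * LL n + |(omegaQ m q₁ : ℝ) - omegaQ m q₂| +
      |(omegaQ m q₃ : ℝ) - omegaQ m q₄|) / (Real.sqrt (LL n) * (σ * r₁)),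
    ((omegaQ m q₃ : ℝ) - omegaQ m q₄) / (Real.sqrt (LL n) * (σ * r₂)),
    ((omegaQ m q₁ : ℝ) - omegaQ m q₂) / (Real.sqrt (LL n) * (σ * r₃))] with hX
  set g : (Fin 3 → ℝ) → ℝ := fun z ↦ r₁ * z 0 - r₂ * |z 1| - r₃ * |z 2| with hg
  have hgc : Continuous g := by fun_prop
  have hnull : _root_.stdGaussian 3 (frontier {z | g z ≤ 2 * x}) = 0 := by
    refine measure_mono_null (frontier_le_subset_eq hgc continuous_const)
      (stdGaussian_levelSet hgc _ fun y a b hab ↦ ?_)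
    have hab' : r₁ * a - r₂ * |y 0| - r₃ * |y 1| = r₁ * b - r₂ * |y 0| - r₃ * |y 1| := hab
    exact mul_left_cancel₀ p₁.ne' (by linarith)
  have hmeas : MeasurableSet {z | g z ≤ 2 * x} := (isClosed_le hgc continuous_const).measurableSet
  refine (tendsto_prb_of_charFun X (fun t ↦ ?_) hmeas hnull).congr' ?_
  · have ht := h.tendsto_charAvg hcop hJ (t 0 / (σ * r₁)) (t 1 / (σ * r₂)) (t 2 / (σ * r₃))
      hu hv rfl
    have hn : ‖t‖ ^ 2 = (t 0 / (σ * r₁)) ^ 2 * (2 * u + 2 * v + 2 * u ^ 2 + 2 * v ^ 2 - 8 * u * v) +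
        (t 1 / (σ * r₂)) ^ 2 * (2 * v - 2 * v ^ 2) + (t 2 / (σ * r₃)) ^ 2 * (2 * u - 2 * u ^ 2) := by
      rw [EuclideanSpace.real_norm_sq_eq, Fin.sum_univ_three, ← e₁, ← e₂, ← e₃, ← s₁, ← s₂, ← s₃]
      field_simp
    rw [← hn] at ht
    convert ht using 7 with n m
    · simp only [hX, PiLp.inner_apply, Fin.sum_univ_three, hμ, real_inner_eq_re_inner]
      simp
      field_simp
    · push_cast; ring
  · filter_upwards [tendsto_LL.eventually_gt_atTop 0] with n hn
    have hs := Real.sqrt_pos.mpr hn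
    congr 1
    ext m
    have key : g (X n m).ofLp = (2 * J m - 2 * μ * LL n) / (Real.sqrt (LL n) * σ) := by
      simp only [hg, hX, Matrix.cons_val]
      rw [abs_div, abs_div, abs_of_pos (mul_pos hs (mul_pos hσ p₂)),
        abs_of_pos (mul_pos hs (mul_pos hσ p₃))]
      field_simp
      ring
    rw [key, div_le_iff₀ (by positivity)]
    constructor <;> intro h' <;> linarith

theorem statement11 (i : ℕ) (hi : 3 < i)
    (h1 : (UFO (i - 1)).ncard = 2) (h2 : (UFO i).ncard = 1) (h3 : (UFO (i + 1)).ncard = 2)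
    (d : ℕ) (hd : UFO i = {d}) (J : ℕ → ℕ) (hJ : IsInvCount d J)
    (a b c lam1 lam2 lam3 : ℝ)
    (ha : a = sigAB i 2 1 ^ 2 / sigSeq i ^ 2)
    (hb : b = sigAB i 1 2 ^ 2 / sigSeq i ^ 2)
    (hc : c = sigAB i 2 2 ^ 2 / sigSeq i ^ 2)
    (hl1 : lam1 = 1 + a + b + c) (hl2 : lam2 = 1 + a - b - c) (hl3 : lam3 = 1 - a + b - c) :
    ∀ x : ℝ, Filter.Tendsto
      (fun n : ℕ => ((cnt (fun m =>
          (J m : ℝ) ≤ muSeq i * LL n + x * sigSeq i * Real.sqrt (LL n)) n : ℝ)) / n)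
      Filter.atTop
      (nhds ((stdGaussian 3 {z : Fin 3 → ℝ |
        Real.sqrt lam1 * z 0 - Real.sqrt lam2 * |z 1| - Real.sqrt lam3 * |z 2| ≤ 2 * x}).toReal)) := by
  intro x
  have hA3 := three_le_totient_qt hi
  have hT := tieData_of_ncard_UFO hi h1 h3 hd
  have hcop := hT.coprime hA3 (fun h ↦ by have := qt_inj (by omega) (by omega) h; omega)
    (fun h ↦ by have := qt_inj (by omega) (by omega) h; omega)
  have hAB := hT.A_lt_B
  set u : ℝ := ((qt i).totient : ℝ)⁻¹ with hu
  set v : ℝ := ((qt (i + 1)).totient : ℝ)⁻¹ with hv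
  have hAR : (3 : ℝ) ≤ (qt i).totient := by exact_mod_cast hA3
  have hABR : ((qt i).totient : ℝ) < (qt (i + 1)).totient := by exact_mod_cast hAB
  have hv0 : 0 < v := inv_pos.mpr (by linarith)
  have hvu : v < u := inv_strictAnti₀ (by linarith) hABR
  have hu1 : u < 1 := inv_lt_one_of_one_lt₀ (by linarith)
  have hu0 : 0 < u := hv0.trans hvu
  have hv1 : v < 1 := hvu.trans hu1
  have f1 : 1 / phiQ i = u := one_div _
  have f2 : 1 / phiQ (i + 1) = v := one_div _
  have f3 : 2 / (phiQ i * phiQ (i + 1)) = 2 * (u * v) := by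
    rw [← f1, ← f2, one_div_mul_one_div, mul_one_div]
  have hσpos : 0 < u + v - 2 * (u * v) := by
    linarith [mul_pos hu0 (sub_pos.mpr hv1), mul_pos hv0 (sub_pos.mpr hu1)]
  have hσ2 : sigSeq i ^ 2 = u + v - 2 * (u * v) := by
    rw [sigSeq, f1, f2, f3, Real.sq_sqrt hσpos.le]
  have hσ : 0 < sigSeq i := by
    rw [sigSeq, f1, f2, f3]
    exact Real.sqrt_pos.mpr hσpos
  have hs : ∀ k l : ℕ, sigAB i k l = Real.sqrt (u ^ k + v ^ l - 2 * (u * v)) := fun k l ↦ by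
    rw [sigAB, f3, ← one_div_pow, ← one_div_pow, f1, f2]
  have h21 : sigAB i 2 1 ^ 2 = u ^ 2 + v - 2 * (u * v) := by
    rw [hs, pow_one, Real.sq_sqrt]
    linarith [sq_nonneg (u - v), mul_pos hv0 (sub_pos.mpr hv1)]
  have h12 : sigAB i 1 2 ^ 2 = u + v ^ 2 - 2 * (u * v) := by
    rw [hs, pow_one, Real.sq_sqrt]
    linarith [sq_nonneg (u - v), mul_pos hu0 (sub_pos.mpr hu1)]
  have h22 : sigAB i 2 2 ^ 2 = u ^ 2 + v ^ 2 - 2 * (u * v) := by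
    rw [hs, Real.sq_sqrt]
    linarith [sq_nonneg (u - v)]
  have hσne : sigSeq i ^ 2 ≠ 0 := (pow_pos hσ 2).ne'
  have ha' : sigSeq i ^ 2 * a = u ^ 2 + v - 2 * (u * v) := by rw [ha, mul_div_cancel₀ _ hσne, h21]
  have hb' : sigSeq i ^ 2 * b = u + v ^ 2 - 2 * (u * v) := by rw [hb, mul_div_cancel₀ _ hσne, h12]
  have hc' : sigSeq i ^ 2 * c = u ^ 2 + v ^ 2 - 2 * (u * v) := by
    rw [hc, mul_div_cancel₀ _ hσne, h22]
  have e₁ : sigSeq i ^ 2 * lam1 = 2 * u + 2 * v + 2 * u ^ 2 + 2 * v ^ 2 - 8 * u * v := by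
    rw [hl1]; linear_combination hσ2 + ha' + hb' + hc'
  have e₂ : sigSeq i ^ 2 * lam2 = 2 * v - 2 * v ^ 2 := by
    rw [hl2]; linear_combination hσ2 + ha' - hb' - hc'
  have e₃ : sigSeq i ^ 2 * lam3 = 2 * u - 2 * u ^ 2 := by
    rw [hl3]; linear_combination hσ2 - ha' + hb' - hc'
  have hpos : ∀ {l : ℝ}, 0 < sigSeq i ^ 2 * l → 0 < l := fun h ↦
    (mul_pos_iff_of_pos_left (pow_pos hσ 2)).mp h
  refine hT.tendsto_prb hcop hJ hu hv ?_ hσ (hpos ?_) (hpos ?_) (hpos ?_) e₁ e₂ e₃ x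
  · rw [muSeq, f1, f2]
  · rw [e₁]
    linarith [sq_nonneg (u - v), mul_pos hu0 (sub_pos.mpr hv1), mul_pos hv0 (sub_pos.mpr hu1)]
  · rw [e₂]
    linarith [mul_pos hv0 (sub_pos.mpr hv1)]
  · rw [e₃]
    linarith [mul_pos hu0 (sub_pos.mpr hu1)]

end
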